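/- There exist constants ρ₀ ∈ (0,1) and K > 0, depending only on n, λ and Λ, such that if g ∈ M_{λ,Λ} and u is a solution of the Ginzburg–Landau equation −Δ_g u = ε⁻²(1−|u|²)u on B₁ satisfying ∫_{B₁} e_ε(u) dvol_g ≤ η |log ε| for some η > 0, then for every δ < min{1/4, ρ₀} and every ε < δ², there exists a radius r₀ ∈ (ε^{1/2}, δ) such that: (i) r₀^{2−n} ∫_{B_{r₀}} (1−|u|²)²/(2ε²) dvol_g ≤ K η |log δ|; (ii) ∫_{δ r₀}^{r₀} s^{1−n} ( ∫_{B_s} (1−|u|²)²/(2ε²) dvol_g ) ds + ∫_{B_{r₀}∖B_{δ r₀}} |x|^{2−n} |∇_r u(x)|² √(det g(x)) dx ≤ K η |log δ|; (iii) r₀^{2−n} ∫_{B_{r₀}} e_ε(u) dvol_g ≤ K (δ r₀)^{2−n} ∫_{B_{δ r₀}} e_ε(u) dvol_g + K η |log δ|. -/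

import Mathlib

open MeasureTheory Metric

noncomputable section

/-- `n`-dimensional Euclidean space. -/
abbrev Euc (n : ℕ) : Type := EuclideanSpace ℝ (Fin n)

/-- The real inner product of two complex numbers, viewing `ℂ ≅ ℝ²`. -/
def rdot (v w : ℂ) : ℝ := v.re * w.re + v.im * w.im

/-- The `i`-th partial derivative of a function on Euclidean space. -/
def pd {n : ℕ} (u : Euc n → ℂ) (i : Fin n) (x : Euc n) : ℂ :=
  fderiv ℝ u x (EuclideanSpace.single i 1)

/-- `√(det g)`. -/
def sqrtDet {n : ℕ} (g : Euc n → Matrix (Fin n) (Fin n) ℝ) (x : Euc n) : ℝ :=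
  Real.sqrt (g x).det

/-- `g^{ij} ∂_i u · ∂_j u`, the squared norm of the gradient of `u` with respect to `g`. -/
def gradSq {n : ℕ} (g : Euc n → Matrix (Fin n) (Fin n) ℝ) (u : Euc n → ℂ) (x : Euc n) : ℝ :=
  ∑ i, ∑ j, (g x)⁻¹ i j * rdot (pd u i x) (pd u j x)

/-- The Ginzburg–Landau energy density `e_ε(u)`. -/
def eDen {n : ℕ} (g : Euc n → Matrix (Fin n) (Fin n) ℝ) (ε : ℝ) (u : Euc n → ℂ)
    (x : Euc n) : ℝ :=
  gradSq g u x / 2 + (1 - ‖u x‖ ^ 2) ^ 2 / (4 * ε ^ 2)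

/-- The class `M_{λ,Λ}` of Lipschitz metrics on the unit ball: symmetric positive definite,
equal to the identity at `0`, Lipschitz components, and uniformly elliptic. -/
def MemM (n : ℕ) (lam Lam : ℝ) (g : Euc n → Matrix (Fin n) (Fin n) ℝ) : Prop :=
  g 0 = 1 ∧
  (∀ x ∈ ball (0 : Euc n) 1, (g x).IsSymm ∧ (g x).PosDef) ∧
  (∀ i j : Fin n,
    LipschitzOnWith (Real.toNNReal Lam) (fun x => g x i j) (ball (0 : Euc n) 1)) ∧
  (∀ x ∈ ball (0 : Euc n) 1, ∀ ξ : Fin n → ℝ,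
    lam * ∑ i, ξ i ^ 2 ≤ ∑ i, ∑ j, g x i j * ξ i * ξ j ∧
    ∑ i, ∑ j, g x i j * ξ i * ξ j ≤ lam⁻¹ * ∑ i, ξ i ^ 2)

/-- A weak solution `u ∈ W^{1,2}(B₁; ℂ)`, `|u| ≤ 1`, of the Ginzburg–Landau equation
`−Δ_g u = ε⁻²(1−|u|²)u` on the unit ball. -/
def IsGLSol (n : ℕ) (g : Euc n → Matrix (Fin n) (Fin n) ℝ) (ε : ℝ) (u : Euc n → ℂ) : Prop :=
  DifferentiableOn ℝ u (ball (0 : Euc n) 1) ∧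
  (∀ x ∈ ball (0 : Euc n) 1, ‖u x‖ ≤ 1) ∧
  IntegrableOn (fun x => eDen g ε u x * sqrtDet g x) (ball (0 : Euc n) 1) ∧
  ∀ ζ : Euc n → ℂ, ContDiff ℝ 1 ζ → tsupport ζ ⊆ ball (0 : Euc n) 1 →
    ∫ x in ball (0 : Euc n) 1,
      ((∑ i, ∑ j, (g x)⁻¹ i j * rdot (pd u i x) (pd ζ j x))
        - (1 - ‖u x‖ ^ 2) / ε ^ 2 * rdot (u x) (ζ x)) * sqrtDet g x = 0

/-- The radial derivative `∇_r u(x) = g^{ij}(x) (x_i/|x|) ∂_j u(x)`. -/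
def radD {n : ℕ} (g : Euc n → Matrix (Fin n) (Fin n) ℝ) (u : Euc n → ℂ) (x : Euc n) : ℂ :=
  ∑ i, ∑ j, (((g x)⁻¹ i j * (x i / ‖x‖) : ℝ) : ℂ) * pd u j x

open scoped Convolution Topology NNReal

theorem rdot_eq_inner (v w : ℂ) : rdot v w = inner ℝ v w := by
  simp [rdot, Complex.inner]; ring

section Mollify
variable {E H : Type*} [NormedAddCommGroup E] [InnerProductSpace ℝ E] [FiniteDimensional ℝ E]
  [MeasurableSpace E] [BorelSpace E] [NormedAddCommGroup H] [InnerProductSpace ℝ H]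

/-- The correlation of two square integrable functions is continuous. -/
theorem continuous_integral_inner_translate {F G : E → H} (hF : MemLp F 2 volume)
    (hG : MemLp G 2 volume) : Continuous fun y => ∫ x, inner ℝ (F x) (G (y + x)) := by
  have : Fact ((2 : ENNReal) ≠ ⊤) := ⟨by simp⟩
  have key : ∀ y : E, ∫ x, inner ℝ (F x) (G (y + x))
      = inner ℝ (hF.toLp F) (DomAddAct.mk y +ᵥ hG.toLp G) := by
    intro y
    rw [L2.inner_def]
    rw [DomAddAct.mk_vadd_toLp]
    apply integral_congr_ae
    filter_upwards [hF.coeFn_toLp, MemLp.coeFn_toLp (hG.comp_measurePreserving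
      (measurePreserving_vadd y volume))] with x h1 h2
    rw [h1]
    exact congrArg _ h2.symm
  simp_rw [key]
  have : Continuous fun y : E => DomAddAct.mk y +ᵥ hG.toLp G := by
    have h1 : Continuous fun y : E => (DomAddAct.mk y : Eᵈᵃᵃ) := DomAddAct.continuous_mk
    exact h1.vadd continuous_const
  fun_prop

theorem tendsto_integral_inner_convolution [CompleteSpace H] {F G : E → H} (hF : MemLp F 2 volume)
    (hG : MemLp G 2 volume) {φ : ℕ → ContDiffBump (0 : E)}
    (hφ : Filter.Tendsto (fun i => (φ i).rOut) Filter.atTop (𝓝 0)) :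
    Filter.Tendsto (fun i => ∫ x, inner ℝ (F x)
      (((φ i).normed volume ⋆[ContinuousLinearMap.lsmul ℝ ℝ, volume] G) x)) Filter.atTop
      (𝓝 (∫ x, inner ℝ (F x) (G x))) := by
  set h : E → ℝ := fun y => ∫ x, inner ℝ (F x) (G (y + x)) with hh
  have hc : Continuous h := continuous_integral_inner_translate hF hG
  have h2 := ContDiffBump.convolution_tendsto_right_of_continuous (μ := (volume : Measure E)) hφ
    hc 0
  have h0 : h 0 = ∫ x, inner ℝ (F x) (G x) := by simp [hh]
  rw [h0] at h2
  refine h2.congr fun i => ?_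
  set ρ := (φ i).normed (volume : Measure E) with hρ
  have hρc : Continuous ρ := (φ i).continuous_normed
  have hρs : HasCompactSupport ρ := (φ i).hasCompactSupport_normed
  have hρi : Integrable ρ volume := hρc.integrable_of_hasCompactSupport hρs
  have hG2 : Integrable (fun x => ‖G x‖ ^ 2) volume := hG.integrable_norm_pow (by norm_num)
  have hF2 : Integrable (fun x => ‖F x‖ ^ 2) volume := hF.integrable_norm_pow (by norm_num)
  have hint : Integrable (Function.uncurry fun x y => inner ℝ (F x) (ρ y • G (x - y)))
      (volume.prod volume) := by
    have i1 := (hF2.mul_prod hρi.norm)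
    have i2 := (hρi.norm.convolution_integrand (ContinuousLinearMap.mul ℝ ℝ) hG2)
    refine (i1.add i2).mono' ?_ ?_
    · exact hF.1.comp_fst.inner (𝕜 := ℝ)
        (hρi.1.convolution_integrand (ContinuousLinearMap.lsmul ℝ ℝ) hG.1)
    · refine Filter.Eventually.of_forall fun ⟨x, y⟩ => ?_
      simp only [Function.uncurry, Pi.add_apply, ContinuousLinearMap.mul_apply']
      refine (norm_inner_le_norm _ _).trans ?_
      rw [norm_smul]
      nlinarith [norm_nonneg (ρ y), sq_nonneg (‖F x‖ - ‖G (x - y)‖), norm_nonneg (F x),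
        norm_nonneg (G (x - y)), mul_nonneg (norm_nonneg (ρ y)) (sq_nonneg (‖F x‖ - ‖G (x - y)‖)),
        mul_nonneg (norm_nonneg (ρ y)) (sq_nonneg (‖F x‖ + ‖G (x - y)‖))]
  simp only [convolution, ContinuousLinearMap.lsmul_apply, zero_sub]
  have e1 : ∀ᵐ x, ∫ y, inner ℝ (F x) (ρ y • G (x - y)) =
      inner ℝ (F x) (∫ y, ρ y • G (x - y)) := by
    have i3 : ∀ᵐ x, Integrable (fun y => ρ y • G (x - y)) volume :=
      Filter.Eventually.of_forall fun x => hρs.convolutionExists_left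
        (ContinuousLinearMap.lsmul ℝ ℝ) hρc (hG.locallyIntegrable (by norm_num)) x
    filter_upwards [i3] with x hx
    exact integral_inner hx _
  rw [← integral_congr_ae e1, integral_integral_swap hint]
  refine integral_congr_ae (Filter.Eventually.of_forall fun y => ?_)
  simp only [hh, inner_smul_right, smul_eq_mul, integral_const_mul]
  congr 2
  ext x
  rw [neg_add_eq_sub]
end Mollify

theorem pd_normed_convolution {n : ℕ} (φ : ContDiffBump (0 : Euc n)) {d : Euc n → ℂ}
    (hd : Differentiable ℝ d) (hdi : ∀ j, LocallyIntegrable (pd d j) volume) (j : Fin n)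
    (x₀ : Euc n) :
    pd (φ.normed volume ⋆[ContinuousLinearMap.lsmul ℝ ℝ, volume] d) j x₀ =
      (φ.normed volume ⋆[ContinuousLinearMap.lsmul ℝ ℝ, volume] (pd d j)) x₀ := by
  set ρ := φ.normed (volume : Measure (Euc n)) with hρ
  have hρc : ContDiff ℝ 1 ρ := φ.contDiff_normed
  have hρs : HasCompactSupport ρ := φ.hasCompactSupport_normed
  have hdl : LocallyIntegrable d volume := hd.continuous.locallyIntegrable
  rw [pd, (hρs.hasFDerivAt_convolution_left (ContinuousLinearMap.lsmul ℝ ℝ) hρc hdl x₀).fderiv]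
  have hex := hρs.fderiv (𝕜 := ℝ) |>.convolutionExists_left
    ((ContinuousLinearMap.lsmul ℝ ℝ : ℝ →L[ℝ] ℂ →L[ℝ] ℂ).precompL (Euc n))
    (hρc.continuous_fderiv one_ne_zero) hdl x₀
  rw [convolution_def, ContinuousLinearMap.integral_apply hex, convolution_def]
  have hderiv : ∀ t, HasFDerivAt (fun t => d (x₀ - t)) (-(fderiv ℝ d (x₀ - t))) t := by
    intro t
    have := (hd (x₀ - t)).hasFDerivAt.comp t ((hasFDerivAt_id t).const_sub x₀)
    convert! this using 1
    ext v
    simp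
  have ibp := integral_bilinear_hasFDerivAt_right_eq_neg_left_of_integrable
    (μ := (volume : Measure (Euc n))) (f := ρ) (f' := fderiv ℝ ρ)
    (g := fun t => d (x₀ - t)) (g' := fun t => -(fderiv ℝ d (x₀ - t)))
    (v := EuclideanSpace.single j 1) (B := (ContinuousLinearMap.lsmul ℝ ℝ : ℝ →L[ℝ] ℂ →L[ℝ] ℂ))
    ?_ ?_ ?_ (fun x _ => (hρc.differentiable one_ne_zero x).hasFDerivAt) (fun x _ => hderiv x)
  · have e1 : ∀ t, ((ContinuousLinearMap.lsmul ℝ ℝ : ℝ →L[ℝ] ℂ →L[ℝ] ℂ) (ρ t))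
        ((-(fderiv ℝ d (x₀ - t))) (EuclideanSpace.single j 1)) =
        - (ContinuousLinearMap.lsmul ℝ ℝ (ρ t) (pd d j (x₀ - t))) := by
      intro t; simp [pd]
    simp_rw [e1, integral_neg, neg_inj] at ibp
    rw [ibp]
    rfl
  · have := hρs.fderiv_apply (𝕜 := ℝ) (EuclideanSpace.single j 1) |>.convolutionExists_left
      (ContinuousLinearMap.lsmul ℝ ℝ : ℝ →L[ℝ] ℂ →L[ℝ] ℂ)
      ((hρc.continuous_fderiv one_ne_zero).clm_apply continuous_const) hdl x₀
    exact this
  · have := hρs.convolutionExists_left (ContinuousLinearMap.lsmul ℝ ℝ : ℝ →L[ℝ] ℂ →L[ℝ] ℂ)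
      hρc.continuous (hdi j) x₀
    refine this.neg.congr (Filter.Eventually.of_forall fun t => ?_)
    simp [pd]
  · exact hρs.convolutionExists_left (ContinuousLinearMap.lsmul ℝ ℝ : ℝ →L[ℝ] ℂ →L[ℝ] ℂ)
      hρc.continuous hdl x₀

theorem weak_form_extends {n : ℕ} {F : Fin n → Euc n → ℂ} {h : Euc n → ℂ}
    (hF : ∀ j, MemLp (F j) 2 volume) (hh : MemLp h 2 volume)
    (hw : ∀ ζ : Euc n → ℂ, ContDiff ℝ 1 ζ → tsupport ζ ⊆ ball (0 : Euc n) 1 →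
      (∑ j, ∫ x, inner ℝ (F j x) (pd ζ j x)) - ∫ x, inner ℝ (h x) (ζ x) = 0)
    {d : Euc n → ℂ} (hd : Differentiable ℝ d) {b : ℝ} (hb : b < 1)
    (hds : tsupport d ⊆ closedBall 0 b) (hd' : ∀ j, MemLp (pd d j) 2 volume) :
    (∑ j, ∫ x, inner ℝ (F j x) (pd d j x)) - ∫ x, inner ℝ (h x) (d x) = 0 := by
  have hdc : HasCompactSupport d :=
    (isCompact_closedBall (0 : Euc n) b).of_isClosed_subset (isClosed_tsupport d) hds
  have hd2 : MemLp d 2 volume := hd.continuous.memLp_of_hasCompactSupport hdc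
  let φ : ℕ → ContDiffBump (0 : Euc n) := fun i =>
    ⟨(1 - b) / 4 / (i + 1), (1 - b) / 2 / (i + 1), by have : 0 < 1 - b := by linarith
                                                      positivity,
      by have : 0 < 1 - b := by linarith
         gcongr; norm_num⟩
  have hφ : Filter.Tendsto (fun i => (φ i).rOut) Filter.atTop (𝓝 0) := by
    have := (tendsto_const_div_atTop_nhds_zero_nat ((1 - b) / 2)).comp
      (Filter.tendsto_add_atTop_nat 1)
    refine this.congr fun i => ?_
    simp [φ]
  have t1 := (tendsto_finsetSum Finset.univ fun j _ =>
    tendsto_integral_inner_convolution (hF j) (hd' j) hφ).sub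
    (tendsto_integral_inner_convolution hh hd2 hφ)
  refine tendsto_nhds_unique t1 (tendsto_const_nhds.congr fun i => ?_)
  rw [← hw ((φ i).normed volume ⋆[ContinuousLinearMap.lsmul ℝ ℝ, volume] d)]
  · congr 1
    refine Finset.sum_congr rfl fun j _ => ?_
    congr 1
    ext x
    rw [pd_normed_convolution (φ i) hd fun j => (hd' j).locallyIntegrable (by norm_num)]
  · exact (φ i).hasCompactSupport_normed.contDiff_convolution_left _ (φ i).contDiff_normed
      hd.continuous.locallyIntegrable
  · have hsub : Function.support
        ((φ i).normed volume ⋆[ContinuousLinearMap.lsmul ℝ ℝ, volume] d) ⊆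
        closedBall 0 ((1 + b) / 2) := by
      refine (support_convolution_subset _).trans ?_
      rintro _ ⟨y, hy, z, hz, rfl⟩
      rw [(φ i).support_normed_eq] at hy
      have hz' := hds (subset_tsupport d hz)
      have hr : (φ i).rOut ≤ (1 - b) / 2 := by
        refine div_le_self (by linarith) ?_
        simp
      simp only [mem_ball_zero_iff, mem_closedBall_zero_iff] at hy hz' ⊢
      refine (norm_add_le y z).trans ?_
      linarith
    refine (closure_minimal hsub isClosed_closedBall).trans (closedBall_subset_ball (by linarith))

section Deformation
variable {E : Type*} [NormedAddCommGroup E] [InnerProductSpace ℝ E]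

/-- The rank one perturbation `h ↦ α h + c ⟨x, h⟩ x` of a multiple of the identity. -/
def scaleRankOne (α c : ℝ) (x : E) : E →L[ℝ] E :=
  α • ContinuousLinearMap.id ℝ E + c • (innerSL ℝ x).smulRight x

theorem scaleRankOne_apply (α c : ℝ) (x h : E) :
    scaleRankOne α c x h = α • h + (c * inner ℝ x h) • x := by
  simp [scaleRankOne, smul_smul]

/-- `scaleRankOne` as an equivalence, when both of its eigenvalues are nonzero. -/
def scaleRankOneEquiv (α c : ℝ) (x : E) (hα : α ≠ 0) (hβ : α + c * ‖x‖ ^ 2 ≠ 0) : E ≃L[ℝ] E :=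
  ContinuousLinearEquiv.equivOfInverse (scaleRankOne α c x)
    (scaleRankOne α⁻¹ (-(c / (α * (α + c * ‖x‖ ^ 2)))) x)
    (fun h => by
      simp only [scaleRankOne_apply, smul_add, smul_smul, inner_add_right, inner_smul_right,
        real_inner_self_eq_norm_sq]
      rw [inv_mul_cancel₀ hα, one_smul, add_assoc, ← add_smul, add_eq_left]
      convert zero_smul ℝ x
      field_simp
      ring)
    (fun h => by
      simp only [scaleRankOne_apply, smul_add, smul_smul, inner_add_right, inner_smul_right,
        real_inner_self_eq_norm_sq]
      rw [mul_inv_cancel₀ hα, one_smul, add_assoc, ← add_smul, add_eq_left]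
      convert zero_smul ℝ x
      field_simp
      ring)

theorem det_scaleRankOne [FiniteDimensional ℝ E] {α : ℝ} (hα : α ≠ 0) (c : ℝ) (x : E)
    {m : ℕ} (hm : Module.finrank ℝ E = m + 1) :
    (scaleRankOne α c x).det = α ^ m * (α + c * ‖x‖ ^ 2) := by
  have e : ((scaleRankOne α c x : E →L[ℝ] E) : E →ₗ[ℝ] E) =
      α • LinearMap.transvection ((innerSL ℝ x : E →L[ℝ] ℝ) : E →ₗ[ℝ] ℝ) ((c / α) • x) := by
    ext h
    simp only [ContinuousLinearMap.coe_coe, scaleRankOne_apply, LinearMap.smul_apply,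
      LinearMap.transvection.apply, smul_add, smul_smul, innerSL_apply_apply]
    congr 2
    field_simp
  rw [ContinuousLinearMap.det, e, LinearMap.det_smul, LinearMap.transvection.det, hm]
  simp only [ContinuousLinearMap.coe_coe, innerSL_apply_apply, inner_smul_right,
    real_inner_self_eq_norm_sq]
  field_simp
  ring

/-- The scalar profile of the radial vector field with `χ' = -q / 2` and `χ 1 = 0`. -/
def profile (q : ℝ → ℝ) (z : ℝ) : ℝ := (∫ y in z..1, q y) / 2

theorem hasDerivAt_profile {q : ℝ → ℝ} (hq : Continuous q) (z : ℝ) :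
    HasDerivAt (profile q) (-q z / 2) z :=
  (intervalIntegral.integral_hasDerivAt_left (hq.intervalIntegrable _ _)
    (hq.stronglyMeasurableAtFilter _ _) hq.continuousAt).div_const 2

theorem profile_eq_zero {q : ℝ → ℝ} {β : ℝ} (hβ : β ≤ 1) (hq0 : ∀ z, β ≤ z → q z = 0) {z : ℝ}
    (hz : β ≤ z) : profile q z = 0 := by
  rw [profile, intervalIntegral.integral_congr (g := fun _ => (0 : ℝ))]
  · simp
  · intro y hy
    exact hq0 y ((le_min hz hβ).trans hy.1)

theorem exists_profile_bound {q : ℝ → ℝ} (hq : Continuous q) {β : ℝ} (hβ : β ≤ 1)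
    (hq0 : ∀ z, β ≤ z → q z = 0) :
    ∃ X : ℝ, 0 < X ∧ ∀ z, 0 ≤ z → |profile q z| ≤ X ∧ |q z| ≤ X := by
  have hc : Continuous (profile q) :=
    continuous_iff_continuousAt.2 fun z => (hasDerivAt_profile hq z).continuousAt
  obtain ⟨C1, h1⟩ := (isCompact_Icc (a := (0 : ℝ)) (b := 1)).exists_bound_of_continuousOn
    hc.continuousOn
  obtain ⟨C2, h2⟩ := (isCompact_Icc (a := (0 : ℝ)) (b := 1)).exists_bound_of_continuousOn
    hq.continuousOn
  refine ⟨max 1 (max C1 C2), by positivity, fun z hz => ?_⟩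
  rcases le_total z 1 with hz1 | hz1
  · exact ⟨(h1 z ⟨hz, hz1⟩).trans (by simp), (h2 z ⟨hz, hz1⟩).trans (by simp)⟩
  · rw [profile_eq_zero hβ hq0 (hβ.trans hz1), hq0 z (hβ.trans hz1)]
    simp

theorem hasFDerivAt_radial {q : ℝ → ℝ} (hq : Continuous q) (t : ℝ) (x : E) :
    HasFDerivAt (fun x : E => (1 - t * profile q (‖x‖ ^ 2)) • x)
      (scaleRankOne (1 - t * profile q (‖x‖ ^ 2)) (t * q (‖x‖ ^ 2)) x) x := by
  have h1 : HasFDerivAt (fun x : E => ‖x‖ ^ 2) (2 • innerSL ℝ x) x :=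
    (hasStrictFDerivAt_norm_sq x).hasFDerivAt
  have h2 := ((hasDerivAt_profile hq (‖x‖ ^ 2)).comp_hasFDerivAt x h1)
  have h3 := ((h2.const_mul t).const_sub 1).smul (hasFDerivAt_id x)
  convert! h3 using 1
  ext h
  simp only [scaleRankOne_apply, add_apply, smul_apply,
    ContinuousLinearMap.smulRight_apply, neg_apply, innerSL_apply_apply,
    ContinuousLinearMap.id_apply, id, Function.comp]
  congr 2
  simp
  ring

theorem exists_radial_homeomorph [CompleteSpace E] {q : ℝ → ℝ} (hq : Continuous q) {β : ℝ}
    (hβ : β ≤ 1) (hq0 : ∀ z, β ≤ z → q z = 0) :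
    ∃ t₀ : ℝ, 0 < t₀ ∧ t₀ ≤ 1 ∧ ∀ t, 0 < t → t < t₀ →
      (∀ z, 0 ≤ z → 1 / 2 ≤ 1 - t * profile q z) ∧
      (∀ z, 0 ≤ z → 1 / 2 ≤ 1 - t * profile q z + t * q z * z) ∧
      ∃ Ψ : E ≃ₜ E, (∀ x, Ψ x = (1 - t * profile q (‖x‖ ^ 2)) • x) ∧
        ∀ y, DifferentiableAt ℝ Ψ.symm y := by
  obtain ⟨X, hX, hb⟩ := exists_profile_bound hq hβ hq0
  refine ⟨min 1 (1 / (4 * X)), by positivity, min_le_left _ _, fun t ht htt => ?_⟩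
  have htX : t * X ≤ 1 / 4 := by
    have := (htt.trans_le (min_le_right _ _)).le
    rw [le_div_iff₀ (by positivity)] at this
    linarith
  have hα : ∀ z, 0 ≤ z → 3 / 4 ≤ 1 - t * profile q z := fun z hz => by
    have := (abs_le.1 (hb z hz).1).2
    nlinarith
  have hβ' : ∀ z, 0 ≤ z → 1 / 2 ≤ 1 - t * profile q z + t * q z * z := fun z hz => by
    rcases le_total z 1 with h1 | h1
    · have h2 := hα z hz
      have h3 := (abs_le.1 (hb z hz).2).1
      have h4 : -X ≤ q z * z := by nlinarith
      nlinarith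
    · rw [hq0 z (hβ.trans h1)]
      linarith [hα z hz]
  refine ⟨fun z hz => by linarith [hα z hz], hβ', ?_⟩
  have hlip : LipschitzWith (1 / 2 : ℝ≥0)
      (fun x : E => (1 - t * profile q (‖x‖ ^ 2)) • x - x) := by
    have hD : ∀ x, HasFDerivAt (fun x : E => (1 - t * profile q (‖x‖ ^ 2)) • x - x)
        (scaleRankOne (1 - t * profile q (‖x‖ ^ 2)) (t * q (‖x‖ ^ 2)) x -
          ContinuousLinearMap.id ℝ E) x := fun x =>
      (hasFDerivAt_radial hq t x).sub (hasFDerivAt_id x)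
    refine lipschitzWith_of_nnnorm_fderiv_le (𝕜 := ℝ)
      (fun x => (hD x).differentiableAt) fun x => ?_
    rw [← NNReal.coe_le_coe, coe_nnnorm, (hD x).fderiv]
    refine ContinuousLinearMap.opNorm_le_bound _ (by simp) fun h => ?_
    rw [sub_apply, scaleRankOne_apply, ContinuousLinearMap.id_apply]
    have e : (1 - t * profile q (‖x‖ ^ 2)) • h + (t * q (‖x‖ ^ 2) * inner ℝ x h) • x - h
      = (t * q (‖x‖ ^ 2) * inner ℝ x h) • x - (t * profile q (‖x‖ ^ 2)) • h := by
      rw [sub_smul, one_smul]; abel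
    rw [e]
    refine (norm_sub_le _ _).trans ?_
    rw [norm_smul, norm_smul, Real.norm_eq_abs, Real.norm_eq_abs, abs_mul, abs_mul, abs_mul,
      abs_of_pos ht]
    have h1 := hb (‖x‖ ^ 2) (by positivity)
    have h2 : |q (‖x‖ ^ 2)| * (‖x‖ * ‖x‖) ≤ X := by
      rcases le_total ‖x‖ 1 with hx | hx
      · nlinarith [h1.2, abs_nonneg (q (‖x‖ ^ 2)), norm_nonneg x,
          mul_le_one₀ hx (norm_nonneg x) hx]
      · rw [hq0 _ (hβ.trans (by nlinarith))]
        simpa using hX.le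
    have h3 := abs_real_inner_le_norm x h
    have h4 : t * |q (‖x‖ ^ 2)| * |inner ℝ x h| * ‖x‖ ≤ t * X * ‖h‖ := by
      calc t * |q (‖x‖ ^ 2)| * |inner ℝ x h| * ‖x‖
          ≤ t * |q (‖x‖ ^ 2)| * (‖x‖ * ‖h‖) * ‖x‖ := by gcongr
        _ = t * (|q (‖x‖ ^ 2)| * (‖x‖ * ‖x‖)) * ‖h‖ := by ring
        _ ≤ _ := by gcongr
    have h5 : t * |profile q (‖x‖ ^ 2)| * ‖h‖ ≤ t * X * ‖h‖ := by
      gcongr; exact h1.1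
    have h6 : t * X * ‖h‖ ≤ 1 / 4 * ‖h‖ := by gcongr
    push_cast
    linarith
  have happ : ApproximatesLinearOn (fun x : E => (1 - t * profile q (‖x‖ ^ 2)) • x)
      ((ContinuousLinearEquiv.refl ℝ E : E ≃L[ℝ] E) : E →L[ℝ] E) Set.univ (1 / 2) :=
    (hlip.lipschitzOnWith (s := Set.univ)).approximatesLinearOn
  have hc : Subsingleton E ∨
      (1 / 2 : ℝ≥0) < ‖((ContinuousLinearEquiv.refl ℝ E).symm : E →L[ℝ] E)‖₊⁻¹ := by
    rcases subsingleton_or_nontrivial E with h | h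
    · exact Or.inl h
    · right
      have : ‖((ContinuousLinearEquiv.refl ℝ E).symm : E →L[ℝ] E)‖₊ = 1 := by
        ext; exact ContinuousLinearMap.norm_id
      rw [this]
      simpa using half_lt_self (zero_lt_one' ℝ≥0)
  let Ψ := happ.toHomeomorph _ hc
  have hΨ : ∀ x, Ψ x = (1 - t * profile q (‖x‖ ^ 2)) • x := fun x => rfl
  refine ⟨Ψ, hΨ, fun y => ?_⟩
  set x := Ψ.symm y
  have hpos : (0 : ℝ) ≤ ‖x‖ ^ 2 := by positivity
  have hD : HasFDerivAt Ψ ((scaleRankOneEquiv (1 - t * profile q (‖x‖ ^ 2)) (t * q (‖x‖ ^ 2)) x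
      (by linarith [hα _ hpos] ) (by linarith [hβ' _ hpos]) : E ≃L[ℝ] E) : E →L[ℝ] E) x :=
    hasFDerivAt_radial hq t x
  exact (HasFDerivAt.of_local_left_inverse Ψ.symm.continuous.continuousAt hD
    (Filter.Eventually.of_forall fun y => Ψ.apply_symm_apply y)).differentiableAt

end Deformation

section Coefficients

theorem contDiff_det {ι E : Type*} [Fintype ι] [DecidableEq ι] [NormedAddCommGroup E]
    [NormedSpace ℝ E] {M : E → Matrix ι ι ℝ} (hM : ∀ i j, ContDiff ℝ 1 fun x => M x i j) :
    ContDiff ℝ 1 fun x => (M x).det := by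
  simp only [Matrix.det_apply']
  exact ContDiff.sum fun σ _ => contDiff_const.mul (contDiff_prod fun i _ => hM _ _)

/-- The compact convex set of symmetric matrices with entries bounded by `M`, whose quadratic
form is bounded below by `lam`. -/
def ellipticSet (n : ℕ) (lam M : ℝ) : Set (Fin n → Fin n → ℝ) :=
  {A | (∀ i j, A i j = A j i) ∧ (∀ i j, |A i j| ≤ M) ∧
    ∀ ξ : Fin n → ℝ, lam * ∑ i, ξ i ^ 2 ≤ ∑ i, ∑ j, A i j * ξ i * ξ j}

theorem convex_ellipticSet (n : ℕ) (lam M : ℝ) : Convex ℝ (ellipticSet n lam M) := by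
  rintro A ⟨hA1, hA2, hA3⟩ B ⟨hB1, hB2, hB3⟩ s t hs ht hst
  refine ⟨fun i j => ?_, fun i j => ?_, fun ξ => ?_⟩
  · simp [hA1 i j, hB1 i j]
  · simp only [Pi.add_apply, Pi.smul_apply, smul_eq_mul]
    have h1 := abs_le.1 (hA2 i j)
    have h2 := abs_le.1 (hB2 i j)
    have : M = s * M + t * M := by rw [← add_mul, hst, one_mul]
    rw [abs_le]
    constructor <;> nlinarith
  · have e : ∑ i, ∑ j, (s • A + t • B) i j * ξ i * ξ j =
        s * ∑ i, ∑ j, A i j * ξ i * ξ j + t * ∑ i, ∑ j, B i j * ξ i * ξ j := by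
      simp only [Finset.mul_sum, ← Finset.sum_add_distrib, Pi.add_apply, Pi.smul_apply,
        smul_eq_mul]
      refine Finset.sum_congr rfl fun i _ => Finset.sum_congr rfl fun j _ => by ring
    rw [e]
    have h1 := mul_le_mul_of_nonneg_left (hA3 ξ) hs
    have h2 := mul_le_mul_of_nonneg_left (hB3 ξ) ht
    have : lam * ∑ i, ξ i ^ 2 = s * (lam * ∑ i, ξ i ^ 2) + t * (lam * ∑ i, ξ i ^ 2) := by
      rw [← add_mul, hst, one_mul]
    linarith

theorem isCompact_ellipticSet (n : ℕ) (lam M : ℝ) : IsCompact (ellipticSet n lam M) := by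
  refine (isCompact_closedBall (0 : Fin n → Fin n → ℝ) |M|).of_isClosed_subset ?_ ?_
  · simp only [ellipticSet, Set.ofPred_and, Set.ofPred_forall]
    refine IsClosed.inter ?_ (IsClosed.inter ?_ ?_)
    · exact isClosed_iInter fun i => isClosed_iInter fun j =>
        isClosed_eq (by fun_prop) (by fun_prop)
    · exact isClosed_iInter fun i => isClosed_iInter fun j =>
        isClosed_le (by fun_prop) (by fun_prop)
    · exact isClosed_iInter fun ξ => isClosed_le (by fun_prop) (by fun_prop)
  · rintro A ⟨-, hA, -⟩
    rw [mem_closedBall_zero_iff, pi_norm_le_iff_of_nonneg (abs_nonneg _)]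
    intro i
    rw [pi_norm_le_iff_of_nonneg (abs_nonneg _)]
    exact fun j => (hA i j).trans (le_abs_self M)

theorem posDef_of_mem_ellipticSet {n : ℕ} {lam M : ℝ} (hlam : 0 < lam) {A : Fin n → Fin n → ℝ}
    (hA : A ∈ ellipticSet n lam M) : (Matrix.of A).PosDef := by
  refine Matrix.PosDef.of_dotProduct_mulVec_pos ?_ fun ξ hξ => ?_
  · ext i j
    simp [Matrix.conjTranspose, hA.1 j i]
  · have h1 : 0 < ∑ i, ξ i ^ 2 := by
      obtain ⟨i, hi⟩ := Function.ne_iff.1 hξ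
      exact Finset.sum_pos' (fun _ _ => sq_nonneg _) ⟨i, Finset.mem_univ i, by
        have : ξ i ≠ 0 := hi
        positivity⟩
    have h2 := hA.2.2 ξ
    have e : star ξ ⬝ᵥ (Matrix.of A).mulVec ξ = ∑ i, ∑ j, A i j * ξ i * ξ j := by
      simp only [dotProduct, Matrix.mulVec, Finset.mul_sum, star_trivial, Matrix.of_apply]
      refine Finset.sum_congr rfl fun i _ => Finset.sum_congr rfl fun j _ => by ring
    rw [e]
    exact (mul_pos hlam h1).trans_le h2

theorem det_pos_of_mem_ellipticSet {n : ℕ} {lam M : ℝ} (hlam : 0 < lam) {A : Fin n → Fin n → ℝ}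
    (hA : A ∈ ellipticSet n lam M) : 0 < (Matrix.of A).det :=
  (posDef_of_mem_ellipticSet hlam hA).det_pos

theorem contDiffOn_sqrt_det_ellipticSet {n : ℕ} {lam M : ℝ} (hlam : 0 < lam) :
    ContDiffOn ℝ 1 (fun A : Fin n → Fin n → ℝ => √(Matrix.of A).det) (ellipticSet n lam M) := by
  have h : ContDiff ℝ 1 fun A : Fin n → Fin n → ℝ => (Matrix.of A).det :=
    contDiff_det fun i j => by simpa using contDiff_apply_apply ℝ ℝ i j
  exact h.contDiffOn.sqrt fun A hA => (det_pos_of_mem_ellipticSet hlam hA).ne'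

theorem contDiffOn_inv_ellipticSet {n : ℕ} {lam M : ℝ} (hlam : 0 < lam) (i j : Fin n) :
    ContDiffOn ℝ 1 (fun A : Fin n → Fin n → ℝ => (Matrix.of A)⁻¹ i j) (ellipticSet n lam M) := by
  have h : ContDiff ℝ 1 fun A : Fin n → Fin n → ℝ => (Matrix.of A).det :=
    contDiff_det fun i j => by simpa using contDiff_apply_apply ℝ ℝ i j
  have h2 : ContDiff ℝ 1 fun A : Fin n → Fin n → ℝ => (Matrix.of A).adjugate i j := by
    simp only [Matrix.adjugate_apply]
    refine contDiff_det fun k l => ?_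
    by_cases hk : k = j
    · subst hk
      simpa using contDiff_const
    · simpa [Matrix.updateRow_apply, hk] using contDiff_apply_apply ℝ ℝ k l
  refine ((h.contDiffOn.inv fun A hA => (det_pos_of_mem_ellipticSet hlam hA).ne').mul
    h2.contDiffOn).congr fun A _ => ?_
  simp [Matrix.inv_def]

theorem exists_lipschitz_bound_ellipticSet {n : ℕ} {lam M : ℝ} {f : (Fin n → Fin n → ℝ) → ℝ}
    (hf : ContDiffOn ℝ 1 f (ellipticSet n lam M)) :
    ∃ L : ℝ, 0 ≤ L ∧ (∀ A ∈ ellipticSet n lam M, |f A| ≤ L) ∧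
      ∀ A ∈ ellipticSet n lam M, ∀ B ∈ ellipticSet n lam M, |f A - f B| ≤ L * ‖A - B‖ := by
  obtain ⟨K, hK⟩ := hf.exists_lipschitzOnWith one_ne_zero (convex_ellipticSet n lam M)
    (isCompact_ellipticSet n lam M)
  obtain ⟨C, hC⟩ := (isCompact_ellipticSet n lam M).exists_bound_of_continuousOn hf.continuousOn
  refine ⟨max K C, le_max_of_le_left K.2, fun A hA => (hC A hA).trans (le_max_right _ _),
    fun A hA B hB => ?_⟩
  have := hK.dist_le_mul A hA B hB
  rw [Real.dist_eq, dist_eq_norm] at this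
  exact this.trans (by gcongr; exact le_max_left _ _)

/-- Coefficients `a^{ij} = g^{ij} √(det g)` and `s = √(det g)` normalised at the origin, with
ellipticity constant `c`, and Lipschitz and size bounds `L`, on the unit ball. -/
structure IsCoeff {n : ℕ} (c L : ℝ) (a : Euc n → Matrix (Fin n) (Fin n) ℝ) (s : Euc n → ℝ) :
    Prop where
  a_zero : a 0 = 1
  s_zero : s 0 = 1
  symm : ∀ x ∈ ball (0 : Euc n) 1, ∀ i j, a x i j = a x j i
  elliptic : ∀ x ∈ ball (0 : Euc n) 1, ∀ ξ : Fin n → ℝ,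
    c * ∑ i, ξ i ^ 2 ≤ ∑ i, ∑ j, a x i j * ξ i * ξ j
  a_le : ∀ x ∈ ball (0 : Euc n) 1, ∀ i j, |a x i j| ≤ L
  a_lip : ∀ x ∈ ball (0 : Euc n) 1, ∀ y ∈ ball (0 : Euc n) 1, ∀ i j,
    |a x i j - a y i j| ≤ L * ‖x - y‖
  le_s : ∀ x ∈ ball (0 : Euc n) 1, c ≤ s x
  s_le : ∀ x ∈ ball (0 : Euc n) 1, s x ≤ L
  s_lip : ∀ x ∈ ball (0 : Euc n) 1, ∀ y ∈ ball (0 : Euc n) 1, |s x - s y| ≤ L * ‖x - y‖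

theorem inv_quadratic_lower_bound {n : ℕ} {lam M : ℝ} (hlam : 0 < lam) (hM : 0 < M) (hn : 0 < n)
    {A : Fin n → Fin n → ℝ} (hA : A ∈ ellipticSet n lam M) (ξ : Fin n → ℝ) :
    lam / (n ^ 2 * M ^ 2) * ∑ i, ξ i ^ 2 ≤ ∑ i, ∑ j, (Matrix.of A)⁻¹ i j * ξ i * ξ j := by
  have hdet : IsUnit (Matrix.of A).det := (det_pos_of_mem_ellipticSet hlam hA).ne'.isUnit
  set η := (Matrix.of A)⁻¹.mulVec ξ with hη
  have hξ : ξ = (Matrix.of A).mulVec η := by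
    rw [hη, Matrix.mulVec_mulVec, Matrix.mul_nonsing_inv _ hdet, Matrix.one_mulVec]
  have e1 : ∑ i, ∑ j, (Matrix.of A)⁻¹ i j * ξ i * ξ j = ∑ i, ξ i * η i := by
    simp only [hη, Matrix.mulVec, dotProduct, Finset.mul_sum]
    refine Finset.sum_congr rfl fun i _ => Finset.sum_congr rfl fun j _ => by ring
  have hξi : ∀ i, ξ i = ∑ j, A i j * η j := fun i => congrFun hξ i
  have e2 : ∑ i, ξ i * η i = ∑ i, ∑ j, A i j * η i * η j := by
    refine Finset.sum_congr rfl fun i _ => ?_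
    rw [hξi i, Finset.sum_mul]
    exact Finset.sum_congr rfl fun j _ => by ring
  rw [e1, e2]
  refine le_trans ?_ (hA.2.2 η)
  have h3 : ∀ i, ξ i ^ 2 ≤ (n * M ^ 2) * ∑ j, η j ^ 2 := fun i => by
    rw [hξi i]
    refine (Finset.sum_mul_sq_le_sq_mul_sq _ _ _).trans ?_
    gcongr
    calc ∑ j, A i j ^ 2 ≤ ∑ _j : Fin n, M ^ 2 := Finset.sum_le_sum fun j _ => by
          rw [← sq_abs]; gcongr; exact hA.2.1 i j
      _ = n * M ^ 2 := by simp
  have h4 : ∑ i, ξ i ^ 2 ≤ n * ((n * M ^ 2) * ∑ j, η j ^ 2) := by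
    refine (Finset.sum_le_sum fun i _ => h3 i).trans (by simp)
  have : (0 : ℝ) < n := by exact_mod_cast hn
  calc lam / (n ^ 2 * M ^ 2) * ∑ i, ξ i ^ 2
      ≤ lam / (n ^ 2 * M ^ 2) * (n * ((n * M ^ 2) * ∑ j, η j ^ 2)) := by gcongr
    _ = _ := by field_simp

theorem abs_le_of_quadratic {n : ℕ} {lam : ℝ} (hlam : 0 < lam) {A : Fin n → Fin n → ℝ}
    (hs : ∀ i j, A i j = A j i)
    (h1 : ∀ ξ : Fin n → ℝ, lam * ∑ i, ξ i ^ 2 ≤ ∑ i, ∑ j, A i j * ξ i * ξ j)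
    (h2 : ∀ ξ : Fin n → ℝ, ∑ i, ∑ j, A i j * ξ i * ξ j ≤ lam⁻¹ * ∑ i, ξ i ^ 2) (i j : Fin n) :
    |A i j| ≤ lam⁻¹ := by
  have hd : ∀ k, 0 ≤ A k k ∧ A k k ≤ lam⁻¹ := fun k => by
    have a1 := h1 (Pi.single k 1)
    have a2 := h2 (Pi.single k 1)
    simp [Pi.single_apply, ite_pow] at a1 a2
    exact ⟨hlam.le.trans a1, a2⟩
  rcases eq_or_ne i j with rfl | hij
  · rw [abs_of_nonneg (hd i).1]; exact (hd i).2
  have key : ∀ σ : ℝ, ∑ k, ∑ l, A k l * (Pi.single i 1 + Pi.single j σ : Fin n → ℝ) k *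
      (Pi.single i 1 + Pi.single j σ : Fin n → ℝ) l = A i i + σ * A i j + σ * A j i +
        σ ^ 2 * A j j := fun σ => by
    simp [Pi.single_apply, mul_add, add_mul, Finset.sum_add_distrib]
    ring
  have b : ∀ σ : ℝ, ∑ k, (Pi.single i 1 + Pi.single j σ : Fin n → ℝ) k ^ 2 = 1 + σ ^ 2 :=
    fun σ => by
    have : ∀ k, (Pi.single i 1 + Pi.single j σ : Fin n → ℝ) k ^ 2 =
        (if k = i then 1 else 0) + (if k = j then σ ^ 2 else 0) := fun k => by
      rcases eq_or_ne k i with rfl | hk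
      · simp [hij]
      · rcases eq_or_ne k j with rfl | hk'
        · simp [hk]
        · simp [hk, hk']
    simp only [Pi.add_apply] at this ⊢
    simp [this, Finset.sum_add_distrib]
  have c1 := h2 (Pi.single i 1 + Pi.single j 1)
  have c2 := h2 (Pi.single i 1 + Pi.single j (-1))
  rw [key, b] at c1 c2
  rw [hs j i] at c1 c2
  have := hd i
  have := hd j
  rw [abs_le]
  constructor <;> nlinarith

theorem exists_isCoeff (n : ℕ) (hn : 0 < n) {lam Lam : ℝ} (hlam : 0 < lam) :
    ∃ c L : ℝ, 0 < c ∧ 1 ≤ L ∧ ∀ g, MemM n lam Lam g →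
      IsCoeff c L (fun x => sqrtDet g x • (g x)⁻¹) (sqrtDet g) := by
  set M := lam⁻¹ with hM
  have hM0 : 0 < M := by positivity
  have hsq := contDiffOn_sqrt_det_ellipticSet (n := n) (M := M) hlam
  obtain ⟨L1, hL1, hb1, hl1⟩ := exists_lipschitz_bound_ellipticSet hsq
  choose L2 hL2 hb2 hl2 using fun i j => exists_lipschitz_bound_ellipticSet
    (hsq.mul (contDiffOn_inv_ellipticSet (n := n) (M := M) hlam i j))
  obtain ⟨c1, hc1, hcs⟩ : ∃ c1 : ℝ, 0 < c1 ∧ ∀ A ∈ ellipticSet n lam M,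
      c1 ≤ √(Matrix.of A).det := by
    rcases (ellipticSet n lam M).eq_empty_or_nonempty with h | h
    · exact ⟨1, one_pos, by simp [h]⟩
    obtain ⟨A, hA, hmin⟩ := (isCompact_ellipticSet n lam M).exists_isMinOn h hsq.continuousOn
    exact ⟨_, Real.sqrt_pos.2 (det_pos_of_mem_ellipticSet hlam hA), fun B hB => hmin hB⟩
  have hn' : (0 : ℝ) < n := by exact_mod_cast hn
  set Λ := max Lam 0 with hΛ
  have hS : 0 ≤ ∑ i, ∑ j, L2 i j := Finset.sum_nonneg fun i _ => Finset.sum_nonneg fun j _ =>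
    hL2 i j
  have hL2S : ∀ i j, L2 i j ≤ ∑ i, ∑ j, L2 i j := fun i j =>
    (Finset.single_le_sum (f := fun j => L2 i j) (fun j _ => hL2 i j) (Finset.mem_univ j)).trans
      (Finset.single_le_sum (f := fun i => ∑ j, L2 i j)
        (fun i _ => Finset.sum_nonneg fun j _ => hL2 i j) (Finset.mem_univ i))
  set S := ∑ i, ∑ j, L2 i j with hSdef
  have hΛ0 : 0 ≤ Λ := le_max_right _ _
  refine ⟨min c1 (c1 * (lam / (n ^ 2 * M ^ 2))), (1 + L1 + S) * (1 + Λ), by positivity,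
    by nlinarith [mul_nonneg hL1 hΛ0, mul_nonneg hS hΛ0], ?_⟩
  rintro g ⟨hg0, hgp, hgl, hge⟩
  set γ : Euc n → Fin n → Fin n → ℝ := fun x => g x with hγ
  have hmem : ∀ x ∈ ball (0 : Euc n) 1, γ x ∈ ellipticSet n lam M := by
    intro x hx
    have hs : ∀ i j, g x i j = g x j i := fun i j => ((hgp x hx).1.apply j i)
    exact ⟨hs, abs_le_of_quadratic hlam hs (fun ξ => (hge x hx ξ).1) (fun ξ => (hge x hx ξ).2),
      fun ξ => (hge x hx ξ).1⟩
  have hlip : ∀ x ∈ ball (0 : Euc n) 1, ∀ y ∈ ball (0 : Euc n) 1,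
      ‖γ x - γ y‖ ≤ Λ * ‖x - y‖ := by
    intro x hx y hy
    refine (pi_norm_le_iff_of_nonneg (by positivity)).2 fun i =>
      (pi_norm_le_iff_of_nonneg (by positivity)).2 fun j => ?_
    have := (hgl i j).dist_le_mul x hx y hy
    rwa [dist_eq_norm, dist_eq_norm, Real.coe_toNNReal'] at this
  have bd1 : L1 ≤ (1 + L1 + S) * (1 + Λ) := by
    nlinarith [mul_nonneg hL1 hΛ0, mul_nonneg hS hΛ0]
  have bd2 : L1 * Λ ≤ (1 + L1 + S) * (1 + Λ) := by
    nlinarith [mul_nonneg hL1 hΛ0, mul_nonneg hS hΛ0]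
  have bd3 : ∀ i j, L2 i j ≤ (1 + L1 + S) * (1 + Λ) := fun i j => by
    nlinarith [mul_nonneg hL1 hΛ0, mul_nonneg hS hΛ0, hL2S i j]
  have bd4 : ∀ i j, L2 i j * Λ ≤ (1 + L1 + S) * (1 + Λ) := fun i j => by
    nlinarith [mul_nonneg hL1 hΛ0, mul_nonneg hS hΛ0, hL2S i j]
  refine ⟨?_, ?_, ?_, ?_, ?_, ?_, ?_, ?_, ?_⟩
  · simp [sqrtDet, hg0]
  · simp [sqrtDet, hg0]
  · intro x hx i j
    have h : (g x)⁻¹.IsSymm := (hgp x hx).1.inv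
    simp [h.apply j i]
  · intro x hx ξ
    have h1 := inv_quadratic_lower_bound hlam hM0 hn (hmem x hx) ξ
    have e : ∑ i, ∑ j, (sqrtDet g x • (g x)⁻¹) i j * ξ i * ξ j =
        sqrtDet g x * ∑ i, ∑ j, (g x)⁻¹ i j * ξ i * ξ j := by
      simp only [Finset.mul_sum, Matrix.smul_apply, smul_eq_mul, mul_assoc]
    rw [e]
    have h2 : c1 ≤ sqrtDet g x := hcs _ (hmem x hx)
    have h0 : 0 ≤ ∑ i, ξ i ^ 2 := Finset.sum_nonneg fun i _ => sq_nonneg _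
    calc min c1 (c1 * (lam / (n ^ 2 * M ^ 2))) * ∑ i, ξ i ^ 2
        ≤ (c1 * (lam / (n ^ 2 * M ^ 2))) * ∑ i, ξ i ^ 2 := by gcongr; exact min_le_right _ _
      _ = c1 * ((lam / (n ^ 2 * M ^ 2)) * ∑ i, ξ i ^ 2) := by ring
      _ ≤ _ := mul_le_mul h2 h1 (by positivity) (hc1.le.trans h2)
  · intro x hx i j
    exact (hb2 i j _ (hmem x hx)).trans (bd3 i j)
  · intro x hx y hy i j
    refine (hl2 i j _ (hmem x hx) _ (hmem y hy)).trans ?_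
    calc L2 i j * ‖γ x - γ y‖ ≤ L2 i j * (Λ * ‖x - y‖) :=
          mul_le_mul_of_nonneg_left (hlip x hx y hy) (hL2 i j)
      _ = (L2 i j * Λ) * ‖x - y‖ := by ring
      _ ≤ _ := mul_le_mul_of_nonneg_right (bd4 i j) (norm_nonneg _)
  · exact fun x hx => (min_le_left _ _).trans (hcs _ (hmem x hx))
  · exact fun x hx => ((le_abs_self _).trans (hb1 _ (hmem x hx))).trans bd1
  · intro x hx y hy
    refine (hl1 _ (hmem x hx) _ (hmem y hy)).trans ?_
    calc L1 * ‖γ x - γ y‖ ≤ L1 * (Λ * ‖x - y‖) :=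
          mul_le_mul_of_nonneg_left (hlip x hx y hy) hL1
      _ = (L1 * Λ) * ‖x - y‖ := by ring
      _ ≤ _ := mul_le_mul_of_nonneg_right bd2 (norm_nonneg _)

end Coefficients

section QuadraticForm
variable {n : ℕ}

/-- The bilinear form with coefficients `A` on `n`-tuples of complex numbers. -/
def qf (A : Matrix (Fin n) (Fin n) ℝ) (v w : Fin n → ℂ) : ℝ :=
  ∑ i, ∑ j, A i j * inner ℝ (v i) (w j)

theorem qf_comm {A : Matrix (Fin n) (Fin n) ℝ} (hA : ∀ i j, A i j = A j i) (v w : Fin n → ℂ) :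
    qf A v w = qf A w v := by
  rw [qf, qf, Finset.sum_comm]
  refine Finset.sum_congr rfl fun i _ => Finset.sum_congr rfl fun j _ => ?_
  rw [hA j i, real_inner_comm]

theorem qf_add_left (A : Matrix (Fin n) (Fin n) ℝ) (v v' w : Fin n → ℂ) :
    qf A (v + v') w = qf A v w + qf A v' w := by
  simp only [qf, Pi.add_apply, inner_add_left, mul_add, Finset.sum_add_distrib]

theorem qf_smul_left (A : Matrix (Fin n) (Fin n) ℝ) (c : ℝ) (v w : Fin n → ℂ) :
    qf A (c • v) w = c * qf A v w := by
  simp only [qf, Pi.smul_apply, real_inner_smul_left, Finset.mul_sum]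
  exact Finset.sum_congr rfl fun i _ => Finset.sum_congr rfl fun j _ => by ring

theorem qf_add_right (A : Matrix (Fin n) (Fin n) ℝ) (v w w' : Fin n → ℂ) :
    qf A v (w + w') = qf A v w + qf A v w' := by
  simp only [qf, Pi.add_apply, inner_add_right, mul_add, Finset.sum_add_distrib]

theorem qf_smul_right (A : Matrix (Fin n) (Fin n) ℝ) (c : ℝ) (v w : Fin n → ℂ) :
    qf A v (c • w) = c * qf A v w := by
  simp only [qf, Pi.smul_apply, real_inner_smul_right, Finset.mul_sum]
  exact Finset.sum_congr rfl fun i _ => Finset.sum_congr rfl fun j _ => by ring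

theorem qf_sub_matrix (A B : Matrix (Fin n) (Fin n) ℝ) (v w : Fin n → ℂ) :
    qf (A - B) v w = qf A v w - qf B v w := by
  simp only [qf, Matrix.sub_apply, sub_mul, Finset.sum_sub_distrib]

theorem abs_qf_le {A : Matrix (Fin n) (Fin n) ℝ} {M : ℝ} (hA : ∀ i j, |A i j| ≤ M)
    (v w : Fin n → ℂ) :
    |qf A v w| ≤ M * n * ((∑ i, ‖v i‖ ^ 2 + ∑ i, ‖w i‖ ^ 2) / 2) := by
  have h : ∀ i j, |A i j * inner ℝ (v i) (w j)| ≤ M * ((‖v i‖ ^ 2 + ‖w j‖ ^ 2) / 2) := by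
    intro i j
    rw [abs_mul]
    have h1 := abs_real_inner_le_norm (v i) (w j)
    have h2 : ‖v i‖ * ‖w j‖ ≤ (‖v i‖ ^ 2 + ‖w j‖ ^ 2) / 2 := by
      nlinarith [sq_nonneg (‖v i‖ - ‖w j‖)]
    exact mul_le_mul (hA i j) (h1.trans h2) (abs_nonneg _) ((abs_nonneg _).trans (hA i j))
  calc |qf A v w| ≤ ∑ i, ∑ j, M * ((‖v i‖ ^ 2 + ‖w j‖ ^ 2) / 2) :=
        (Finset.abs_sum_le_sum_abs _ _).trans (Finset.sum_le_sum fun i _ =>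
          (Finset.abs_sum_le_sum_abs _ _).trans (Finset.sum_le_sum fun j _ => h i j))
    _ = _ := by
      simp only [← Finset.mul_sum, ← Finset.sum_div, Finset.sum_add_distrib, Finset.sum_const,
        Finset.card_univ, Fintype.card_fin, nsmul_eq_mul]
      ring

theorem le_qf_self {A : Matrix (Fin n) (Fin n) ℝ} {c : ℝ}
    (hA : ∀ ξ : Fin n → ℝ, c * ∑ i, ξ i ^ 2 ≤ ∑ i, ∑ j, A i j * ξ i * ξ j) (v : Fin n → ℂ) :
    c * ∑ i, ‖v i‖ ^ 2 ≤ qf A v v := by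
  have h1 := hA fun i => (v i).re
  have h2 := hA fun i => (v i).im
  have e : qf A v v = ∑ i, ∑ j, A i j * (v i).re * (v j).re +
      ∑ i, ∑ j, A i j * (v i).im * (v j).im := by
    simp only [qf, ← Finset.sum_add_distrib, ← rdot_eq_inner, rdot]
    exact Finset.sum_congr rfl fun i _ => Finset.sum_congr rfl fun j _ => by ring
  have e2 : ∑ i, ‖v i‖ ^ 2 = ∑ i, (v i).re ^ 2 + ∑ i, (v i).im ^ 2 := by
    rw [← Finset.sum_add_distrib]
    exact Finset.sum_congr rfl fun i _ => by
      rw [Complex.sq_norm, Complex.normSq_apply]; ring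
  rw [e, e2]
  linarith

/-- The contraction `∑ x_k v_k`. -/
def contract (x : Euc n) (v : Fin n → ℂ) : ℂ := ∑ k, x k • v k

/-- The radial part `(x_i ∑ x_k v_k)_i`, not normalised. -/
def radialPart (x : Euc n) (v : Fin n → ℂ) : Fin n → ℂ := fun i => x i • contract x v

theorem norm_contract_sq_le (x : Euc n) (v : Fin n → ℂ) :
    ‖contract x v‖ ^ 2 ≤ ‖x‖ ^ 2 * ∑ i, ‖v i‖ ^ 2 := by
  have h1 : ‖contract x v‖ ≤ ∑ i, |x i| * ‖v i‖ :=
    (norm_sum_le _ _).trans (Finset.sum_le_sum fun i _ => by rw [norm_smul, Real.norm_eq_abs])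
  calc ‖contract x v‖ ^ 2 ≤ (∑ i, |x i| * ‖v i‖) ^ 2 := by gcongr
    _ ≤ (∑ i, |x i| ^ 2) * ∑ i, ‖v i‖ ^ 2 := Finset.sum_mul_sq_le_sq_mul_sq _ _ _
    _ = _ := by rw [EuclideanSpace.norm_sq_eq]; simp

theorem sum_norm_radialPart_sq_le (x : Euc n) (v : Fin n → ℂ) :
    ∑ i, ‖radialPart x v i‖ ^ 2 ≤ ‖x‖ ^ 4 * ∑ i, ‖v i‖ ^ 2 := by
  have e : ∑ i, ‖radialPart x v i‖ ^ 2 = ‖x‖ ^ 2 * ‖contract x v‖ ^ 2 := by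
    rw [EuclideanSpace.norm_sq_eq, Finset.sum_mul]
    exact Finset.sum_congr rfl fun i _ => by rw [radialPart, norm_smul, mul_pow]
  rw [e]
  calc ‖x‖ ^ 2 * ‖contract x v‖ ^ 2 ≤ ‖x‖ ^ 2 * (‖x‖ ^ 2 * ∑ i, ‖v i‖ ^ 2) := by
        gcongr; exact norm_contract_sq_le x v
    _ = _ := by ring

theorem abs_one_sub_pow_sub_le {X t χ : ℝ} (ht : 0 ≤ t) (ht1 : t ≤ 1) (hχ : |χ| ≤ X) (k : ℕ) :
    |(1 - t * χ) ^ k - (1 - k * (t * χ))| ≤ (k ^ 2 * X ^ 2 * (1 + X) ^ k) * t ^ 2 := by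
  have hX : 0 ≤ X := (abs_nonneg _).trans hχ
  have h1 : |1 - t * χ| ≤ 1 + X := by
    refine (abs_sub _ _).trans ?_
    rw [abs_one, abs_mul, abs_of_nonneg ht]
    nlinarith [abs_nonneg χ]
  induction k with
  | zero => simp
  | succ k ih =>
    have e : (1 - t * χ) ^ (k + 1) - (1 - ((k + 1 : ℕ) : ℝ) * (t * χ)) =
        (1 - t * χ) * ((1 - t * χ) ^ k - (1 - k * (t * χ))) + k * (t ^ 2 * χ ^ 2) := by
      push_cast; ring
    rw [e]
    refine (abs_add_le _ _).trans ?_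
    rw [abs_mul, abs_of_nonneg (by positivity : 0 ≤ k * (t ^ 2 * χ ^ 2))]
    have h2 : χ ^ 2 ≤ X ^ 2 := by rw [← sq_abs]; gcongr
    have h3 : (1 : ℝ) ≤ (1 + X) ^ (k + 1) := one_le_pow₀ (by linarith)
    calc |1 - t * χ| * |(1 - t * χ) ^ k - (1 - k * (t * χ))| + k * (t ^ 2 * χ ^ 2)
        ≤ (1 + X) * ((k ^ 2 * X ^ 2 * (1 + X) ^ k) * t ^ 2) + k * (t ^ 2 * X ^ 2) := by gcongr
      _ = ((k ^ 2) * X ^ 2 * t ^ 2) * (1 + X) ^ (k + 1) + (k * X ^ 2 * t ^ 2) * 1 := by ring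
      _ ≤ ((k ^ 2) * X ^ 2 * t ^ 2) * (1 + X) ^ (k + 1) + (k * X ^ 2 * t ^ 2) * (1 + X) ^ (k + 1) :=
        by gcongr
      _ = ((k ^ 2 + k) * X ^ 2 * t ^ 2) * (1 + X) ^ (k + 1) := by ring
      _ ≤ (((k + 1) ^ 2) * X ^ 2 * t ^ 2) * (1 + X) ^ (k + 1) := by
        gcongr
        nlinarith [(Nat.cast_nonneg k : (0 : ℝ) ≤ k)]
      _ = _ := by push_cast; ring

theorem exists_jacobian_bounds (k : ℕ) {X : ℝ} (hX : 0 ≤ X) :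
    ∃ C : ℝ, 0 ≤ C ∧ ∀ t χ y : ℝ, 0 ≤ t → t ≤ 1 → |χ| ≤ X → |y| ≤ X →
      |(1 - t * χ) ^ k - 1| ≤ C * t ∧
      |(1 - t * χ) ^ k * (1 - t * χ + t * y) - 1| ≤ C * t ∧
      |(1 - t * χ) ^ k * (1 - t * χ + t * y) - (1 + t * (y - (k + 1) * χ))| ≤ C * t ^ 2 := by
  set C₁ : ℝ := k ^ 2 * X ^ 2 * (1 + X) ^ k + k * X with hC₁
  set C₂ : ℝ := ((k + 1 : ℕ) : ℝ) ^ 2 * X ^ 2 * (1 + X) ^ (k + 1) with hC₂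
  have h1 : 0 ≤ C₁ := by positivity
  have h2 : 0 ≤ C₂ := by positivity
  refine ⟨C₁ + C₂ + X * C₁ + X + (k + 1) * X, by positivity, fun t χ y ht ht1 hχ hy => ?_⟩
  have b1 := abs_one_sub_pow_sub_le ht ht1 hχ k
  have b2 := abs_one_sub_pow_sub_le ht ht1 hχ (k + 1)
  have htt : t ^ 2 ≤ t := by nlinarith
  have a1 : |(1 - t * χ) ^ k - 1| ≤ C₁ * t := by
    have e : (1 - t * χ) ^ k - 1 = ((1 - t * χ) ^ k - (1 - k * (t * χ))) + -(k * (t * χ)) := by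
      ring
    rw [e]
    refine (abs_add_le _ _).trans ?_
    rw [abs_neg, abs_mul, abs_mul, abs_of_nonneg ht, Nat.abs_cast]
    calc _ ≤ k ^ 2 * X ^ 2 * (1 + X) ^ k * t + k * (t * X) := by
          refine add_le_add (b1.trans ?_) ?_ <;> gcongr
      _ = _ := by rw [hC₁]; ring
  have a3 : |(1 - t * χ) ^ k * (1 - t * χ + t * y) - (1 + t * (y - (k + 1) * χ))| ≤
      (C₂ + X * C₁) * t ^ 2 := by
    have e : (1 - t * χ) ^ k * (1 - t * χ + t * y) - (1 + t * (y - (k + 1) * χ)) =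
        ((1 - t * χ) ^ (k + 1) - (1 - ((k + 1 : ℕ) : ℝ) * (t * χ))) +
          t * y * ((1 - t * χ) ^ k - 1) := by
      push_cast; ring
    rw [e]
    refine (abs_add_le _ _).trans ?_
    rw [abs_mul, abs_mul, abs_of_nonneg ht]
    calc _ ≤ C₂ * t ^ 2 + t * X * (C₁ * t) := by gcongr
      _ = _ := by ring
  have a2 : |(1 - t * χ) ^ k * (1 - t * χ + t * y) - 1| ≤
      (C₂ + X * C₁ + X + (k + 1) * X) * t := by
    have e : (1 - t * χ) ^ k * (1 - t * χ + t * y) - 1 = ((1 - t * χ) ^ k * (1 - t * χ + t * y)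
      - (1 + t * (y - (k + 1) * χ))) + t * (y - (k + 1) * χ) := by ring
    rw [e]
    refine (abs_add_le _ _).trans ?_
    have : |t * (y - (k + 1) * χ)| ≤ t * (X + (k + 1) * X) := by
      rw [abs_mul, abs_of_nonneg ht]
      gcongr
      refine (abs_sub _ _).trans ?_
      rw [abs_mul, abs_of_nonneg (by positivity : (0 : ℝ) ≤ k + 1)]
      gcongr
    calc _ ≤ (C₂ + X * C₁) * t + t * (X + (k + 1) * X) :=
          add_le_add (a3.trans (by gcongr)) this
      _ = _ := by ring
  have p1 : 0 ≤ X * C₁ := by positivity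
  have p2 : 0 ≤ (k + 1) * X := by positivity
  exact ⟨a1.trans (mul_le_mul_of_nonneg_right (by linarith) ht),
    a2.trans (mul_le_mul_of_nonneg_right (by linarith) ht),
    a3.trans (mul_le_mul_of_nonneg_right (by linarith) (sq_nonneg t))⟩

end QuadraticForm

section Deformed

theorem sum_deformed_terms_le (m : ℕ) {L X C₁ C₂ N G W Q P Q' P' Y' s s' t χ q y r α β D : ℝ}
    (hL : 0 ≤ L) (hX : 0 ≤ X) (hC₁ : 0 ≤ C₁) (hC₂ : 0 ≤ C₂) (hN : N = L * (m + 3))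
    (hG0 : 0 ≤ G) (hW : 0 ≤ W) (hr0 : 0 ≤ r) (ht : 0 < t) (ht1 : t ≤ 1) (hq : |q| ≤ X)
    (hβ : 1 / 2 ≤ β) (hD : D = t * |χ| * r) (hDX : D ≤ t * X)
    (hss : |s' - s| ≤ L * D) (hs : |s| ≤ L)
    (bQ : |Q| ≤ N * G) (bP' : |P'| ≤ N * G) (bY' : |Y'| ≤ N * G)
    (bdQ : |Q' - Q| ≤ D * N * G) (bdP : |P' - P| ≤ D * N * G)
    (f2b : |α ^ m - 1| ≤ C₁ * t) (f1c : |α ^ m * β - 1| ≤ C₁ * t)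
    (f1b : |α ^ m * β - (1 + t * (y - (m + 1) * χ))| ≤ C₁ * t ^ 2)
    (f4c : |α ^ (m + 2) * β - 1| ≤ C₂ * t)
    (f4b : |α ^ (m + 2) * β - (1 + t * (y - (((m + 2 : ℕ) : ℝ) + 1) * χ))| ≤ C₂ * t ^ 2) :
    (α ^ m * β) * Q' / 2 - α ^ m * (t * q * P') + α ^ m / β * (t ^ 2 * q ^ 2 * Y') / 2
        + (α ^ (m + 2) * β) * (s' * W) ≤
      (Q / 2 + s * W) + t * (y * (Q / 2 + s * W)
          - (m + 1) * χ * (Q / 2 + s * W) - 2 * χ * (s * W) - q * P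
          + L * (m + 3) * |χ| * r * (G + W))
        + (C₁ * N + C₁ * (X * N) + C₁ * (X * N) + X * X * N + C₁ * (X * X * N)
    + (C₁ + 1) * 2 * X ^ 2 * N + C₂ * L + C₂ * (L * X)) * t ^ 2 * (G + W) := by
  have hN0 : 0 ≤ N := by rw [hN]; positivity
  have hD0 : 0 ≤ D := by rw [hD]; positivity
  have ht2 : 0 ≤ t ^ 2 := sq_nonneg t
  have hDNG : D * N * G ≤ t * (X * N * G) := by
    calc D * N * G ≤ (t * X) * N * G := by gcongr
      _ = _ := by ring
  -- the four terms
  have T1 : (α ^ m * β) * Q' ≤ (1 + t * (y - (m + 1) * χ)) * Q + D * N * G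
      + (C₁ * N + C₁ * (X * N)) * t ^ 2 * G := by
    have i1 : (α ^ m * β - (1 + t * (y - (m + 1) * χ))) * Q ≤ C₁ * t ^ 2 * (N * G) :=
      (le_abs_self _).trans (by rw [abs_mul]; gcongr)
    have i2 : (α ^ m * β - 1) * (Q' - Q) ≤ C₁ * t * (t * (X * N * G)) :=
      (le_abs_self _).trans (by rw [abs_mul]; gcongr; exact bdQ.trans hDNG)
    have i3 := (le_abs_self _).trans bdQ
    linear_combination i1 + i2 + i3
  have T2 : -(α ^ m * (t * q * P')) ≤ -(t * q * P)
      + (X * X * N + C₁ * (X * N)) * t ^ 2 * G := by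
    have i1 : -(α ^ m - 1) * (t * q * P') ≤ C₁ * t * (t * X * (N * G)) :=
      (le_abs_self _).trans (by
        rw [abs_mul, abs_neg, abs_mul, abs_mul, abs_of_pos ht]; gcongr)
    have i2 : -(t * q * (P' - P)) ≤ t * X * (t * (X * N * G)) :=
      (neg_le_abs _).trans (by
        rw [abs_mul, abs_mul, abs_of_pos ht]; gcongr; exact bdP.trans hDNG)
    linear_combination i1 + i2
  have T3 : α ^ m / β * (t ^ 2 * q ^ 2 * Y') ≤ ((C₁ + 1) * 2 * X ^ 2 * N) * t ^ 2 * G := by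
    refine (le_abs_self _).trans ?_
    have i1 : |α ^ m / β| ≤ (C₁ + 1) * 2 := by
      rw [abs_div, abs_of_pos (by linarith : 0 < β), div_le_iff₀ (by linarith)]
      have : |α ^ m| ≤ C₁ + 1 := by
        have e : α ^ m = (α ^ m - 1) + 1 := by ring
        rw [e]
        refine (abs_add_le _ _).trans ?_
        rw [abs_one]
        linarith only [f2b, mul_le_of_le_one_right hC₁ ht1]
      nlinarith only [this, hβ, hC₁]
    have i2 : q ^ 2 ≤ X ^ 2 := by rw [← sq_abs]; gcongr
    rw [abs_mul, abs_mul, abs_of_nonneg (by positivity : 0 ≤ t ^ 2 * q ^ 2)]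
    calc _ ≤ (C₁ + 1) * 2 * (t ^ 2 * X ^ 2 * (N * G)) := by gcongr
      _ = _ := by ring
  have hW4 : (α ^ (m + 2) * β) * (s' * W) ≤ (1 + t * (y - (m + 3) * χ)) * (s * W) + L * D * W
      + (C₂ * L + C₂ * (L * X)) * t ^ 2 * W := by
    have e : ((m + 2 : ℕ) : ℝ) + 1 = m + 3 := by push_cast; ring
    rw [e] at f4b
    have i1 : (α ^ (m + 2) * β - (1 + t * (y - (m + 3) * χ))) * (s * W) ≤ C₂ * t ^ 2 * (L * W) :=
      (le_abs_self _).trans (by rw [abs_mul, abs_mul, abs_of_nonneg hW]; gcongr)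
    have i2 : (α ^ (m + 2) * β - 1) * ((s' - s) * W) ≤ C₂ * t * (L * (t * X) * W) :=
      (le_abs_self _).trans (by
        rw [abs_mul, abs_mul, abs_of_nonneg hW]; gcongr; exact hss.trans (by gcongr))
    have i3 : (s' - s) * W ≤ L * D * W :=
      mul_le_mul_of_nonneg_right ((le_abs_self _).trans hss) hW
    linear_combination i1 + i2 + i3
  have hLD : L * D * W ≤ N * D * W := by
    gcongr
    rw [hN]
    exact le_mul_of_one_le_right hL (by linarith only [(Nat.cast_nonneg m : (0 : ℝ) ≤ m)])
  have hDN : D * N * G / 2 ≤ N * D * G := by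
    have : 0 ≤ D * N * G := by positivity
    linarith
  have e0 : t * (N * |χ| * r * (G + W)) = N * D * G + N * D * W := by rw [hD]; ring
  rw [← hN]
  have hpos1 : 0 ≤ (C₁ * N + C₁ * (X * N)) * t ^ 2 * G := by positivity
  have hpos2 : 0 ≤ ((C₁ + 1) * 2 * X ^ 2 * N) * t ^ 2 * G := by positivity
  have hpos3 : 0 ≤ (C₂ * L + C₂ * (L * X)) * t ^ 2 * G := by positivity
  have hpos4 : 0 ≤ (C₁ * N + C₁ * (X * N) + C₁ * (X * N) + X * X * N + C₁ * (X * X * N)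
    + (C₁ + 1) * 2 * X ^ 2 * N) * t ^ 2 * W := by positivity
  have hpos5 : 0 ≤ C₁ * (X * X * N) * t ^ 2 * G := by positivity
  linear_combination (1 / 2) * T1 + T2 + (1 / 2) * T3 + hW4 + hLD + hDN - e0 + (1 / 2) * hpos1
    + hpos5 + (1 / 2) * hpos2 + hpos3 + hpos4

theorem exists_deformed_energy_bound (m : ℕ) {L X : ℝ} (hL : 0 ≤ L) (hX : 0 ≤ X) :
    ∃ C : ℝ, 0 ≤ C ∧ ∀ (x : Euc (m + 3)) (v w : Fin (m + 3) → ℂ)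
      (A A' : Matrix (Fin (m + 3)) (Fin (m + 3)) ℝ) (s s' W t χ q : ℝ),
      ‖x‖ ≤ 1 → 0 < t → t ≤ 1 → |χ| ≤ X → |q| ≤ X →
      1 / 2 ≤ 1 - t * χ → 1 / 2 ≤ 1 - t * χ + t * (q * ‖x‖ ^ 2) →
      (∀ i j, A' i j = A' j i) → (∀ i j, |A i j| ≤ L) → (∀ i j, |A' i j| ≤ L) →
      (∀ i j, |A' i j - A i j| ≤ L * (t * |χ| * ‖x‖)) →
      |s' - s| ≤ L * (t * |χ| * ‖x‖) → |s| ≤ L → 0 ≤ W →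
      v = (1 - t * χ) • w + (t * q) • radialPart x w →
      (qf A' w w / 2 + s' * W) * ((1 - t * χ) ^ (m + 2) * (1 - t * χ + t * (q * ‖x‖ ^ 2))) ≤
        (qf A v v / 2 + s * W) + t * (q * ‖x‖ ^ 2 * (qf A v v / 2 + s * W)
          - (m + 1) * χ * (qf A v v / 2 + s * W) - 2 * χ * (s * W) - q * qf A (radialPart x v) v
          + L * (m + 3) * |χ| * ‖x‖ * (∑ i, ‖v i‖ ^ 2 + W))
        + C * t ^ 2 * (∑ i, ‖v i‖ ^ 2 + W) := by
  obtain ⟨C₁, hC₁, h1⟩ := exists_jacobian_bounds m hX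
  obtain ⟨C₂, hC₂, h2⟩ := exists_jacobian_bounds (m + 2) hX
  set N : ℝ := L * (m + 3) with hN
  have hN0 : 0 ≤ N := by positivity
  refine ⟨C₁ * N + C₁ * (X * N) + C₁ * (X * N) + X * X * N + C₁ * (X * X * N)
    + (C₁ + 1) * 2 * X ^ 2 * N + C₂ * L + C₂ * (L * X), by positivity, ?_⟩
  intro x v w A A' s s' W t χ q hx ht ht1 hχ hq hα hβ hsym hA hA' hAA hss hs hW hv
  set α := 1 - t * χ with hαdef
  set r := ‖x‖
  set y := q * r ^ 2 with hy
  set β := α + t * y with hβdef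
  set G := ∑ i, ‖v i‖ ^ 2 with hG
  set Q := qf A v v
  set P := qf A (radialPart x v) v
  set Q' := qf A' v v with hQ'
  set P' := qf A' (radialPart x v) v with hP'
  set Y' := qf A' (radialPart x v) (radialPart x v) with hY'
  have hr0 : 0 ≤ r := norm_nonneg x
  have hG0 : 0 ≤ G := Finset.sum_nonneg fun i _ => sq_nonneg _
  have hα0 : α ≠ 0 := by linarith
  have hβ0 : β ≠ 0 := by linarith
  have hyX : |y| ≤ X := by
    rw [hy, abs_mul, abs_of_nonneg (sq_nonneg r)]
    have : r ^ 2 ≤ 1 := by nlinarith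
    nlinarith [abs_nonneg q]
  -- the inverse relation between `v` and `w`
  have hz : contract x v = β • contract x w := by
    have : contract x v = α • contract x w + (t * q) • ∑ k, x k • radialPart x w k := by
      rw [hv]
      simp only [contract, Pi.add_apply, Pi.smul_apply, smul_add, Finset.sum_add_distrib,
        Finset.smul_sum]
      congr 1 <;> exact Finset.sum_congr rfl fun k _ => smul_comm _ _ _
    rw [this]
    have e : ∑ k, x k • radialPart x w k = (r ^ 2) • contract x w := by
      simp only [radialPart, smul_smul, ← Finset.sum_smul]
      congr 1
      rw [EuclideanSpace.norm_sq_eq]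
      exact Finset.sum_congr rfl fun k _ => by rw [Real.norm_eq_abs, sq_abs, sq]
    rw [e, smul_smul, ← add_smul, hβdef, hy]
    congr 1; ring
  have hw : w = α⁻¹ • (v + (-(t * q / β)) • radialPart x v) := by
    have e : radialPart x v = β • radialPart x w := by
      funext i
      simp only [radialPart, Pi.smul_apply, hz]
      exact smul_comm _ _ _
    rw [e, smul_smul, hv, add_assoc, ← add_smul]
    have : t * q + -(t * q / β) * β = 0 := by field_simp; ring
    rw [this, zero_smul, add_zero, smul_smul, inv_mul_cancel₀ hα0, one_smul]
  have hQw : qf A' w w = α⁻¹ ^ 2 * (Q' - 2 * (t * q / β) * P' + (t * q / β) ^ 2 * Y') := by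
    rw [hw]
    simp only [qf_smul_left, qf_smul_right, qf_add_left, qf_add_right]
    rw [qf_comm hsym v (radialPart x v)]
    ring
  have hradG : ∑ i, ‖radialPart x v i‖ ^ 2 ≤ G := by
    refine (sum_norm_radialPart_sq_le x v).trans ?_
    have : r ^ 4 ≤ 1 := pow_le_one₀ hr0 hx
    nlinarith
  set D := t * |χ| * r with hD
  have hD0 : 0 ≤ D := by positivity
  have hDX : D ≤ t * X := by
    rw [hD]
    calc t * |χ| * r ≤ t * X * 1 := by gcongr
      _ = _ := by ring
  have hcast : ((m + 3 : ℕ) : ℝ) = m + 3 := by push_cast; ring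
  have bQ : |Q| ≤ N * G := by
    refine (abs_qf_le hA v v).trans (le_of_eq ?_)
    rw [hN, hcast]; ring
  have bd : ∀ {B : Matrix (Fin (m + 3)) (Fin (m + 3)) ℝ} {M : ℝ}, 0 ≤ M →
      (∀ i j, |B i j| ≤ M) → |qf B (radialPart x v) v| ≤ M * (m + 3) * G := by
    intro B M hM hB
    refine (abs_qf_le hB _ _).trans ?_
    rw [hcast]
    gcongr
    linarith
  have bP' : |P'| ≤ N * G := bd hL hA'
  have bY' : |Y'| ≤ N * G := by
    refine (abs_qf_le hA' _ _).trans ?_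
    rw [hN, hcast]
    gcongr
    linarith
  have bdQ : |Q' - Q| ≤ D * N * G := by
    rw [hQ', ← qf_sub_matrix]
    refine (abs_qf_le (fun i j => by simpa using hAA i j) v v).trans (le_of_eq ?_)
    rw [hN, hcast]; ring
  have bdP : |P' - P| ≤ D * N * G := by
    rw [hP', ← qf_sub_matrix]
    refine (bd (M := L * D) (by positivity) (fun i j => by simpa using hAA i j)).trans (le_of_eq ?_)
    rw [hN]; ring
  obtain ⟨f2b, f1c, f1b⟩ := h1 t χ y ht.le ht1 hχ hyX
  obtain ⟨-, f4c, f4b⟩ := h2 t χ y ht.le ht1 hχ hyX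
  rw [← hαdef, ← hβdef] at f1b f1c f4b f4c
  rw [← hαdef] at f2b
  have hsplit : (qf A' w w / 2 + s' * W) * (α ^ (m + 2) * β) =
      (α ^ m * β) * Q' / 2 - α ^ m * (t * q * P') + α ^ m / β * (t ^ 2 * q ^ 2 * Y') / 2
        + (α ^ (m + 2) * β) * (s' * W) := by
    rw [hQw]
    field_simp
    ring
  rw [hsplit]
  exact sum_deformed_terms_le m hL hX hC₁ hC₂ hN hG0 hW hr0 ht ht1 hq hβ hD hDX hss hs bQ bP' bY'
    bdQ bdP f2b f1c f1b f4c f4b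

end Deformed

section RadialDiffeo
variable {m : ℕ} {q : ℝ → ℝ} {β t : ℝ} {Ψ : Euc (m + 3) ≃ₜ Euc (m + 3)}

/-- A homeomorphism `x ↦ (1 - t χ(|x|²)) x` of Euclidean space which is the identity outside a
ball of radius `√β < 1` and whose differential has eigenvalues at least `1 / 2`. -/
structure IsRadialDiffeo (q : ℝ → ℝ) (β t : ℝ) (Ψ : Euc (m + 3) ≃ₜ Euc (m + 3)) : Prop where
  continuous_q : Continuous q
  β_lt : β < 1
  q_eq_zero : ∀ z, β ≤ z → q z = 0
  le_α : ∀ z, 0 ≤ z → 1 / 2 ≤ 1 - t * profile q z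
  le_β : ∀ z, 0 ≤ z → 1 / 2 ≤ 1 - t * profile q z + t * (q z * z)
  apply_eq : ∀ x, Ψ x = (1 - t * profile q (‖x‖ ^ 2)) • x
  differentiableAt_symm : ∀ y, DifferentiableAt ℝ Ψ.symm y

/-- The Jacobian determinant of `x ↦ (1 - t χ(|x|²)) x`. -/
def radialJac (m : ℕ) (q : ℝ → ℝ) (t : ℝ) (x : Euc (m + 3)) : ℝ :=
  (1 - t * profile q (‖x‖ ^ 2)) ^ (m + 2) *
    (1 - t * profile q (‖x‖ ^ 2) + t * (q (‖x‖ ^ 2) * ‖x‖ ^ 2))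

theorem continuous_profile (hq : Continuous q) : Continuous (profile q) :=
  continuous_iff_continuousAt.2 fun z => (hasDerivAt_profile hq z).continuousAt

theorem continuous_radialJac (m : ℕ) (hq : Continuous q) (t : ℝ) :
    Continuous (radialJac m q t) := by
  have := continuous_profile hq
  unfold radialJac
  fun_prop

namespace IsRadialDiffeo

theorem half_pow_le_jac (h : IsRadialDiffeo q β t Ψ) (x : Euc (m + 3)) :
    (1 / 2) ^ (m + 3) ≤ radialJac m q t x := by
  have h1 := h.le_α (‖x‖ ^ 2) (by positivity)
  have h2 := h.le_β (‖x‖ ^ 2) (by positivity)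
  rw [pow_succ, radialJac]
  gcongr

theorem jac_pos (h : IsRadialDiffeo q β t Ψ) (x : Euc (m + 3)) : 0 < radialJac m q t x :=
  lt_of_lt_of_le (by positivity) (h.half_pow_le_jac x)

theorem apply_eq_self (h : IsRadialDiffeo q β t Ψ) {x : Euc (m + 3)} (hx : β ≤ ‖x‖ ^ 2) :
    Ψ x = x := by
  rw [h.apply_eq, profile_eq_zero h.β_lt.le h.q_eq_zero hx]
  simp

theorem symm_eq_self (h : IsRadialDiffeo q β t Ψ) {x : Euc (m + 3)} (hx : β ≤ ‖x‖ ^ 2) :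
    Ψ.symm x = x := by
  rw [Homeomorph.symm_apply_eq, h.apply_eq_self hx]

theorem apply_mem_ball_iff (h : IsRadialDiffeo q β t Ψ) {x : Euc (m + 3)} :
    Ψ x ∈ ball (0 : Euc (m + 3)) 1 ↔ x ∈ ball (0 : Euc (m + 3)) 1 := by
  have key : ∀ y : Euc (m + 3), y ∉ ball (0 : Euc (m + 3)) 1 → β ≤ ‖y‖ ^ 2 := fun y hy => by
    rw [mem_ball_zero_iff, not_lt] at hy
    nlinarith [h.β_lt]
  constructor
  · intro h1
    by_contra h2
    rw [h.apply_eq_self (key x h2)] at h1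
    exact h2 h1
  · intro h1
    by_contra h2
    have h3 : Ψ x = x := Ψ.injective (h.apply_eq_self (key _ h2))
    rw [h3] at h2
    exact h2 h1

theorem image_ball (h : IsRadialDiffeo q β t Ψ) :
    Ψ '' ball (0 : Euc (m + 3)) 1 = ball (0 : Euc (m + 3)) 1 := by
  ext y
  constructor
  · rintro ⟨x, hx, rfl⟩
    exact h.apply_mem_ball_iff.2 hx
  · exact fun hy => ⟨Ψ.symm y, h.apply_mem_ball_iff.1 (by simpa using hy), by simp⟩

theorem hasFDerivAt (h : IsRadialDiffeo q β t Ψ) (x : Euc (m + 3)) :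
    HasFDerivAt Ψ (scaleRankOne (1 - t * profile q (‖x‖ ^ 2)) (t * q (‖x‖ ^ 2)) x) x :=
  (hasFDerivAt_radial h.continuous_q t x).congr_of_eventuallyEq
    (Filter.Eventually.of_forall h.apply_eq)

theorem abs_det (h : IsRadialDiffeo q β t Ψ) (x : Euc (m + 3)) :
    |(scaleRankOne (1 - t * profile q (‖x‖ ^ 2)) (t * q (‖x‖ ^ 2)) x).det| =
      radialJac m q t x := by
  have h1 := h.le_α (‖x‖ ^ 2) (by positivity)
  rw [det_scaleRankOne (by linarith) _ x (m := m + 2) (by simp), mul_assoc t]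
  exact abs_of_pos (h.jac_pos x)

theorem integrableOn_iff (h : IsRadialDiffeo q β t Ψ) (f : Euc (m + 3) → ℝ) :
    IntegrableOn f (ball 0 1) ↔ IntegrableOn (fun x => radialJac m q t x * f (Ψ x)) (ball 0 1) := by
  have := integrableOn_image_iff_integrableOn_abs_det_fderiv_smul volume
    (measurableSet_ball (x := (0 : Euc (m + 3))) (ε := 1))
    (fun x _ => (h.hasFDerivAt x).hasFDerivWithinAt) Ψ.injective.injOn f
  rw [h.image_ball] at this
  simpa only [h.abs_det, smul_eq_mul] using this

theorem setIntegral_eq (h : IsRadialDiffeo q β t Ψ) (f : Euc (m + 3) → ℝ) :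
    ∫ x in ball 0 1, f x = ∫ x in ball 0 1, radialJac m q t x * f (Ψ x) := by
  have := integral_image_eq_integral_abs_det_fderiv_smul volume
    (measurableSet_ball (x := (0 : Euc (m + 3))) (ε := 1))
    (fun x _ => (h.hasFDerivAt x).hasFDerivWithinAt) Ψ.injective.injOn f
  rw [h.image_ball] at this
  simpa only [h.abs_det, smul_eq_mul] using this

theorem setLIntegral_eq (h : IsRadialDiffeo q β t Ψ) (f : Euc (m + 3) → ENNReal) :
    ∫⁻ x in ball 0 1, f x = ∫⁻ x in ball 0 1, ENNReal.ofReal (radialJac m q t x) * f (Ψ x) := by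
  have := lintegral_image_eq_lintegral_abs_det_fderiv_mul volume
    (measurableSet_ball (x := (0 : Euc (m + 3))) (ε := 1))
    (fun x _ => (h.hasFDerivAt x).hasFDerivWithinAt) Ψ.injective.injOn f
  rw [h.image_ball] at this
  simpa only [h.abs_det] using this

theorem setLIntegral_comp_le (h : IsRadialDiffeo q β t Ψ) (f : Euc (m + 3) → ENNReal) :
    ∫⁻ x in ball 0 1, f (Ψ x) ≤ 2 ^ (m + 3) * ∫⁻ x in ball 0 1, f x := by
  rw [h.setLIntegral_eq f, ← lintegral_const_mul' _ _ (by finiteness)]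
  refine lintegral_mono fun x => ?_
  rw [← mul_assoc]
  refine le_mul_of_one_le_left (by positivity) ?_
  have : (2 : ENNReal) ^ (m + 3) = ENNReal.ofReal (2 ^ (m + 3)) := by
    rw [ENNReal.ofReal_pow (by norm_num)]; simp
  rw [this, ← ENNReal.ofReal_mul (by positivity), ENNReal.one_le_ofReal]
  calc (1 : ℝ) = 2 ^ (m + 3) * (1 / 2) ^ (m + 3) := by rw [← mul_pow]; norm_num
    _ ≤ _ := by gcongr; exact h.half_pow_le_jac x

theorem norm_apply_sub_self (h : IsRadialDiffeo q β t Ψ) (ht : 0 ≤ t) (x : Euc (m + 3)) :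
    ‖Ψ x - x‖ = t * |profile q (‖x‖ ^ 2)| * ‖x‖ := by
  rw [h.apply_eq, sub_smul, one_smul, sub_sub_cancel_left, norm_neg, norm_smul, Real.norm_eq_abs,
    abs_mul, abs_of_nonneg ht]

end IsRadialDiffeo

theorem exists_isRadialDiffeo (m : ℕ) (hq : Continuous q) (hβ : β < 1)
    (hq0 : ∀ z, β ≤ z → q z = 0) :
    ∃ t₀ : ℝ, 0 < t₀ ∧ t₀ ≤ 1 ∧ ∀ t, 0 < t → t < t₀ →
      ∃ Ψ : Euc (m + 3) ≃ₜ Euc (m + 3), IsRadialDiffeo q β t Ψ := by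
  obtain ⟨t₀, h0, h1, H⟩ := exists_radial_homeomorph (E := Euc (m + 3)) hq hβ.le hq0
  refine ⟨t₀, h0, h1, fun t ht htt => ?_⟩
  obtain ⟨ha, hb, Ψ, hΨ, hd⟩ := H t ht htt
  exact ⟨Ψ, hq, hβ, hq0, ha, fun z hz => by simpa [mul_assoc] using hb z hz, hΨ, hd⟩

end RadialDiffeo

section Gradient
variable {n : ℕ}

/-- The tuple of partial derivatives. -/
def grad (u : Euc n → ℂ) (x : Euc n) : Fin n → ℂ := fun i => pd u i x

/-- The squared Euclidean length of the gradient. -/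
def gsq (u : Euc n → ℂ) (x : Euc n) : ℝ := ∑ i, ‖grad u x i‖ ^ 2

theorem gsq_nonneg (u : Euc n → ℂ) (x : Euc n) : 0 ≤ gsq u x :=
  Finset.sum_nonneg fun _ _ => sq_nonneg _

theorem measurable_pd (u : Euc n → ℂ) (i : Fin n) : Measurable (pd u i) :=
  measurable_fderiv_apply_const ℝ u _

theorem measurable_gsq (u : Euc n → ℂ) : Measurable (gsq u) :=
  Finset.measurable_sum _ fun i _ => ((measurable_pd u i).norm.pow_const 2)

theorem fderiv_apply_eq_contract (u : Euc n → ℂ) (x v : Euc n) :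
    fderiv ℝ u x v = contract v (grad u x) := by
  have : v = ∑ i, v i • EuclideanSpace.single i (1 : ℝ) := by
    ext j
    simp [Finset.sum_apply, Pi.single_apply]
  conv_lhs => rw [this]
  simp [contract, grad, pd]

theorem norm_pd_sq_le_gsq (u : Euc n → ℂ) (x : Euc n) (i : Fin n) : ‖pd u i x‖ ^ 2 ≤ gsq u x :=
  Finset.single_le_sum (f := fun i => ‖grad u x i‖ ^ 2) (fun _ _ => sq_nonneg _)
    (Finset.mem_univ i)

/-- The chain rule for a radial diffeomorphism. -/
theorem IsRadialDiffeo.grad_eq {m : ℕ} {q : ℝ → ℝ} {β t : ℝ} {Ψ : Euc (m + 3) ≃ₜ Euc (m + 3)}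
    (h : IsRadialDiffeo q β t Ψ) {u : Euc (m + 3) → ℂ} {x : Euc (m + 3)}
    (hu : DifferentiableAt ℝ u x) :
    grad u x = (1 - t * profile q (‖x‖ ^ 2)) • grad (u ∘ Ψ.symm) (Ψ x) +
      (t * q (‖x‖ ^ 2)) • radialPart x (grad (u ∘ Ψ.symm) (Ψ x)) := by
  have h1 : DifferentiableAt ℝ (u ∘ Ψ.symm) (Ψ x) := by
    refine DifferentiableAt.comp _ ?_ (h.differentiableAt_symm _)
    rwa [Ψ.symm_apply_apply]
  have h2 := h1.hasFDerivAt.comp x (h.hasFDerivAt x)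
  have e : (u ∘ Ψ.symm) ∘ Ψ = u := by ext; simp
  rw [e] at h2
  funext i
  rw [grad, pd, h2.fderiv, ContinuousLinearMap.comp_apply, scaleRankOne_apply, map_add, map_smul,
    map_smul, fderiv_apply_eq_contract _ _ x]
  simp only [Pi.add_apply, Pi.smul_apply, radialPart, smul_smul]
  congr 3
  simp [EuclideanSpace.inner_single_right]

end Gradient

section Competitor
variable {m : ℕ} {q : ℝ → ℝ} {β t : ℝ} {Ψ : Euc (m + 3) ≃ₜ Euc (m + 3)}

namespace IsRadialDiffeo

theorem integrableOn_gsq (h : IsRadialDiffeo q β t Ψ) (ht : 0 < t) (ht1 : t ≤ 1)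
    {u : Euc (m + 3) → ℂ} (hu : DifferentiableOn ℝ u (ball 0 1))
    (hG : IntegrableOn (gsq u) (ball 0 1)) :
    IntegrableOn (gsq (u ∘ Ψ.symm)) (ball 0 1) := by
  obtain ⟨X, hX, hb⟩ := exists_profile_bound h.continuous_q h.β_lt.le h.q_eq_zero
  obtain ⟨C, hC, H⟩ := exists_deformed_energy_bound m zero_le_one hX.le
  rw [h.integrableOn_iff]
  have hm : AEStronglyMeasurable (fun x => radialJac m q t x * gsq (u ∘ Ψ.symm) (Ψ x))
      (volume.restrict (ball 0 1)) :=
    (((continuous_radialJac m h.continuous_q t).measurable).mul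
      ((measurable_gsq _).comp Ψ.continuous.measurable)).aestronglyMeasurable
  have hcast : ((m + 3 : ℕ) : ℝ) = m + 3 := by push_cast; ring
  refine (hG.const_mul (1 + X + (m + 1) * X + 2 * (X * (m + 3)) + 2 * ((m + 3) * X) + 2 * C)).mono'
    hm ?_
  filter_upwards [ae_restrict_mem measurableSet_ball] with x hx
  have hx1 : ‖x‖ ≤ 1 := (mem_ball_zero_iff.1 hx).le
  have hx2 : ‖x‖ ^ 2 ≤ 1 := pow_le_one₀ (norm_nonneg _) hx1
  have hx0 := norm_nonneg x
  have hz : 0 ≤ ‖x‖ ^ 2 := by positivity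
  have hone : ∀ v : Fin (m + 3) → ℂ, qf 1 v v = ∑ i, ‖v i‖ ^ 2 := fun v => by
    simp [qf, Matrix.one_apply, ← Complex.normSq_apply, Complex.normSq_eq_norm_sq]
  have h1 : ∀ i j : Fin (m + 3), |(1 : Matrix (Fin (m + 3)) (Fin (m + 3)) ℝ) i j| ≤ 1 :=
    fun i j => by rw [Matrix.one_apply]; split_ifs <;> simp
  have := H x (grad u x) (grad (u ∘ Ψ.symm) (Ψ x)) 1 1 0 0 0 t (profile q (‖x‖ ^ 2))
    (q (‖x‖ ^ 2)) hx1 ht ht1 (hb _ hz).1 (hb _ hz).2 (h.le_α _ hz) (h.le_β _ hz)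
    (fun i j => by simp [Matrix.one_apply, eq_comm]) h1 h1 (fun i j => by simp; positivity)
    (by simp; positivity) (by simp) le_rfl (h.grad_eq (hu.differentiableAt (isOpen_ball.mem_nhds hx)))
  rw [hone, hone] at this
  rw [Real.norm_eq_abs, abs_of_nonneg (mul_nonneg (h.jac_pos x).le (gsq_nonneg _ _))]
  have hP : |qf 1 (radialPart x (grad u x)) (grad u x)| ≤ (m + 3) * gsq u x := by
    refine (abs_qf_le h1 _ _).trans ?_
    have h5 := sum_norm_radialPart_sq_le x (grad u x)
    have h6 : ‖x‖ ^ 4 ≤ 1 := pow_le_one₀ hx0 hx1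
    have h7 := gsq_nonneg u x
    have h8 : ∑ i, ‖radialPart x (grad u x) i‖ ^ 2 ≤ gsq u x :=
      h5.trans (mul_le_of_le_one_left h7 h6)
    rw [hcast, one_mul]
    refine mul_le_mul_of_nonneg_left ?_ (by positivity)
    change (_ + gsq u x) / 2 ≤ _
    linarith
  change (gsq (u ∘ Ψ.symm) (Ψ x) / 2 + _) * radialJac m q t x ≤ _ at this
  change _ ≤ (gsq u x / 2 + _) + t * (_ * (gsq u x / 2 + _) - _ * (gsq u x / 2 + _) - _ - _ +
    _ * (gsq u x + _)) + _ * (gsq u x + _) at this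
  set G := gsq u x with hGdef
  have hG0 : 0 ≤ G := gsq_nonneg _ _
  set χ := profile q (‖x‖ ^ 2)
  set p := q (‖x‖ ^ 2)
  set P := qf 1 (radialPart x (grad u x)) (grad u x)
  have hχ := hb _ hz
  have b1 : p * ‖x‖ ^ 2 * (G / 2) ≤ X * (G / 2) := by
    have : p * ‖x‖ ^ 2 ≤ X := by
      refine (le_abs_self _).trans ?_
      rw [abs_mul, abs_of_nonneg hz]
      exact (mul_le_of_le_one_right (abs_nonneg _) hx2).trans hχ.2
    gcongr
  have b2 : -((m + 1) * χ * (G / 2)) ≤ (m + 1) * X * (G / 2) := by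
    have h9 : -χ ≤ X := (neg_le_abs _).trans hχ.1
    calc -((m + 1) * χ * (G / 2)) = (m + 1) * (-χ) * (G / 2) := by ring
      _ ≤ _ := by gcongr
  have b3 : -(p * P) ≤ X * ((m + 3) * G) := by
    refine (neg_le_abs _).trans ?_
    rw [abs_mul]
    gcongr
    exact hχ.2
  have b4 : 1 * ((m : ℝ) + 3) * |χ| * ‖x‖ * G ≤ (m + 3) * X * G := by
    calc 1 * ((m : ℝ) + 3) * |χ| * ‖x‖ * G ≤ 1 * (m + 3) * X * 1 * G := by
          gcongr; exact hχ.1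
      _ = _ := by ring
  have b5 : t * (p * ‖x‖ ^ 2 * (G / 2) - (m + 1) * χ * (G / 2) - p * P +
      1 * ((m : ℝ) + 3) * |χ| * ‖x‖ * G) ≤
      X * (G / 2) + (m + 1) * X * (G / 2) + X * ((m + 3) * G) + (m + 3) * X * G := by
    have hY : 0 ≤ X * (G / 2) + (m + 1) * X * (G / 2) + X * ((m + 3) * G) + (m + 3) * X * G := by
      positivity
    refine (mul_le_mul_of_nonneg_left (by linarith only [b1, b2, b3, b4]) ht.le).trans
      (mul_le_of_le_one_left hY ht1)
  have b6 : C * t ^ 2 * G ≤ C * G := by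
    calc C * t ^ 2 * G ≤ C * 1 * G := by gcongr; exact pow_le_one₀ ht.le ht1
      _ = _ := by ring
  linear_combination 2 * this + 2 * b5 + 2 * b6

/-- The difference between the deformed map and the map. -/
theorem differentiable_sub (h : IsRadialDiffeo q β t Ψ) {u : Euc (m + 3) → ℂ}
    (hu : DifferentiableOn ℝ u (ball 0 1)) :
    Differentiable ℝ fun y => u (Ψ.symm y) - u y := by
  intro y
  by_cases hy : y ∈ ball (0 : Euc (m + 3)) 1
  · have h1 : Ψ.symm y ∈ ball (0 : Euc (m + 3)) 1 := h.apply_mem_ball_iff.1 (by simpa using hy)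
    exact (DifferentiableAt.comp y (hu.differentiableAt (isOpen_ball.mem_nhds h1))
      (h.differentiableAt_symm y)).sub (hu.differentiableAt (isOpen_ball.mem_nhds hy))
  · have hev : ∀ᶠ z in 𝓝 y, β < ‖z‖ ^ 2 := by
      rw [mem_ball_zero_iff, not_lt] at hy
      have hβy : β < ‖y‖ ^ 2 := by nlinarith [h.β_lt]
      exact (by fun_prop : Continuous fun z : Euc (m + 3) => ‖z‖ ^ 2).continuousAt.eventually_const_lt
        hβy
    refine (differentiableAt_const (0 : ℂ)).congr_of_eventuallyEq (hev.mono fun z hz => ?_)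
    simp [h.symm_eq_self hz.le]

theorem sub_eq_zero (h : IsRadialDiffeo q β t Ψ) (u : Euc (m + 3) → ℂ) {y : Euc (m + 3)}
    (hy : β ≤ ‖y‖ ^ 2) : u (Ψ.symm y) - u y = 0 := by
  rw [h.symm_eq_self hy, sub_self]

theorem tsupport_sub_subset (h : IsRadialDiffeo q β t Ψ) (u : Euc (m + 3) → ℂ) :
    tsupport (fun y => u (Ψ.symm y) - u y) ⊆ closedBall 0 √β := by
  refine closure_minimal (fun y hy => ?_) isClosed_closedBall
  rw [mem_closedBall_zero_iff]
  by_contra hc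
  exact hy (h.sub_eq_zero u (Real.lt_sq_of_sqrt_lt (not_le.1 hc)).le)

theorem sqrt_lt_one (h : IsRadialDiffeo q β t Ψ) : √β < 1 := by
  rw [Real.sqrt_lt' one_pos]
  simpa using h.β_lt

theorem pd_sub (h : IsRadialDiffeo q β t Ψ) {u : Euc (m + 3) → ℂ}
    (hu : DifferentiableOn ℝ u (ball 0 1)) {y : Euc (m + 3)} (hy : y ∈ ball (0 : Euc (m + 3)) 1)
    (j : Fin (m + 3)) :
    pd (fun y => u (Ψ.symm y) - u y) j y = pd (u ∘ Ψ.symm) j y - pd u j y := by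
  have h1 : Ψ.symm y ∈ ball (0 : Euc (m + 3)) 1 := h.apply_mem_ball_iff.1 (by simpa using hy)
  have e : fderiv ℝ (fun y => u (Ψ.symm y) - u y) y = fderiv ℝ (u ∘ Ψ.symm) y - fderiv ℝ u y :=
    fderiv_sub (DifferentiableAt.comp y (hu.differentiableAt (isOpen_ball.mem_nhds h1))
      (h.differentiableAt_symm y)) (hu.differentiableAt (isOpen_ball.mem_nhds hy))
  simp only [pd, e, sub_apply]

theorem memLp_pd_sub (h : IsRadialDiffeo q β t Ψ) (ht : 0 < t) (ht1 : t ≤ 1)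
    {u : Euc (m + 3) → ℂ} (hu : DifferentiableOn ℝ u (ball 0 1))
    (hG : IntegrableOn (gsq u) (ball 0 1)) (j : Fin (m + 3)) :
    MemLp (pd (fun y => u (Ψ.symm y) - u y) j) 2 volume := by
  rw [memLp_two_iff_integrable_sq_norm (measurable_pd _ j).aestronglyMeasurable,
    ← integrableOn_iff_integrable_of_support_subset (s := ball 0 1)]
  · refine (((h.integrableOn_gsq ht ht1 hu hG).add hG).const_mul 2).mono'
      ((measurable_pd _ j).norm.pow_const 2).aestronglyMeasurable ?_
    filter_upwards [ae_restrict_mem measurableSet_ball] with y hy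
    rw [h.pd_sub hu hy, norm_pow, norm_norm]
    have h1 := norm_pd_sq_le_gsq (u ∘ Ψ.symm) y j
    have h2 := norm_pd_sq_le_gsq u y j
    have h3 := norm_sub_le (pd (u ∘ Ψ.symm) j y) (pd u j y)
    have h4 := norm_nonneg (pd (u ∘ Ψ.symm) j y - pd u j y)
    simp only [Pi.add_apply]
    nlinarith [sq_nonneg (‖pd (u ∘ Ψ.symm) j y‖ - ‖pd u j y‖)]
  · intro y hy
    by_contra hc
    refine hy ?_
    have hy' : y ∉ tsupport (fun y => u (Ψ.symm y) - u y) := fun h' => by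
      have := h.tsupport_sub_subset u h'
      rw [mem_closedBall_zero_iff] at this
      exact hc (mem_ball_zero_iff.2 (this.trans_lt h.sqrt_lt_one))
    have : fderiv ℝ (fun y => u (Ψ.symm y) - u y) y = 0 := by
      have := notMem_tsupport_iff_eventuallyEq.1 hy'
      rw [this.fderiv_eq]
      simp
    simp [pd, this]

end IsRadialDiffeo
end Competitor

section Displacement

theorem sq_integral_le_mul_integral_sq {f : ℝ → ℝ} {t : ℝ} (ht : 0 < t)
    (hf : IntegrableOn f (Set.Ioc 0 t)) (hf2 : IntegrableOn (fun σ => f σ ^ 2) (Set.Ioc 0 t)) :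
    (∫ σ in Set.Ioc 0 t, f σ) ^ 2 ≤ t * ∫ σ in Set.Ioc 0 t, f σ ^ 2 := by
  set I := ∫ σ in Set.Ioc 0 t, f σ with hI
  have h0 : 0 ≤ ∫ σ in Set.Ioc 0 t, (f σ - I / t) ^ 2 :=
    integral_nonneg fun _ => sq_nonneg _
  have h1 : ∫ σ in Set.Ioc 0 t, (f σ - I / t) ^ 2 =
      (∫ σ in Set.Ioc 0 t, f σ ^ 2) - 2 * (I / t) * I + t * (I / t) ^ 2 := by
    have e : ∀ σ, (f σ - I / t) ^ 2 = f σ ^ 2 - 2 * (I / t) * f σ + (I / t) ^ 2 := fun σ => by ring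
    simp_rw [e]
    have h1 := integral_add (hf2.sub (hf.const_mul (2 * (I / t)))) (integrable_const ((I / t) ^ 2))
    have h2 := integral_sub hf2 (hf.const_mul (2 * (I / t)))
    simp only [Pi.sub_apply] at h1 h2
    rw [h1, h2, integral_const_mul, ← hI]
    simp [ht.le]
  rw [h1] at h0
  have h2 : t * ((∫ σ in Set.Ioc 0 t, f σ ^ 2) - 2 * (I / t) * I + t * (I / t) ^ 2) =
      t * (∫ σ in Set.Ioc 0 t, f σ ^ 2) - I ^ 2 := by
    field_simp
    ring
  have := mul_nonneg ht.le h0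
  linarith

theorem ofReal_norm_sub_sq_le_lintegral {f f' : ℝ → ℂ} {t : ℝ} (ht : 0 < t)
    (hf : ∀ σ ∈ Set.Icc 0 t, HasDerivAt f (f' σ) σ) :
    ENNReal.ofReal (‖f t - f 0‖ ^ 2) ≤
      ENNReal.ofReal t * ∫⁻ σ in Set.Ioc 0 t, ENNReal.ofReal (‖f' σ‖ ^ 2) := by
  have e : ∫⁻ σ in Set.Ioc 0 t, ENNReal.ofReal (‖f' σ‖ ^ 2) =
      ∫⁻ σ in Set.Ioc 0 t, ENNReal.ofReal (‖deriv f σ‖ ^ 2) :=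
    setLIntegral_congr_fun measurableSet_Ioc fun σ hσ => by
      simp only [(hf σ (Set.Ioc_subset_Icc_self hσ)).deriv]
  rw [e]
  by_cases htop : ∫⁻ σ in Set.Ioc 0 t, ENNReal.ofReal (‖deriv f σ‖ ^ 2) = ⊤
  · rw [htop, ENNReal.mul_top (by simpa using ht)]
    exact le_top
  have hm : Measurable (deriv f) := measurable_deriv f
  have hi2 : IntegrableOn (fun σ => ‖deriv f σ‖ ^ 2) (Set.Ioc 0 t) := by
    refine ⟨(hm.norm.pow_const 2).aestronglyMeasurable, ?_⟩
    rw [hasFiniteIntegral_iff_ofReal (Filter.Eventually.of_forall fun _ => by positivity)]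
    exact lt_top_iff_ne_top.2 htop
  have hi1 : IntegrableOn (deriv f) (Set.Ioc 0 t) :=
    ((memLp_two_iff_integrable_sq_norm hm.aestronglyMeasurable).2 hi2).integrable one_le_two
  have hftc : ∫ σ in (0 : ℝ)..t, deriv f σ = f t - f 0 := by
    refine intervalIntegral.integral_eq_sub_of_hasDerivAt (fun σ hσ => ?_)
      ((intervalIntegrable_iff_integrableOn_Ioc_of_le ht.le).2 hi1)
    rw [Set.uIcc_of_le ht.le] at hσ
    exact (hf σ hσ).differentiableAt.hasDerivAt
  rw [← ofReal_integral_eq_lintegral_ofReal hi2 (Filter.Eventually.of_forall fun _ => by positivity),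
    ← ENNReal.ofReal_mul ht.le]
  refine ENNReal.ofReal_le_ofReal ?_
  rw [← hftc, intervalIntegral.integral_of_le ht.le]
  refine le_trans ?_ (sq_integral_le_mul_integral_sq ht hi1.norm hi2)
  gcongr
  exact norm_integral_le_integral_norm _

variable {m : ℕ} {q : ℝ → ℝ} {β t : ℝ} {Ψ : Euc (m + 3) ≃ₜ Euc (m + 3)}

theorem lintegral_norm_sub_radial_sq_le {X : ℝ} (ht : 0 < t)
    (hΨ : ∀ σ, 0 < σ → σ ≤ t → ∃ Ψ : Euc (m + 3) ≃ₜ Euc (m + 3), IsRadialDiffeo q β σ Ψ)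
    (hX : ∀ z, 0 ≤ z → |profile q z| ≤ X)
    {u : Euc (m + 3) → ℂ} (hu : DifferentiableOn ℝ u (ball 0 1)) :
    ∫⁻ x in ball 0 1, ENNReal.ofReal (‖u ((1 - t * profile q (‖x‖ ^ 2)) • x) - u x‖ ^ 2) ≤
      ENNReal.ofReal (t ^ 2) *
        (2 ^ (m + 3) * ∫⁻ x in ball 0 1, ENNReal.ofReal (X ^ 2 * gsq u x)) := by
  obtain ⟨Ψt, hΨt⟩ := hΨ t ht le_rfl
  have hcont := continuous_profile hΨt.continuous_q
  have hpt : ∀ x ∈ ball (0 : Euc (m + 3)) 1,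
      ENNReal.ofReal (‖u ((1 - t * profile q (‖x‖ ^ 2)) • x) - u x‖ ^ 2) ≤
        ENNReal.ofReal t * ∫⁻ σ in Set.Ioc 0 t,
          ENNReal.ofReal (X ^ 2 * gsq u ((1 - σ * profile q (‖x‖ ^ 2)) • x)) := by
    intro x hx
    set χ := profile q (‖x‖ ^ 2)
    have hχ : |χ| ≤ X := hX _ (by positivity)
    have hmem : ∀ σ ∈ Set.Icc 0 t, (1 - σ * χ) • x ∈ ball (0 : Euc (m + 3)) 1 := by
      intro σ hσ
      rcases hσ.1.eq_or_lt with rfl | h0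
      · simpa using hx
      · obtain ⟨Ψ, h⟩ := hΨ σ h0 hσ.2
        rw [← h.apply_eq]
        exact h.apply_mem_ball_iff.2 hx
    have hd : ∀ σ ∈ Set.Icc 0 t, HasDerivAt (fun σ : ℝ => u ((1 - σ * χ) • x))
        (fderiv ℝ u ((1 - σ * χ) • x) ((-χ) • x)) σ := by
      intro σ hσ
      have h1 : HasDerivAt (fun σ : ℝ => (1 - σ * χ) • x) ((-χ) • x) σ := by
        have := (((hasDerivAt_id σ).mul_const χ).const_sub 1).smul_const x
        simpa using this
      exact (hu.differentiableAt (isOpen_ball.mem_nhds (hmem σ hσ))).hasFDerivAt.comp_hasDerivAt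
        σ h1
    have := ofReal_norm_sub_sq_le_lintegral ht hd
    simp only [zero_mul, sub_zero, one_smul] at this
    refine this.trans ?_
    gcongr with σ
    rw [fderiv_apply_eq_contract]
    refine (norm_contract_sq_le _ _).trans ?_
    refine mul_le_mul_of_nonneg_right ?_ (gsq_nonneg _ _)
    rw [norm_smul, norm_neg, Real.norm_eq_abs, mul_pow]
    have hx1 : ‖x‖ ^ 2 ≤ 1 := pow_le_one₀ (norm_nonneg _) (mem_ball_zero_iff.1 hx).le
    calc |χ| ^ 2 * ‖x‖ ^ 2 ≤ X ^ 2 * 1 := by gcongr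
      _ = X ^ 2 := mul_one _
  have hmeas : Measurable fun p : Euc (m + 3) × ℝ =>
      ENNReal.ofReal (X ^ 2 * gsq u ((1 - p.2 * profile q (‖p.1‖ ^ 2)) • p.1)) := by
    refine (((measurable_gsq u).comp (Continuous.measurable ?_)).const_mul _).ennreal_ofReal
    fun_prop
  calc _ ≤ ∫⁻ x in ball 0 1, ENNReal.ofReal t * ∫⁻ σ in Set.Ioc 0 t,
          ENNReal.ofReal (X ^ 2 * gsq u ((1 - σ * profile q (‖x‖ ^ 2)) • x)) :=
        setLIntegral_mono' measurableSet_ball hpt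
    _ = ENNReal.ofReal t * ∫⁻ σ in Set.Ioc 0 t, ∫⁻ x in ball 0 1,
          ENNReal.ofReal (X ^ 2 * gsq u ((1 - σ * profile q (‖x‖ ^ 2)) • x)) := by
        rw [lintegral_const_mul' _ _ (by finiteness), lintegral_lintegral_swap hmeas.aemeasurable]
    _ ≤ ENNReal.ofReal t * ∫⁻ σ in Set.Ioc 0 t,
          2 ^ (m + 3) * ∫⁻ x in ball 0 1, ENNReal.ofReal (X ^ 2 * gsq u x) := by
        gcongr 1
        refine setLIntegral_mono' measurableSet_Ioc fun σ hσ => ?_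
        obtain ⟨Ψ, h⟩ := hΨ σ hσ.1 hσ.2
        simpa only [h.apply_eq] using
          h.setLIntegral_comp_le fun x => ENNReal.ofReal (X ^ 2 * gsq u x)
    _ = _ := by
        rw [setLIntegral_const, Real.volume_Ioc, sub_zero, sq t, ENNReal.ofReal_mul ht.le]
        ring

theorem exists_integral_norm_sub_sq_le (m : ℕ) (hq : Continuous q) (hβ : β < 1)
    (hq0 : ∀ z, β ≤ z → q z = 0) {u : Euc (m + 3) → ℂ} (hu : DifferentiableOn ℝ u (ball 0 1))
    (hG : IntegrableOn (gsq u) (ball 0 1)) :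
    ∃ C, 0 ≤ C ∧ ∀ t, 0 < t → t ≤ 1 →
      (∀ σ, 0 < σ → σ ≤ t → ∃ Ψ : Euc (m + 3) ≃ₜ Euc (m + 3), IsRadialDiffeo q β σ Ψ) →
      ∀ Ψ : Euc (m + 3) ≃ₜ Euc (m + 3), IsRadialDiffeo q β t Ψ →
        ∫ y in ball 0 1, ‖u (Ψ.symm y) - u y‖ ^ 2 ≤ C * t ^ 2 := by
  obtain ⟨X, hX, hb⟩ := exists_profile_bound hq hβ.le hq0
  set J : ℝ := (1 + X) ^ (m + 2) * (1 + X + X) with hJ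
  set I : ℝ := ∫ x in ball 0 1, gsq u x with hI
  have hI0 : 0 ≤ I := integral_nonneg fun x => gsq_nonneg u x
  refine ⟨J * (2 ^ (m + 3) * (X ^ 2 * I)), by positivity, fun t ht ht1 hσ Ψ h => ?_⟩
  have hjac : ∀ x ∈ ball (0 : Euc (m + 3)) 1, radialJac m q t x ≤ J := by
    intro x hx
    have hz : 0 ≤ ‖x‖ ^ 2 := by positivity
    have hx2 : ‖x‖ ^ 2 ≤ 1 := pow_le_one₀ (norm_nonneg _) (mem_ball_zero_iff.1 hx).le
    have ha := h.le_α _ hz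
    have hb' := h.le_β _ hz
    have h1 : -(t * profile q (‖x‖ ^ 2)) ≤ X := by
      refine (neg_le_abs _).trans ?_
      rw [abs_mul, abs_of_pos ht]
      exact (mul_le_of_le_one_left (abs_nonneg _) ht1).trans (hb _ hz).1
    have h2 : t * (q (‖x‖ ^ 2) * ‖x‖ ^ 2) ≤ X := by
      refine (le_abs_self _).trans ?_
      rw [abs_mul, abs_of_pos ht, abs_mul, abs_of_nonneg hz]
      refine (mul_le_of_le_one_left (by positivity) ht1).trans ?_
      exact (mul_le_of_le_one_right (abs_nonneg _) hx2).trans (hb _ hz).2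
    rw [radialJac, hJ]
    refine mul_le_mul (pow_le_pow_left₀ (by linarith) (by linarith) _) (by linarith) (by linarith)
      (by positivity)
  have hmeas : AEStronglyMeasurable (fun y => ‖u (Ψ.symm y) - u y‖ ^ 2)
      (volume.restrict (ball 0 1)) :=
    ((h.differentiable_sub hu).continuous.norm.pow 2).aestronglyMeasurable
  rw [integral_eq_lintegral_of_nonneg_ae (Filter.Eventually.of_forall fun _ => by positivity) hmeas]
  refine ENNReal.toReal_le_of_le_ofReal (by positivity) ?_
  rw [h.setLIntegral_eq]
  calc _ ≤ ∫⁻ x in ball 0 1, ENNReal.ofReal J *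
          ENNReal.ofReal (‖u ((1 - t * profile q (‖x‖ ^ 2)) • x) - u x‖ ^ 2) := by
        refine setLIntegral_mono' measurableSet_ball fun x hx => ?_
        rw [Ψ.symm_apply_apply, ← h.apply_eq, norm_sub_rev]
        gcongr
        exact hjac x hx
    _ ≤ ENNReal.ofReal J * (ENNReal.ofReal (t ^ 2) *
        (2 ^ (m + 3) * ∫⁻ x in ball 0 1, ENNReal.ofReal (X ^ 2 * gsq u x))) := by
        rw [lintegral_const_mul' _ _ (by finiteness)]
        gcongr
        exact lintegral_norm_sub_radial_sq_le ht hσ (fun z hz => (hb z hz).1) hu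
    _ = _ := by
        rw [← ofReal_integral_eq_lintegral_ofReal (hG.const_mul _)
          (Filter.Eventually.of_forall fun x => mul_nonneg (by positivity) (gsq_nonneg u x)),
          integral_const_mul, ← hI,
          show (2 : ENNReal) ^ (m + 3) = ENNReal.ofReal (2 ^ (m + 3)) by
            rw [ENNReal.ofReal_pow (by norm_num)]; simp,
          ← ENNReal.ofReal_mul (by positivity), ← ENNReal.ofReal_mul (by positivity),
          ← ENNReal.ofReal_mul (by positivity)]
        congr 1
        ring

end Displacement

section Solutions

/-- The potential term of the Ginzburg–Landau energy. -/
def potential {n : ℕ} (ε : ℝ) (u : Euc n → ℂ) (x : Euc n) : ℝ :=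
  (1 - ‖u x‖ ^ 2) ^ 2 / (4 * ε ^ 2)

/-- The energy density with respect to Lebesgue measure, for principal coefficients `a` and
density `s`. -/
def dens {n : ℕ} (a : Euc n → Matrix (Fin n) (Fin n) ℝ) (s : Euc n → ℝ) (ε : ℝ)
    (u : Euc n → ℂ) (x : Euc n) : ℝ :=
  qf (a x) (grad u x) (grad u x) / 2 + s x * potential ε u x

/-- Weak solutions of the Ginzburg–Landau equation in divergence form. -/
structure IsSol {n : ℕ} (c L ε : ℝ) (a : Euc n → Matrix (Fin n) (Fin n) ℝ) (s : Euc n → ℝ)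
    (u : Euc n → ℂ) : Prop extends IsCoeff c L a s where
  c_pos : 0 < c
  one_le_L : 1 ≤ L
  ε_pos : 0 < ε
  diff : DifferentiableOn ℝ u (ball 0 1)
  norm_le : ∀ x ∈ ball (0 : Euc n) 1, ‖u x‖ ≤ 1
  integrable_gsq : IntegrableOn (gsq u) (ball 0 1)
  weak : ∀ ζ : Euc n → ℂ, ContDiff ℝ 1 ζ → tsupport ζ ⊆ ball (0 : Euc n) 1 →
    ∫ x in ball (0 : Euc n) 1, (qf (a x) (grad u x) (grad ζ x) -
      (1 - ‖u x‖ ^ 2) / ε ^ 2 * s x * inner ℝ (u x) (ζ x)) = 0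

section General
variable {n : ℕ} {c L ε : ℝ} {a : Euc n → Matrix (Fin n) (Fin n) ℝ} {s : Euc n → ℝ}
  {u : Euc n → ℂ}

theorem integrable_inner_of_memLp {F G : Euc n → ℂ} (hF : MemLp F 2 volume)
    (hG : MemLp G 2 volume) : Integrable fun x => (inner ℝ (F x) (G x) : ℝ) := by
  refine ((hF.integrable_norm_pow two_ne_zero).add (hG.integrable_norm_pow two_ne_zero)).mono'
    (hF.1.inner hG.1) (Filter.Eventually.of_forall fun x => ?_)
  refine (norm_inner_le_norm _ _).trans ?_
  simp only [Pi.add_apply]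
  nlinarith [sq_nonneg (‖F x‖ - ‖G x‖), sq_nonneg (‖F x‖), sq_nonneg ‖G x‖]

theorem potential_nonneg (ε : ℝ) (u : Euc n → ℂ) (x : Euc n) : 0 ≤ potential ε u x := by
  unfold potential; positivity

theorem IsCoeff.continuousOn_a (h : IsCoeff c L a s) (hL : 0 ≤ L) (i j : Fin n) :
    ContinuousOn (fun x => a x i j) (ball 0 1) :=
  (LipschitzOnWith.of_dist_le_mul (K := ⟨L, hL⟩) fun x hx y hy => by
    rw [Real.dist_eq, dist_eq_norm]; exact h.a_lip x hx y hy i j).continuousOn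

theorem IsCoeff.continuousOn_s (h : IsCoeff c L a s) (hL : 0 ≤ L) :
    ContinuousOn s (ball 0 1) :=
  (LipschitzOnWith.of_dist_le_mul (K := ⟨L, hL⟩) fun x hx y hy => by
    rw [Real.dist_eq, dist_eq_norm]; exact h.s_lip x hx y hy).continuousOn

namespace IsSol

theorem L_nonneg (h : IsSol c L ε a s u) : 0 ≤ L := zero_le_one.trans h.one_le_L

theorem aesm_a (h : IsSol c L ε a s u) (i j : Fin n) :
    AEStronglyMeasurable (fun x => a x i j) (volume.restrict (ball 0 1)) :=
  (h.continuousOn_a h.L_nonneg i j).aestronglyMeasurable measurableSet_ball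

theorem aesm_s (h : IsSol c L ε a s u) :
    AEStronglyMeasurable s (volume.restrict (ball 0 1)) :=
  (h.continuousOn_s h.L_nonneg).aestronglyMeasurable measurableSet_ball

theorem aesm_u (h : IsSol c L ε a s u) :
    AEStronglyMeasurable u (volume.restrict (ball 0 1)) :=
  h.diff.continuousOn.aestronglyMeasurable measurableSet_ball

theorem aesm_potential {v : Euc n → ℂ}
    (hv : AEStronglyMeasurable v (volume.restrict (ball 0 1))) :
    AEStronglyMeasurable (potential ε v) (volume.restrict (ball 0 1)) :=
  ((aestronglyMeasurable_const.sub (hv.norm.pow 2)).pow 2).mul_const _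

theorem aesm_qf (h : IsSol c L ε a s u) (v w : Euc n → ℂ) :
    AEStronglyMeasurable (fun x => qf (a x) (grad v x) (grad w x))
      (volume.restrict (ball 0 1)) := by
  unfold qf
  exact Finset.aestronglyMeasurable_fun_sum _ fun i _ =>
    Finset.aestronglyMeasurable_fun_sum _ fun j _ => (h.aesm_a i j).mul
      ((measurable_pd v i).aestronglyMeasurable.inner (measurable_pd w j).aestronglyMeasurable)

theorem s_nonneg (h : IsSol c L ε a s u) {x : Euc n} (hx : x ∈ ball (0 : Euc n) 1) : 0 ≤ s x :=
  h.c_pos.le.trans (h.le_s x hx)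

theorem abs_qf_grad_le (h : IsSol c L ε a s u) {x : Euc n} (hx : x ∈ ball (0 : Euc n) 1)
    (v w : Euc n → ℂ) :
    |qf (a x) (grad v x) (grad w x)| ≤ L * n * ((gsq v x + gsq w x) / 2) :=
  abs_qf_le (h.a_le x hx) _ _

theorem integrableOn_qf (h : IsSol c L ε a s u) {v w : Euc n → ℂ}
    (hv : IntegrableOn (gsq v) (ball 0 1)) (hw : IntegrableOn (gsq w) (ball 0 1)) :
    IntegrableOn (fun x => qf (a x) (grad v x) (grad w x)) (ball 0 1) := by
  refine (((hv.add hw).div_const 2).const_mul (L * n)).mono' (h.aesm_qf v w) ?_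
  filter_upwards [ae_restrict_mem measurableSet_ball] with x hx
  exact h.abs_qf_grad_le hx v w

theorem potential_le (h : IsSol c L ε a s u) {v : ℂ} (hv : ‖v‖ ≤ 1) :
    (1 - ‖v‖ ^ 2) ^ 2 / (4 * ε ^ 2) ≤ 1 / (4 * ε ^ 2) := by
  have := norm_nonneg v
  have := h.ε_pos
  gcongr
  exact pow_le_one₀ (by nlinarith) (by nlinarith)

theorem integrableOn_potential (h : IsSol c L ε a s u) {v : Euc n → ℂ}
    (hv : AEStronglyMeasurable v (volume.restrict (ball 0 1)))
    (hv1 : ∀ x ∈ ball (0 : Euc n) 1, ‖v x‖ ≤ 1) :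
    IntegrableOn (potential ε v) (ball 0 1) := by
  refine Integrable.mono' (g := fun _ => 1 / (4 * ε ^ 2))
    (integrableOn_const (by finiteness)) (aesm_potential hv) ?_
  filter_upwards [ae_restrict_mem measurableSet_ball] with x hx
  rw [Real.norm_eq_abs, abs_of_nonneg (potential_nonneg _ _ _)]
  exact h.potential_le (hv1 x hx)

theorem integrableOn_s_mul (h : IsSol c L ε a s u) {f : Euc n → ℝ}
    (hf : IntegrableOn f (ball 0 1)) : IntegrableOn (fun x => s x * f x) (ball 0 1) := by
  refine (hf.norm.const_mul L).mono' (h.aesm_s.mul hf.1) ?_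
  filter_upwards [ae_restrict_mem measurableSet_ball] with x hx
  rw [norm_mul, Real.norm_eq_abs (s x), abs_of_nonneg (h.s_nonneg hx)]
  exact mul_le_mul_of_nonneg_right (h.s_le x hx) (norm_nonneg _)

theorem integrableOn_dens (h : IsSol c L ε a s u) {v : Euc n → ℂ}
    (hv : AEStronglyMeasurable v (volume.restrict (ball 0 1)))
    (hv1 : ∀ x ∈ ball (0 : Euc n) 1, ‖v x‖ ≤ 1) (hG : IntegrableOn (gsq v) (ball 0 1)) :
    IntegrableOn (dens a s ε v) (ball 0 1) :=
  ((h.integrableOn_qf hG hG).div_const 2).add (h.integrableOn_s_mul (h.integrableOn_potential hv hv1))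

theorem weak_of_differentiable (h : IsSol c L ε a s u) {d : Euc n → ℂ} (hd : Differentiable ℝ d)
    {b : ℝ} (hb : b < 1) (hds : tsupport d ⊆ closedBall 0 b)
    (hd' : ∀ j, MemLp (pd d j) 2 volume) :
    ∫ x in ball (0 : Euc n) 1, (qf (a x) (grad u x) (grad d x) -
      (1 - ‖u x‖ ^ 2) / ε ^ 2 * s x * inner ℝ (u x) (d x)) = 0 := by
  set F : Fin n → Euc n → ℂ := fun j => (ball 0 1).indicator fun x => ∑ i, a x i j • pd u i x
    with hFdef
  set f : Euc n → ℂ := (ball 0 1).indicator fun x => ((1 - ‖u x‖ ^ 2) / ε ^ 2 * s x) • u x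
    with hfdef
  have hF : ∀ j, MemLp (F j) 2 volume := by
    intro j
    rw [hFdef, memLp_indicator_iff_restrict measurableSet_ball]
    refine memLp_finsetSum _ fun i _ => ?_
    have h1 : MemLp (pd u i) 2 (volume.restrict (ball 0 1)) := by
      rw [memLp_two_iff_integrable_sq_norm (measurable_pd u i).aestronglyMeasurable]
      refine h.integrable_gsq.mono' ((measurable_pd u i).norm.pow_const 2).aestronglyMeasurable ?_
      filter_upwards with x
      rw [Real.norm_eq_abs, abs_of_nonneg (sq_nonneg _)]
      exact norm_pd_sq_le_gsq u x i
    refine h1.of_le_mul (c := L) ((h.aesm_a i j).smul (measurable_pd u i).aestronglyMeasurable) ?_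
    filter_upwards [ae_restrict_mem measurableSet_ball] with x hx
    rw [norm_smul]
    exact mul_le_mul_of_nonneg_right (h.a_le x hx i j) (norm_nonneg _)
  have hf : MemLp f 2 volume := by
    rw [hfdef, memLp_indicator_iff_restrict measurableSet_ball]
    have : IsFiniteMeasure (volume.restrict (ball (0 : Euc n) 1)) :=
      ⟨by rw [Measure.restrict_apply_univ]; exact measure_ball_lt_top⟩
    refine MemLp.of_bound ?_ (1 / ε ^ 2 * L) ?_
    · exact (((aestronglyMeasurable_const.sub (h.aesm_u.norm.pow 2)).mul_const _).mul h.aesm_s).smul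
        h.aesm_u
    · filter_upwards [ae_restrict_mem measurableSet_ball] with x hx
      have h1 := h.norm_le x hx
      have h0 := norm_nonneg (u x)
      have h2 := h.s_nonneg hx
      have h3 := h.s_le x hx
      have h4 : 0 ≤ 1 - ‖u x‖ ^ 2 := by nlinarith
      have h5 : 1 - ‖u x‖ ^ 2 ≤ 1 := by nlinarith
      have h6 := h.L_nonneg
      rw [norm_smul, Real.norm_eq_abs, abs_of_nonneg (by positivity)]
      calc _ ≤ (1 / ε ^ 2 * L) * 1 := by gcongr
        _ = _ := mul_one _
  have key : ∀ d : Euc n → ℂ, MemLp d 2 volume → (∀ j, MemLp (pd d j) 2 volume) →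
      (∑ j, ∫ x, inner ℝ (F j x) (pd d j x)) - ∫ x, inner ℝ (f x) (d x) =
      ∫ x in ball (0 : Euc n) 1, (qf (a x) (grad u x) (grad d x) -
        (1 - ‖u x‖ ^ 2) / ε ^ 2 * s x * inner ℝ (u x) (d x)) := by
    intro d hd hd'
    have i1 : ∀ j, Integrable fun x => (inner ℝ (F j x) (pd d j x) : ℝ) := fun j =>
      integrable_inner_of_memLp (hF j) (hd' j)
    have i2 : Integrable fun x => (inner ℝ (f x) (d x) : ℝ) := integrable_inner_of_memLp hf hd
    rw [← integral_finsetSum _ fun j _ => i1 j, ← integral_sub (integrable_finsetSum _ fun j _ => i1 j) i2,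
      ← integral_indicator measurableSet_ball]
    refine integral_congr_ae (Filter.Eventually.of_forall fun x => ?_)
    by_cases hx : x ∈ ball (0 : Euc n) 1
    · simp only [hFdef, hfdef, Set.indicator_of_mem hx, sum_inner, inner_smul_left, qf, grad]
      rw [Finset.sum_comm]
      simp
    · simp [hFdef, hfdef, Set.indicator_of_notMem hx]
  have hL2 : ∀ d : Euc n → ℂ, Continuous d → HasCompactSupport d → MemLp d 2 volume :=
    fun d h1 h2 => h1.memLp_of_hasCompactSupport h2
  have hcs : ∀ {d : Euc n → ℂ} {b : ℝ}, tsupport d ⊆ closedBall 0 b → HasCompactSupport d :=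
    fun h => (isCompact_closedBall _ _).of_isClosed_subset (isClosed_tsupport _) h
  rw [← key d (hL2 d hd.continuous (hcs hds)) hd']
  refine weak_form_extends hF hf (fun ζ hζ hζs => ?_) hd hb hds hd'
  have hζc : HasCompactSupport ζ := hcs (hζs.trans ball_subset_closedBall)
  rw [key ζ (hL2 ζ hζ.continuous hζc) fun j => hL2 _ ?_ ?_]
  · exact h.weak ζ hζ hζs
  · exact (hζ.continuous_fderiv one_ne_zero).clm_apply continuous_const
  · exact hζc.fderiv_apply ℝ _

end IsSol
end General
end Solutions

section Comparison

theorem potential_convexity {p p' e D δ : ℝ} (he : 0 < e) (hp0 : 0 ≤ p)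
    (hp' : p' = p + 2 * D + δ) (hδ : 0 ≤ δ) :
    (1 - p) ^ 2 / (4 * e) - (1 - p) / e * D ≤ (1 - p') ^ 2 / (4 * e) + δ / (2 * e) := by
  have : (1 - p') ^ 2 / (4 * e) + δ / (2 * e) - ((1 - p) ^ 2 / (4 * e) - (1 - p) / e * D) =
      ((2 * D + δ) ^ 2 + 2 * p * δ) / (4 * e) := by
    rw [hp']; field_simp; ring
  have h2 : 0 ≤ ((2 * D + δ) ^ 2 + 2 * p * δ) / (4 * e) := by positivity
  linarith

variable {m : ℕ} {c L ε : ℝ} {a : Euc (m + 3) → Matrix (Fin (m + 3)) (Fin (m + 3)) ℝ}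
  {s : Euc (m + 3) → ℝ} {u : Euc (m + 3) → ℂ}
  {q : ℝ → ℝ} {β t : ℝ} {Ψ : Euc (m + 3) ≃ₜ Euc (m + 3)}

namespace IsSol

theorem qf_grad_nonneg (h : IsSol c L ε a s u) {x : Euc (m + 3)}
    (hx : x ∈ ball (0 : Euc (m + 3)) 1) (v : Fin (m + 3) → ℂ) : 0 ≤ qf (a x) v v :=
  (mul_nonneg h.c_pos.le (Finset.sum_nonneg fun _ _ => sq_nonneg _)).trans
    (le_qf_self (h.elliptic x hx) v)

theorem integral_dens_le_deformed (h : IsSol c L ε a s u) (hΨ : IsRadialDiffeo q β t Ψ)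
    (ht : 0 < t) (ht1 : t ≤ 1) :
    ∫ x in ball 0 1, dens a s ε u x ≤ (∫ x in ball 0 1, dens a s ε (u ∘ Ψ.symm) x) +
      L / (2 * ε ^ 2) * ∫ y in ball 0 1, ‖u (Ψ.symm y) - u y‖ ^ 2 := by
  set d : Euc (m + 3) → ℂ := fun y => u (Ψ.symm y) - u y with hd
  have hsymm : ∀ y ∈ ball (0 : Euc (m + 3)) 1, Ψ.symm y ∈ ball (0 : Euc (m + 3)) 1 := fun y hy =>
    hΨ.apply_mem_ball_iff.1 (by simpa using hy)
  have hG' := hΨ.integrableOn_gsq ht ht1 h.diff h.integrable_gsq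
  have hu'c : ContinuousOn (u ∘ Ψ.symm) (ball 0 1) :=
    h.diff.continuousOn.comp Ψ.symm.continuous.continuousOn hsymm
  have hu'm : AEStronglyMeasurable (u ∘ Ψ.symm) (volume.restrict (ball 0 1)) :=
    hu'c.aestronglyMeasurable measurableSet_ball
  have hu'1 : ∀ y ∈ ball (0 : Euc (m + 3)) 1, ‖(u ∘ Ψ.symm) y‖ ≤ 1 := fun y hy =>
    h.norm_le _ (hsymm y hy)
  have hdd := hΨ.differentiable_sub h.diff
  have hdL := hΨ.memLp_pd_sub ht ht1 h.diff h.integrable_gsq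
  have hGd : IntegrableOn (gsq d) (ball 0 1) := by
    unfold gsq
    exact integrable_finsetSum _ fun i _ =>
      ((hdL i).integrable_norm_pow two_ne_zero).integrableOn
  have hdc : HasCompactSupport d :=
    (isCompact_closedBall _ _).of_isClosed_subset (isClosed_tsupport _) (hΨ.tsupport_sub_subset u)
  have hd2 : IntegrableOn (fun y => ‖d y‖ ^ 2) (ball 0 1) :=
    ((hdd.continuous.memLp_of_hasCompactSupport (p := 2) hdc).integrable_norm_pow
      two_ne_zero).integrableOn
  have hw := h.weak_of_differentiable hdd hΨ.sqrt_lt_one (hΨ.tsupport_sub_subset u) hdL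
  have hB : IntegrableOn (fun x => qf (a x) (grad u x) (grad d x) -
      (1 - ‖u x‖ ^ 2) / ε ^ 2 * s x * inner ℝ (u x) (d x)) (ball 0 1) := by
    refine (h.integrableOn_qf h.integrable_gsq hGd).sub ?_
    have : IntegrableOn (fun x => s x * ((1 - ‖u x‖ ^ 2) / ε ^ 2 * inner ℝ (u x) (d x)))
        (ball 0 1) := by
      refine h.integrableOn_s_mul ?_
      have hI : IntegrableOn (fun x => ‖d x‖) (ball 0 1) :=
        (hdd.continuous.norm.integrable_of_hasCompactSupport hdc.norm).integrableOn
      refine (hI.const_mul (1 / ε ^ 2)).mono' ((((aestronglyMeasurable_const.sub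
        (h.aesm_u.norm.pow 2)).mul_const _)).mul
          (h.aesm_u.inner hdd.continuous.aestronglyMeasurable)) ?_
      filter_upwards [ae_restrict_mem measurableSet_ball] with x hx
      have h1 := h.norm_le x hx
      have h0 := norm_nonneg (u x)
      have h4 : 0 ≤ 1 - ‖u x‖ ^ 2 := by nlinarith
      have h5 : 1 - ‖u x‖ ^ 2 ≤ 1 := by nlinarith
      rw [norm_mul, Real.norm_eq_abs, abs_of_nonneg (by positivity)]
      gcongr
      refine (norm_inner_le_norm _ _).trans (mul_le_of_le_one_left (norm_nonneg _) h1)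
    refine this.congr (Filter.Eventually.of_forall fun x => ?_)
    simp only
    ring
  have hE := h.integrableOn_dens h.aesm_u h.norm_le h.integrable_gsq
  have hE' := h.integrableOn_dens hu'm hu'1 hG'
  have key : ∫ x in ball 0 1, (dens a s ε u x + (qf (a x) (grad u x) (grad d x) -
      (1 - ‖u x‖ ^ 2) / ε ^ 2 * s x * inner ℝ (u x) (d x))) ≤
      ∫ x in ball 0 1, (dens a s ε (u ∘ Ψ.symm) x + L / (2 * ε ^ 2) * ‖d x‖ ^ 2) := by
    refine setIntegral_mono_on (hE.add hB) (hE'.add (hd2.const_mul _)) measurableSet_ball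
      fun x hx => ?_
    have hgrad : grad (u ∘ Ψ.symm) x = grad u x + grad d x := by
      funext i
      have := hΨ.pd_sub h.diff hx i
      simp only [grad, Pi.add_apply, hd, this, add_sub_cancel]
    have hud : (u ∘ Ψ.symm) x = u x + d x := by simp [hd]
    have h2 := potential_convexity (p := ‖u x‖ ^ 2) (p' := ‖(u ∘ Ψ.symm) x‖ ^ 2)
      (D := inner ℝ (u x) (d x)) (δ := ‖d x‖ ^ 2) (pow_pos h.ε_pos 2) (by positivity)
      (by rw [hud, norm_add_sq_real]) (by positivity)
    have h3 := mul_le_mul_of_nonneg_left h2 (h.s_nonneg hx)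
    have h4 : s x * (‖d x‖ ^ 2 / (2 * ε ^ 2)) ≤ L * (‖d x‖ ^ 2 / (2 * ε ^ 2)) := by
      have := h.ε_pos
      exact mul_le_mul_of_nonneg_right (h.s_le x hx) (by positivity)
    have h5 := h.qf_grad_nonneg hx (grad d x)
    have h6 : qf (a x) (grad (u ∘ Ψ.symm) x) (grad (u ∘ Ψ.symm) x) =
        qf (a x) (grad u x) (grad u x) + 2 * qf (a x) (grad u x) (grad d x) +
          qf (a x) (grad d x) (grad d x) := by
      rw [hgrad, qf_add_left, qf_add_right, qf_add_right, qf_comm (h.symm x hx) (grad d x)]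
      ring
    simp only [dens, potential, h6]
    have h7 : L * (‖d x‖ ^ 2 / (2 * ε ^ 2)) = L / (2 * ε ^ 2) * ‖d x‖ ^ 2 := by ring
    linarith only [h3, h4, h5, h7]
  have e1 := integral_add hE hB
  have e2 := integral_add hE' (hd2.const_mul (L / (2 * ε ^ 2)))
  rw [integral_const_mul] at e2
  rw [hw, add_zero] at e1
  exact e1.symm.le.trans (key.trans e2.le)

end IsSol
end Comparison

section Stationarity

variable {m : ℕ} {c L ε : ℝ} {a : Euc (m + 3) → Matrix (Fin (m + 3)) (Fin (m + 3)) ℝ}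
  {s : Euc (m + 3) → ℝ} {u : Euc (m + 3) → ℂ}
  {q : ℝ → ℝ} {β t : ℝ} {Ψ : Euc (m + 3) ≃ₜ Euc (m + 3)}

/-- The upper bound for the derivative of the energy density along a radial deformation with
radial profile of value `χ` and slope `p`. -/
def innerVar (L : ℝ) (a : Euc (m + 3) → Matrix (Fin (m + 3)) (Fin (m + 3)) ℝ)
    (s : Euc (m + 3) → ℝ) (ε : ℝ) (u : Euc (m + 3) → ℂ) (p χ : ℝ) (x : Euc (m + 3)) : ℝ :=
  p * ‖x‖ ^ 2 * dens a s ε u x - (m + 1) * χ * dens a s ε u x - 2 * χ * (s x * potential ε u x) -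
    p * qf (a x) (radialPart x (grad u x)) (grad u x) +
    L * (m + 3) * |χ| * ‖x‖ * (gsq u x + potential ε u x)

namespace IsSol

theorem abs_dens_le (h : IsSol c L ε a s u) {x : Euc (m + 3)} (hx : x ∈ ball (0 : Euc (m + 3)) 1) :
    |dens a s ε u x| ≤ L * (m + 3) * (gsq u x + potential ε u x) := by
  have h1 := h.abs_qf_grad_le hx u u
  have h2 : |s x * potential ε u x| ≤ L * (m + 3) * potential ε u x := by
    rw [abs_mul, abs_of_nonneg (h.s_nonneg hx), abs_of_nonneg (potential_nonneg _ _ _)]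
    have h3 : L ≤ L * (m + 3) := le_mul_of_one_le_right h.L_nonneg (by linarith [m.cast_nonneg (α := ℝ)])
    exact mul_le_mul_of_nonneg_right ((h.s_le x hx).trans h3) (potential_nonneg _ _ _)
  push_cast at h1
  have h5 := abs_nonneg (qf (a x) (grad u x) (grad u x))
  calc |dens a s ε u x| ≤ |qf (a x) (grad u x) (grad u x)| / 2 + |s x * potential ε u x| := by
        refine (abs_add_le _ _).trans ?_
        rw [abs_div, abs_two]
    _ ≤ _ := by linarith only [h1, h2, h5]

theorem abs_qf_radialPart_le (h : IsSol c L ε a s u) {x : Euc (m + 3)}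
    (hx : x ∈ ball (0 : Euc (m + 3)) 1) :
    |qf (a x) (radialPart x (grad u x)) (grad u x)| ≤ L * (m + 3) * gsq u x := by
  refine (abs_qf_le (h.a_le x hx) _ _).trans ?_
  have h5 := sum_norm_radialPart_sq_le x (grad u x)
  have h6 : ‖x‖ ^ 4 ≤ 1 := pow_le_one₀ (norm_nonneg _) (mem_ball_zero_iff.1 hx).le
  have h7 := gsq_nonneg u x
  have h8 : ∑ i, ‖radialPart x (grad u x) i‖ ^ 2 ≤ gsq u x :=
    h5.trans (mul_le_of_le_one_left h7 h6)
  have := h.L_nonneg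
  push_cast
  refine mul_le_mul_of_nonneg_left ?_ (by positivity)
  change (_ + gsq u x) / 2 ≤ _
  linarith

theorem abs_innerVar_le (h : IsSol c L ε a s u) {x : Euc (m + 3)}
    (hx : x ∈ ball (0 : Euc (m + 3)) 1) (p χ : ℝ) :
    |innerVar L a s ε u p χ x| ≤
      (m + 6) * (L * (m + 3)) * (|p| + |χ|) * (gsq u x + potential ε u x) := by
  have hd := h.abs_dens_le hx
  have hr := h.abs_qf_radialPart_le hx
  have hW := potential_nonneg ε u x
  have hG := gsq_nonneg u x
  have hx1 : ‖x‖ ≤ 1 := (mem_ball_zero_iff.1 hx).le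
  have hx2 : ‖x‖ ^ 2 ≤ 1 := pow_le_one₀ (norm_nonneg _) hx1
  have hL := h.L_nonneg
  set M := L * (m + 3) * (gsq u x + potential ε u x) with hM
  have hM0 : 0 ≤ M := by positivity
  have hsW : |s x * potential ε u x| ≤ M := by
    rw [abs_mul, abs_of_nonneg (h.s_nonneg hx), abs_of_nonneg hW, hM]
    have h3 : L ≤ L * (m + 3) := le_mul_of_one_le_right hL (by linarith [m.cast_nonneg (α := ℝ)])
    exact mul_le_mul ((h.s_le x hx).trans h3) (by linarith) hW (by positivity)
  have hr' : |qf (a x) (radialPart x (grad u x)) (grad u x)| ≤ M :=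
    hr.trans (mul_le_mul_of_nonneg_left (by linarith) (by positivity))
  have t1 : |p * ‖x‖ ^ 2 * dens a s ε u x| ≤ |p| * M := by
    rw [abs_mul, abs_mul, abs_of_nonneg (sq_nonneg ‖x‖)]
    calc |p| * ‖x‖ ^ 2 * |dens a s ε u x| ≤ |p| * 1 * M := by gcongr
      _ = _ := by ring
  have t2 : |(m + 1) * χ * dens a s ε u x| ≤ (m + 1) * (|χ| * M) := by
    rw [abs_mul, abs_mul, abs_of_nonneg (by positivity : (0 : ℝ) ≤ m + 1), mul_assoc]
    gcongr
  have t3 : |2 * χ * (s x * potential ε u x)| ≤ 2 * (|χ| * M) := by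
    rw [abs_mul, abs_mul, abs_two, mul_assoc]
    gcongr
  have t4 : |p * qf (a x) (radialPart x (grad u x)) (grad u x)| ≤ |p| * M := by
    rw [abs_mul]
    gcongr
  have t5 : |L * (m + 3) * |χ| * ‖x‖ * (gsq u x + potential ε u x)| ≤ |χ| * M := by
    rw [abs_of_nonneg (by positivity)]
    calc _ ≤ L * (m + 3) * |χ| * 1 * (gsq u x + potential ε u x) := by gcongr
      _ = _ := by rw [hM]; ring
  have key : |innerVar L a s ε u p χ x| ≤ |p| * M + (m + 1) * (|χ| * M) + 2 * (|χ| * M) +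
      |p| * M + |χ| * M := by
    unfold innerVar
    refine (abs_add_le _ _).trans (add_le_add ((abs_sub _ _).trans (add_le_add ((abs_sub _ _).trans
      (add_le_add ((abs_sub _ _).trans (add_le_add t1 t2)) t3)) t4)) t5)
  have h8 : 0 ≤ (m : ℝ) * (|p| * M) := by positivity
  have h9 : 0 ≤ |p| * M := by positivity
  have h10 : 0 ≤ |χ| * M := by positivity
  have e : (m + 6) * (L * (m + 3)) * (|p| + |χ|) * (gsq u x + potential ε u x) =
      (m + 6) * (|p| * M) + (m + 6) * (|χ| * M) := by rw [hM]; ring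
  rw [e]
  linarith only [key, h8, h9, h10]

theorem integrableOn_gsq_add_potential (h : IsSol c L ε a s u) :
    IntegrableOn (fun x => gsq u x + potential ε u x) (ball 0 1) :=
  h.integrable_gsq.add (h.integrableOn_potential h.aesm_u h.norm_le)

theorem aesm_innerVar (h : IsSol c L ε a s u) {p χ : ℝ → ℝ} (hp : Measurable p)
    (hχ : Measurable χ) :
    AEStronglyMeasurable (fun x => innerVar L a s ε u (p (‖x‖ ^ 2)) (χ (‖x‖ ^ 2)) x)
      (volume.restrict (ball 0 1)) := by
  have hn : Measurable fun x : Euc (m + 3) => ‖x‖ ^ 2 := measurable_norm.pow_const 2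
  have h1 : AEStronglyMeasurable (fun x : Euc (m + 3) => p (‖x‖ ^ 2)) (volume.restrict (ball 0 1)) :=
    (hp.comp hn).aestronglyMeasurable
  have h2 : AEStronglyMeasurable (fun x : Euc (m + 3) => χ (‖x‖ ^ 2)) (volume.restrict (ball 0 1)) :=
    (hχ.comp hn).aestronglyMeasurable
  have h3 : AEStronglyMeasurable (fun x : Euc (m + 3) => ‖x‖) (volume.restrict (ball 0 1)) :=
    measurable_norm.aestronglyMeasurable
  have hW := aesm_potential (ε := ε) h.aesm_u
  have hG : AEStronglyMeasurable (gsq u) (volume.restrict (ball 0 1)) :=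
    (measurable_gsq u).aestronglyMeasurable
  have hD : AEStronglyMeasurable (dens a s ε u) (volume.restrict (ball 0 1)) :=
    ((h.aesm_qf u u).mul_const (2 : ℝ)⁻¹).add (h.aesm_s.mul hW)
  have hR : AEStronglyMeasurable (fun x => qf (a x) (radialPart x (grad u x)) (grad u x))
      (volume.restrict (ball 0 1)) := by
    have hr : ∀ i, Measurable fun x => radialPart x (grad u x) i := fun i => by
      unfold radialPart contract
      exact ((by fun_prop : Continuous fun x : Euc (m + 3) => x i).measurable).smul
        (Finset.measurable_sum _ fun k _ =>
          ((by fun_prop : Continuous fun x : Euc (m + 3) => x k).measurable).smul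
            (measurable_pd u k))
    unfold qf
    exact Finset.aestronglyMeasurable_fun_sum _ fun i _ =>
      Finset.aestronglyMeasurable_fun_sum _ fun j _ => (h.aesm_a i j).mul
        ((hr i).aestronglyMeasurable.inner (measurable_pd u j).aestronglyMeasurable)
  exact (((((h1.mul (h3.pow 2)).mul hD).sub ((h2.const_mul _).mul hD)).sub
    ((h2.const_mul _).mul (h.aesm_s.mul hW))).sub (h1.mul hR)).add
      (((h2.norm.const_mul _).mul h3).mul (hG.add hW))

theorem integrableOn_innerVar (h : IsSol c L ε a s u) {p χ : ℝ → ℝ} (hp : Measurable p)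
    (hχ : Measurable χ) {X : ℝ} (hpX : ∀ z, 0 ≤ z → |p z| ≤ X) (hχX : ∀ z, 0 ≤ z → |χ z| ≤ X) :
    IntegrableOn (fun x => innerVar L a s ε u (p (‖x‖ ^ 2)) (χ (‖x‖ ^ 2)) x) (ball 0 1) := by
  refine (h.integrableOn_gsq_add_potential.const_mul
    ((m + 6) * (L * (m + 3)) * (X + X))).mono' (h.aesm_innerVar hp hχ) ?_
  filter_upwards [ae_restrict_mem measurableSet_ball] with x hx
  refine (h.abs_innerVar_le hx _ _).trans ?_
  have := h.L_nonneg
  have := add_nonneg (gsq_nonneg u x) (potential_nonneg ε u x)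
  gcongr
  · exact hpX _ (by positivity)
  · exact hχX _ (by positivity)

theorem integral_innerVar_nonneg (h : IsSol c L ε a s u) (hq : Continuous q) (hβ : β < 1)
    (hq0 : ∀ z, β ≤ z → q z = 0) :
    0 ≤ ∫ x in ball 0 1, innerVar L a s ε u (q (‖x‖ ^ 2)) (profile q (‖x‖ ^ 2)) x := by
  obtain ⟨t₀, ht₀, ht₁, hex⟩ := exists_isRadialDiffeo m hq hβ hq0
  obtain ⟨C, hC, hd⟩ := exists_integral_norm_sub_sq_le m hq hβ hq0 h.diff h.integrable_gsq
  obtain ⟨X, hX, hb⟩ := exists_profile_bound hq hβ.le hq0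
  obtain ⟨C', hC', H⟩ := exists_deformed_energy_bound m h.L_nonneg hX.le
  have hN := h.integrableOn_innerVar hq.measurable (continuous_profile hq).measurable
    (fun z hz => (hb z hz).2) fun z hz => (hb z hz).1
  set N := fun x : Euc (m + 3) => innerVar L a s ε u (q (‖x‖ ^ 2)) (profile q (‖x‖ ^ 2)) x
    with hNdef
  set S := ∫ x in ball 0 1, (gsq u x + potential ε u x) with hS
  have hS0 : 0 ≤ S := integral_nonneg fun x => add_nonneg (gsq_nonneg u x) (potential_nonneg ε u x)
  have hL := h.L_nonneg
  have hE := h.integrableOn_dens h.aesm_u h.norm_le h.integrable_gsq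
  have step : ∀ t, 0 < t → t < t₀ →
      0 ≤ (∫ x in ball 0 1, N x) + t * (C' * S + L / (2 * ε ^ 2) * C) := by
    intro t ht htt
    have ht1 : t ≤ 1 := htt.le.trans ht₁
    obtain ⟨Ψ, hΨ⟩ := hex t ht htt
    have h1 := h.integral_dens_le_deformed hΨ ht ht1
    have h2 := hd t ht ht1 (fun σ h0 h1 => hex σ h0 (h1.trans_lt htt)) Ψ hΨ
    have hsymm : ∀ y ∈ ball (0 : Euc (m + 3)) 1, Ψ.symm y ∈ ball (0 : Euc (m + 3)) 1 :=
      fun y hy => hΨ.apply_mem_ball_iff.1 (by simpa using hy)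
    have hu'm : AEStronglyMeasurable (u ∘ Ψ.symm) (volume.restrict (ball 0 1)) :=
      (h.diff.continuousOn.comp Ψ.symm.continuous.continuousOn hsymm).aestronglyMeasurable
        measurableSet_ball
    have hE' := h.integrableOn_dens hu'm (fun y hy => h.norm_le _ (hsymm y hy))
      (hΨ.integrableOn_gsq ht ht1 h.diff h.integrable_gsq)
    have h3 : ∫ x in ball 0 1, dens a s ε (u ∘ Ψ.symm) x ≤
        ∫ x in ball 0 1, (dens a s ε u x + t * N x +
          C' * t ^ 2 * (gsq u x + potential ε u x)) := by
      rw [hΨ.setIntegral_eq]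
      refine setIntegral_mono_on ((hΨ.integrableOn_iff _).1 hE')
        ((hE.add (hN.const_mul t)).add (h.integrableOn_gsq_add_potential.const_mul _))
        measurableSet_ball fun x hx => ?_
      have hΨx := hΨ.apply_mem_ball_iff.2 hx
      have hz : 0 ≤ ‖x‖ ^ 2 := by positivity
      have hdist := hΨ.norm_apply_sub_self ht.le x
      have hpot : potential ε (u ∘ Ψ.symm) (Ψ x) = potential ε u x := by simp [potential]
      have := H x (grad u x) (grad (u ∘ Ψ.symm) (Ψ x)) (a x) (a (Ψ x)) (s x) (s (Ψ x))
        (potential ε u x) t (profile q (‖x‖ ^ 2)) (q (‖x‖ ^ 2)) (mem_ball_zero_iff.1 hx).le ht ht1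
        (hb _ hz).1 (hb _ hz).2 (hΨ.le_α _ hz) (hΨ.le_β _ hz) (h.symm _ hΨx) (h.a_le x hx)
        (h.a_le _ hΨx) (fun i j => hdist ▸ h.a_lip _ hΨx x hx i j) (hdist ▸ h.s_lip _ hΨx x hx)
        (by rw [abs_of_nonneg (h.s_nonneg hx)]; exact h.s_le x hx) (potential_nonneg _ _ _)
        (hΨ.grad_eq (h.diff.differentiableAt (isOpen_ball.mem_nhds hx)))
      rw [dens, hpot, mul_comm, radialJac]
      exact this
    have e1 := integral_add (hE.add (hN.const_mul t))
      (h.integrableOn_gsq_add_potential.const_mul (C' * t ^ 2))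
    have e2 := integral_add hE (hN.const_mul t)
    rw [integral_const_mul] at e1 e2
    simp only [Pi.add_apply] at e1
    rw [e1, e2] at h3
    have h4 : L / (2 * ε ^ 2) * ∫ y in ball 0 1, ‖u (Ψ.symm y) - u y‖ ^ 2 ≤
        L / (2 * ε ^ 2) * (C * t ^ 2) := mul_le_mul_of_nonneg_left h2 (by positivity)
    have h5 : 0 ≤ t * ((∫ x in ball 0 1, N x) + t * (C' * S + L / (2 * ε ^ 2) * C)) := by
      have e : t * ((∫ x in ball 0 1, N x) + t * (C' * S + L / (2 * ε ^ 2) * C)) =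
        t * (∫ x in ball 0 1, N x) + C' * t ^ 2 * S + L / (2 * ε ^ 2) * (C * t ^ 2) := by ring
      rw [e]
      linarith only [h1, h3, h4]
    exact nonneg_of_mul_nonneg_right h5 ht
  have hlim : Filter.Tendsto (fun t : ℝ => (∫ x in ball 0 1, N x) +
      t * (C' * S + L / (2 * ε ^ 2) * C)) (𝓝[>] 0)
      (𝓝 ((∫ x in ball 0 1, N x) + 0 * (C' * S + L / (2 * ε ^ 2) * C))) :=
    ((Continuous.tendsto (by fun_prop) 0).mono_left nhdsWithin_le_nhds)
  rw [zero_mul, add_zero] at hlim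
  refine ge_of_tendsto hlim ?_
  filter_upwards [Ioo_mem_nhdsGT ht₀] with t ht
  exact step t ht.1 ht.2

end IsSol
end Stationarity

section RadialWeights

/-- The integral of `τ⁻⁽ᵏ⁺¹⁾` from `max r ρ` to `σ`. -/
def tail (k : ℕ) (ρ σ r : ℝ) : ℝ := ∫ τ in (max r ρ)..σ, (τ ^ (k + 1))⁻¹

variable {ρ σ : ℝ}

theorem intervalIntegrable_inv_pow {b : ℝ} (hb : 0 < b) (hσ : b ≤ σ) (k : ℕ) :
    IntervalIntegrable (fun τ : ℝ => (τ ^ k)⁻¹) volume b σ := by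
  refine ContinuousOn.intervalIntegrable (ContinuousOn.inv₀ (by fun_prop) fun τ hτ => ?_)
  rw [Set.uIcc_of_le hσ] at hτ
  exact (pow_pos (hb.trans_le hτ.1) _).ne'

theorem mul_tail (k : ℕ) (hρ : 0 < ρ) (hρσ : ρ ≤ σ) {r : ℝ} (hr : r ≤ σ) :
    k * tail k ρ σ r = (max r ρ ^ k)⁻¹ - (σ ^ k)⁻¹ := by
  have hb : 0 < max r ρ := hρ.trans_le (le_max_right _ _)
  have hbσ : max r ρ ≤ σ := max_le hr hρσ
  have hd : ∀ τ ∈ Set.uIcc (max r ρ) σ,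
      HasDerivAt (fun τ : ℝ => -(τ ^ k)⁻¹) (k * (τ ^ (k + 1))⁻¹) τ := by
    intro τ hτ
    rw [Set.uIcc_of_le hbσ] at hτ
    have hτ0 : 0 < τ := hb.trans_le hτ.1
    have := ((hasDerivAt_pow k τ).inv (pow_pos hτ0 k).ne').neg
    refine HasDerivAt.congr_deriv this ?_
    rcases k with _ | k
    · simp
    · simp only [Nat.add_sub_cancel]
      field_simp
      ring
  have := intervalIntegral.integral_eq_sub_of_hasDerivAt hd
    ((intervalIntegrable_inv_pow hb hbσ _).const_mul _)
  rw [intervalIntegral.integral_const_mul] at this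
  rw [tail, this]
  ring

theorem tail_nonneg (k : ℕ) (hρ : 0 < ρ) (hρσ : ρ ≤ σ) {r : ℝ} (hr : r ≤ σ) :
    0 ≤ tail k ρ σ r :=
  intervalIntegral.integral_nonneg (max_le hr hρσ) fun τ hτ => by
    have : 0 < τ := (hρ.trans_le (le_max_right _ _)).trans_le hτ.1
    positivity

theorem tail_succ_mul_le (k : ℕ) (hρ : 0 < ρ) (hρσ : ρ ≤ σ) {r : ℝ} (hr : r ≤ σ) :
    tail (k + 1) ρ σ r * r ≤ tail k ρ σ r := by
  have hb : 0 < max r ρ := hρ.trans_le (le_max_right _ _)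
  have hbσ : max r ρ ≤ σ := max_le hr hρσ
  rw [tail, tail, ← intervalIntegral.integral_mul_const]
  refine intervalIntegral.integral_mono_on hbσ ((intervalIntegrable_inv_pow hb hbσ _).mul_const _)
    (intervalIntegrable_inv_pow hb hbσ _) fun τ hτ => ?_
  have hτ0 : 0 < τ := hb.trans_le hτ.1
  have hrτ : r ≤ τ := (le_max_left _ _).trans hτ.1
  rw [pow_succ τ (k + 1), mul_inv, mul_assoc]
  refine mul_le_of_le_one_right (by positivity) ?_
  rw [inv_mul_le_one₀ hτ0]
  exact hrτ

theorem setIntegral_tail_mul {n : ℕ} (k : ℕ) (hρ : 0 < ρ) (hρσ : ρ ≤ σ) {H : Euc n → ℝ}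
    (hH : IntegrableOn H (ball 0 σ)) :
    IntegrableOn (fun x => tail k ρ σ ‖x‖ * H x) (ball 0 σ) ∧
    ∫ x in ball 0 σ, tail k ρ σ ‖x‖ * H x =
      ∫ τ in ρ..σ, (τ ^ (k + 1))⁻¹ * ∫ x in ball 0 τ, H x := by
  set S : Set (Euc n × ℝ) := {p | ‖p.1‖ < p.2} with hS
  have hSm : MeasurableSet S := measurableSet_lt (by fun_prop) (by fun_prop)
  set F : Euc n × ℝ → ℝ := S.indicator fun p => (p.2 ^ (k + 1))⁻¹ * H p.1 with hF
  have hFi : Integrable F ((volume.restrict (ball 0 σ)).prod (volume.restrict (Set.Ioc ρ σ))) := by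
    have h1 : Integrable (fun p : Euc n × ℝ => (ρ ^ (k + 1))⁻¹ * ‖H p.1‖)
        ((volume.restrict (ball 0 σ)).prod (volume.restrict (Set.Ioc ρ σ))) :=
      (Integrable.comp_fst (f := fun x => ‖H x‖) hH.norm _).const_mul _
    refine h1.mono' ?_ ?_
    · refine AEStronglyMeasurable.indicator (AEStronglyMeasurable.mul ?_ hH.1.comp_fst) hSm
      exact (measurable_snd.pow_const _).inv.aestronglyMeasurable
    · have hae : ∀ᵐ p ∂((volume.restrict (ball (0 : Euc n) σ)).prod
          (volume.restrict (Set.Ioc ρ σ))), p.2 ∈ Set.Ioc ρ σ :=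
        Measure.quasiMeasurePreserving_snd.ae (ae_restrict_mem measurableSet_Ioc)
      filter_upwards [hae] with p hp
      refine (norm_indicator_le_norm_self _ _).trans ?_
      rw [norm_mul, norm_inv, norm_pow, Real.norm_eq_abs, abs_of_pos (hρ.trans hp.1)]
      gcongr
      exact hp.1.le
  have e1 : ∀ x ∈ ball (0 : Euc n) σ, ∫ τ in Set.Ioc ρ σ, F (x, τ) = tail k ρ σ ‖x‖ * H x := by
    intro x hx
    rw [mem_ball_zero_iff] at hx
    rw [tail, intervalIntegral.integral_of_le (max_le hx.le hρσ), ← integral_mul_const]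
    have hset : Set.Ioc (max ‖x‖ ρ) σ = Set.Ioc ρ σ ∩ {τ | ‖x‖ < τ} := by
      ext τ
      simp only [Set.mem_Ioc, max_lt_iff, Set.mem_inter_iff, Set.mem_ofPred_eq]
      tauto
    rw [hset, ← setIntegral_indicator (measurableSet_lt measurable_const measurable_id')]
    rfl
  have e2 : ∀ τ ∈ Set.Ioc ρ σ, ∫ x in ball 0 σ, F (x, τ) =
      (τ ^ (k + 1))⁻¹ * ∫ x in ball 0 τ, H x := by
    intro τ hτ
    rw [← integral_const_mul]
    have hset : ball (0 : Euc n) τ = ball 0 σ ∩ {x | ‖x‖ < τ} := by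
      ext x
      simp only [mem_ball_zero_iff, Set.mem_inter_iff, Set.mem_ofPred_eq]
      exact ⟨fun h => ⟨h.trans_le hτ.2, h⟩, fun h => h.2⟩
    rw [hset, ← setIntegral_indicator (measurableSet_lt measurable_norm measurable_const)]
    rfl
  constructor
  · refine (hFi.integral_prod_left).congr ?_
    filter_upwards [ae_restrict_mem measurableSet_ball] with x hx
    exact e1 x hx
  · rw [intervalIntegral.integral_of_le hρσ, ← setIntegral_congr_fun measurableSet_ball e1,
      ← setIntegral_congr_fun measurableSet_Ioc e2]
    exact integral_integral_swap hFi

/-- The limiting radial slope, as a function of the squared radius. -/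
def radialSlope (N : ℕ) (ρ σ z : ℝ) : ℝ :=
  (Set.Ico (ρ ^ 2) (σ ^ 2)).indicator (fun z => (√z ^ N)⁻¹) z

/-- Continuous approximations of `radialSlope`. -/
def slopeApprox (N : ℕ) (ρ σ : ℝ) (k : ℕ) (z : ℝ) : ℝ :=
  (√(max z (ρ ^ 2)) ^ N)⁻¹ * (min 1 (max 0 (k * (σ ^ 2 - z))) *
    min 1 (max 0 (k * (z - ρ ^ 2) + 1)))

theorem continuous_slopeApprox (N : ℕ) (hρ : 0 < ρ) (σ : ℝ) (k : ℕ) :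
    Continuous (slopeApprox N ρ σ k) := by
  unfold slopeApprox
  refine Continuous.mul (Continuous.inv₀ (by fun_prop) fun z => ?_) (by fun_prop)
  have : 0 < √(max z (ρ ^ 2)) := Real.sqrt_pos.2 (lt_max_of_lt_right (by positivity))
  positivity

theorem slopeApprox_eq_zero (N : ℕ) (k : ℕ) {z : ℝ} (hz : σ ^ 2 ≤ z) :
    slopeApprox N ρ σ k z = 0 := by
  have : (k : ℝ) * (σ ^ 2 - z) ≤ 0 := mul_nonpos_of_nonneg_of_nonpos k.cast_nonneg (by linarith)
  simp [slopeApprox, max_eq_left this]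

theorem abs_slopeApprox_le (N : ℕ) (hρ : 0 < ρ) (k : ℕ) (z : ℝ) :
    |slopeApprox N ρ σ k z| ≤ (ρ ^ N)⁻¹ := by
  have h1 : ρ ≤ √(max z (ρ ^ 2)) := Real.le_sqrt_of_sq_le (le_max_right _ _)
  have h2 : ∀ y : ℝ, 0 ≤ min 1 (max 0 y) ∧ min 1 (max 0 y) ≤ 1 := fun y =>
    ⟨le_min zero_le_one (le_max_left _ _), min_le_left _ _⟩
  have h3 := h2 (k * (σ ^ 2 - z))
  have h4 := h2 (k * (z - ρ ^ 2) + 1)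
  rw [slopeApprox, abs_mul, abs_of_nonneg (mul_nonneg h3.1 h4.1), abs_of_nonneg (by positivity)]
  calc _ ≤ (√(max z (ρ ^ 2)) ^ N)⁻¹ * 1 := by
        gcongr
        exact mul_le_one₀ h3.2 h4.1 h4.2
    _ ≤ _ := by
        rw [mul_one]
        gcongr

theorem tendsto_slopeApprox (N : ℕ) (ρ σ z : ℝ) :
    Filter.Tendsto (fun k => slopeApprox N ρ σ k z) Filter.atTop (𝓝 (radialSlope N ρ σ z)) := by
  have hk : ∀ y : ℝ, 0 < y → ∀ᶠ k : ℕ in Filter.atTop, 1 ≤ k * y := fun y hy =>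
    (tendsto_natCast_atTop_atTop.atTop_mul_const hy).eventually_ge_atTop 1
  refine tendsto_const_nhds.congr' ?_
  by_cases hz : z ∈ Set.Ico (ρ ^ 2) (σ ^ 2)
  · filter_upwards [hk (σ ^ 2 - z) (by linarith [hz.2])] with k h1
    have h2 : 1 ≤ (k : ℝ) * (z - ρ ^ 2) + 1 := by
      have := mul_nonneg (k.cast_nonneg (α := ℝ)) (sub_nonneg.2 hz.1)
      linarith
    rw [radialSlope, Set.indicator_of_mem hz, slopeApprox, max_eq_left hz.1,
      min_eq_left (h1.trans (le_max_right _ _)), min_eq_left (h2.trans (le_max_right _ _))]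
    simp
  · rw [radialSlope, Set.indicator_of_notMem hz]
    rw [Set.mem_Ico, not_and_or, not_le, not_lt] at hz
    rcases hz with hz | hz
    · filter_upwards [hk (ρ ^ 2 - z) (by linarith)] with k h1
      have h2 : (k : ℝ) * (z - ρ ^ 2) + 1 ≤ 0 := by linarith
      simp [slopeApprox, max_eq_left h2]
    · exact Filter.Eventually.of_forall fun k => (slopeApprox_eq_zero N k hz).symm

theorem profile_radialSlope (k : ℕ) (hρ : 0 < ρ) (hρσ : ρ ≤ σ) (hσ : σ ≤ 1) {r : ℝ} (hr0 : 0 ≤ r)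
    (hr : r ≤ σ) : profile (radialSlope (k + 3) ρ σ) (r ^ 2) = tail (k + 1) ρ σ r := by
  have hσ0 : 0 < σ := hρ.trans_le hρσ
  set b := max r ρ with hb
  have hb0 : 0 < b := hρ.trans_le (le_max_right _ _)
  have hbσ : b ≤ σ := max_le hr hρσ
  have hbσ2 : b ^ 2 ≤ σ ^ 2 := by gcongr
  have hrb : r ^ 2 ≤ b ^ 2 := by gcongr; exact le_max_left _ _
  have hσ1 : σ ^ 2 ≤ 1 := pow_le_one₀ hσ0.le hσ
  have hset : (Set.Ioo (r ^ 2) 1 ∩ Set.Ico (ρ ^ 2) (σ ^ 2) : Set ℝ) =ᵐ[volume]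
      (Set.Ioc (b ^ 2) (σ ^ 2) : Set ℝ) := by
    have h1 : Set.Ioo (r ^ 2) 1 ∩ Set.Ioo (ρ ^ 2) (σ ^ 2) = Set.Ioo (b ^ 2) (σ ^ 2) := by
      rw [Set.Ioo_inter_Ioo]
      congr 1
      · rw [hb]
        rcases le_total r ρ with h | h
        · rw [max_eq_right h, sup_of_le_right (by gcongr)]
        · rw [max_eq_left h, sup_of_le_left (by gcongr)]
      · exact inf_of_le_right hσ1
    have h2 : (Set.Ioo (r ^ 2) 1 ∩ Set.Ico (ρ ^ 2) (σ ^ 2) : Set ℝ) =ᵐ[volume]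
        (Set.Ioo (r ^ 2) 1 ∩ Set.Ioo (ρ ^ 2) (σ ^ 2) : Set ℝ) :=
      ae_eq_set_inter (Filter.EventuallyEq.refl _ _) Ioo_ae_eq_Ico.symm
    rw [h1] at h2
    exact Filter.EventuallyEq.trans h2 Ioo_ae_eq_Ioc
  have e1 : ∫ y in (r ^ 2)..1, radialSlope (k + 3) ρ σ y =
      ∫ y in (b ^ 2)..(σ ^ 2), (√y ^ (k + 3))⁻¹ := by
    rw [intervalIntegral.integral_of_le (hrb.trans (hbσ2.trans hσ1)), integral_Ioc_eq_integral_Ioo,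
      intervalIntegral.integral_of_le hbσ2]
    unfold radialSlope
    rw [setIntegral_indicator measurableSet_Ico, setIntegral_congr_set hset]
  have hd : ∀ y ∈ Set.uIcc (b ^ 2) (σ ^ 2),
      HasDerivAt (fun y : ℝ => -2 * (√y ^ (k + 1))⁻¹) ((k + 1) * (√y ^ (k + 3))⁻¹) y := by
    intro y hy
    rw [Set.uIcc_of_le hbσ2] at hy
    have hy0 : 0 < y := (pow_pos hb0 2).trans_le hy.1
    have hs : 0 < √y := Real.sqrt_pos.2 hy0
    have h1 := ((Real.hasDerivAt_sqrt hy0.ne').pow (k + 1))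
    have h2 := (h1.inv (pow_pos hs _).ne').const_mul (-2)
    refine HasDerivAt.congr_deriv h2 ?_
    simp only [Nat.add_sub_cancel, Pi.pow_apply]
    field_simp
    push_cast
    ring
  have hint : IntervalIntegrable (fun y : ℝ => (k + 1) * (√y ^ (k + 3))⁻¹) volume
      (b ^ 2) (σ ^ 2) := by
    refine ContinuousOn.intervalIntegrable (continuousOn_const.mul
      (ContinuousOn.inv₀ (by fun_prop) fun y hy => ?_))
    rw [Set.uIcc_of_le hbσ2] at hy
    exact (pow_pos (Real.sqrt_pos.2 ((pow_pos hb0 2).trans_le hy.1)) _).ne'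
  have e2 := intervalIntegral.integral_eq_sub_of_hasDerivAt hd hint
  rw [intervalIntegral.integral_const_mul, ← e1, Real.sqrt_sq hb0.le, Real.sqrt_sq hσ0.le] at e2
  have e3 := mul_tail (k + 1) hρ hρσ hr
  rw [← hb] at e3
  push_cast at e3
  have hk : (0 : ℝ) < k + 1 := by positivity
  refine mul_left_cancel₀ hk.ne' ?_
  rw [e3, profile]
  linarith

end RadialWeights

section LimitingVariation

variable {m : ℕ} {c L ε : ℝ} {a : Euc (m + 3) → Matrix (Fin (m + 3)) (Fin (m + 3)) ℝ}
  {s : Euc (m + 3) → ℝ} {u : Euc (m + 3) → ℂ} {ρ σ : ℝ}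

theorem radialSlope_eq_zero (N : ℕ) {z : ℝ} (hz : σ ^ 2 ≤ z) : radialSlope N ρ σ z = 0 :=
  Set.indicator_of_notMem (fun h => absurd h.2 (not_lt.2 hz)) _

theorem abs_profile_le {q : ℝ → ℝ} {β X z : ℝ} (hβ : β ≤ 1) (hq0 : ∀ z, β ≤ z → q z = 0)
    (hX : ∀ z, |q z| ≤ X) (hz : 0 ≤ z) : |profile q z| ≤ X := by
  have hX0 : 0 ≤ X := (abs_nonneg _).trans (hX 0)
  rcases le_total β z with h | h
  · rw [profile_eq_zero hβ hq0 h, abs_zero]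
    exact hX0
  · have h1 : |∫ y in z..1, q y| ≤ X * |1 - z| := by
      rw [← Real.norm_eq_abs]
      exact intervalIntegral.norm_integral_le_of_norm_le_const fun y _ => hX y
    have h2 : |1 - z| ≤ 1 := by rw [abs_of_nonneg] <;> linarith
    rw [profile, abs_div, abs_two]
    have := mul_le_mul_of_nonneg_left h2 hX0
    have := abs_nonneg (∫ y in z..1, q y)
    linarith

theorem tendsto_profile_slopeApprox (N : ℕ) (hρ : 0 < ρ) (z : ℝ) :
    Filter.Tendsto (fun k => profile (slopeApprox N ρ σ k) z) Filter.atTop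
      (𝓝 (profile (radialSlope N ρ σ) z)) := by
  refine Filter.Tendsto.div_const ?_ 2
  refine intervalIntegral.tendsto_integral_filter_of_dominated_convergence
    (fun _ => (ρ ^ N)⁻¹) (Filter.Eventually.of_forall fun k => ?_)
    (Filter.Eventually.of_forall fun k => ?_) intervalIntegrable_const ?_
  · exact (continuous_slopeApprox N hρ σ k).aestronglyMeasurable
  · exact Filter.Eventually.of_forall fun y _ => abs_slopeApprox_le N hρ k y
  · exact Filter.Eventually.of_forall fun y _ => tendsto_slopeApprox N ρ σ y

theorem tendsto_innerVar {x : Euc (m + 3)} {p χ : ℕ → ℝ} {p₀ χ₀ : ℝ}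
    (hp : Filter.Tendsto p Filter.atTop (𝓝 p₀)) (hχ : Filter.Tendsto χ Filter.atTop (𝓝 χ₀)) :
    Filter.Tendsto (fun k => innerVar L a s ε u (p k) (χ k) x) Filter.atTop
      (𝓝 (innerVar L a s ε u p₀ χ₀ x)) :=
  (((((hp.mul_const _).mul_const _).sub ((hχ.const_mul _).mul_const _)).sub
    ((hχ.const_mul _).mul_const _)).sub (hp.mul_const _)).add
      (((hχ.abs.const_mul _).mul_const _).mul_const _)

namespace IsSol

theorem integral_innerVar_tail (h : IsSol c L ε a s u) (hρ : 0 < ρ) (hρσ : ρ ≤ σ) (hσ : σ < 1) :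
    IntegrableOn (fun x => innerVar L a s ε u (radialSlope (m + 3) ρ σ (‖x‖ ^ 2))
      (tail (m + 1) ρ σ ‖x‖) x) (ball 0 σ) ∧
    0 ≤ ∫ x in ball 0 σ, innerVar L a s ε u (radialSlope (m + 3) ρ σ (‖x‖ ^ 2))
      (tail (m + 1) ρ σ ‖x‖) x := by
  have hσ0 : 0 < σ := hρ.trans_le hρσ
  have hσ2 : σ ^ 2 < 1 := pow_lt_one₀ hσ0.le hσ two_ne_zero
  have hzero : ∀ k z, σ ^ 2 ≤ z → slopeApprox (m + 3) ρ σ k z = 0 := fun k z =>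
    slopeApprox_eq_zero _ k
  set q := slopeApprox (m + 3) ρ σ with hq
  set X := (ρ ^ (m + 3))⁻¹ with hX
  have hqc : ∀ k, Continuous (q k) := continuous_slopeApprox _ hρ σ
  have hqX : ∀ k z, |q k z| ≤ X := abs_slopeApprox_le _ hρ
  have hpX : ∀ k z, 0 ≤ z → |profile (q k) z| ≤ X := fun k z hz =>
    abs_profile_le hσ2.le (hzero k) (hqX k) hz
  have hlimq := tendsto_slopeApprox (m + 3) ρ σ
  have hlimp := tendsto_profile_slopeApprox (m + 3) (σ := σ) hρ
  have hp : Measurable (radialSlope (m + 3) ρ σ) :=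
    measurable_of_tendsto_metrizable (fun k => (hqc k).measurable) (tendsto_pi_nhds.2 hlimq)
  have hχ : Measurable (profile (radialSlope (m + 3) ρ σ)) :=
    measurable_of_tendsto_metrizable (fun k => (continuous_profile (hqc k)).measurable)
      (tendsto_pi_nhds.2 hlimp)
  have hint := h.integrableOn_innerVar hp hχ
    (fun z _ => le_of_tendsto (hlimq z).abs (Filter.Eventually.of_forall fun k => hqX k z))
    (fun z hz => le_of_tendsto (hlimp z).abs (Filter.Eventually.of_forall fun k => hpX k z hz))
  have hL := h.L_nonneg
  have hlim : Filter.Tendsto (fun k => ∫ x in ball 0 1,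
      innerVar L a s ε u (q k (‖x‖ ^ 2)) (profile (q k) (‖x‖ ^ 2)) x) Filter.atTop
      (𝓝 (∫ x in ball 0 1, innerVar L a s ε u (radialSlope (m + 3) ρ σ (‖x‖ ^ 2))
        (profile (radialSlope (m + 3) ρ σ) (‖x‖ ^ 2)) x)) := by
    refine tendsto_integral_of_dominated_convergence
      (fun x => (m + 6) * (L * (m + 3)) * (X + X) * (gsq u x + potential ε u x))
      (fun k => h.aesm_innerVar (hqc k).measurable (continuous_profile (hqc k)).measurable)
      (h.integrableOn_gsq_add_potential.const_mul _) (fun k => ?_)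
      (Filter.Eventually.of_forall fun x => ?_)
    · filter_upwards [ae_restrict_mem measurableSet_ball] with x hx
      refine (h.abs_innerVar_le hx _ _).trans ?_
      have := add_nonneg (gsq_nonneg u x) (potential_nonneg ε u x)
      gcongr
      · exact hqX k _
      · exact hpX k _ (by positivity)
    · exact tendsto_innerVar (hlimq (‖x‖ ^ 2)) (hlimp (‖x‖ ^ 2))
  have hnn := ge_of_tendsto hlim (Filter.Eventually.of_forall fun k =>
    h.integral_innerVar_nonneg (hqc k) hσ2 (hzero k))
  have hsub : ball (0 : Euc (m + 3)) σ ⊆ ball 0 1 := ball_subset_ball hσ.le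
  have heq : ∀ x ∈ ball (0 : Euc (m + 3)) σ,
      innerVar L a s ε u (radialSlope (m + 3) ρ σ (‖x‖ ^ 2))
        (profile (radialSlope (m + 3) ρ σ) (‖x‖ ^ 2)) x =
      innerVar L a s ε u (radialSlope (m + 3) ρ σ (‖x‖ ^ 2)) (tail (m + 1) ρ σ ‖x‖) x := by
    intro x hx
    rw [profile_radialSlope m hρ hρσ hσ.le (norm_nonneg x) (mem_ball_zero_iff.1 hx).le]
  refine ⟨(hint.mono_set hsub).congr_fun heq measurableSet_ball, ?_⟩
  rw [← setIntegral_congr_fun measurableSet_ball heq]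
  rwa [setIntegral_eq_of_subset_of_forall_sdiff_eq_zero measurableSet_ball hsub] at hnn
  intro x hx
  have hx1 : σ ≤ ‖x‖ := by
    have := hx.2
    rwa [mem_ball_zero_iff, not_lt] at this
  have hz : σ ^ 2 ≤ ‖x‖ ^ 2 := by gcongr
  rw [radialSlope_eq_zero _ hz,
    profile_eq_zero hσ2.le (fun z hz => radialSlope_eq_zero _ hz) hz]
  simp [innerVar]

end IsSol
end LimitingVariation

section Monotonicity

/-- The conormal derivative `∑ a_ij x_i ∂_j u` in the direction of the position vector. -/
def conormal {n : ℕ} (a : Euc n → Matrix (Fin n) (Fin n) ℝ) (u : Euc n → ℂ) (x : Euc n) : ℂ :=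
  ∑ i, ∑ j, (a x i j * x i) • pd u j x

theorem qf_radialPart {n : ℕ} (a : Euc n → Matrix (Fin n) (Fin n) ℝ) (u : Euc n → ℂ) (x : Euc n) :
    qf (a x) (radialPart x (grad u x)) (grad u x) =
      inner ℝ (contract x (grad u x)) (conormal a u x) := by
  simp only [qf, radialPart, conormal, inner_sum]
  refine Finset.sum_congr rfl fun i _ => Finset.sum_congr rfl fun j _ => ?_
  rw [real_inner_smul_left, real_inner_smul_right, grad]
  ring

theorem norm_sum_smul_le {n : ℕ} {M : ℝ} {b : Fin n → Fin n → ℝ} (hb : ∀ i j, |b i j| ≤ M)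
    (u : Euc n → ℂ) (x : Euc n) :
    ‖∑ i, ∑ j, b i j • pd u j x‖ ≤ n ^ 2 * (M * √(gsq u x)) := by
  have h1 : ∀ i j, ‖b i j • pd u j x‖ ≤ M * √(gsq u x) := fun i j => by
    rw [norm_smul]
    exact mul_le_mul (hb i j) (Real.le_sqrt_of_sq_le (norm_pd_sq_le_gsq u x j)) (norm_nonneg _)
      ((abs_nonneg _).trans (hb i j))
  refine (norm_sum_le_of_le _ fun i _ => norm_sum_le_of_le _ fun j _ => h1 i j).trans ?_
  simp [sq, mul_assoc]

theorem abs_apply_le_norm {n : ℕ} (x : Euc n) (i : Fin n) : |x i| ≤ ‖x‖ := by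
  simpa using PiLp.norm_apply_le x i

variable {n : ℕ} {c L ε : ℝ} {a : Euc n → Matrix (Fin n) (Fin n) ℝ} {s : Euc n → ℝ}
  {u : Euc n → ℂ}

namespace IsSol

theorem norm_conormal_sub_contract_le (h : IsSol c L ε a s u) {x : Euc n}
    (hx : x ∈ ball (0 : Euc n) 1) :
    ‖conormal a u x - contract x (grad u x)‖ ≤ n ^ 2 * (L * ‖x‖ ^ 2 * √(gsq u x)) := by
  have e : conormal a u x - contract x (grad u x) =
      ∑ i, ∑ j, ((a x i j - a 0 i j) * x i) • pd u j x := by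
    have e2 : contract x (grad u x) = ∑ i, ∑ j, (a 0 i j * x i) • pd u j x := by
      simp only [h.a_zero, contract, grad]
      refine Finset.sum_congr rfl fun i _ => ?_
      rw [Finset.sum_eq_single i]
      · simp
      · intro j _ hj
        simp [Matrix.one_apply_ne' hj]
      · simp
    rw [e2, conormal, ← Finset.sum_sub_distrib]
    refine Finset.sum_congr rfl fun i _ => ?_
    rw [← Finset.sum_sub_distrib]
    refine Finset.sum_congr rfl fun j _ => ?_
    rw [← sub_smul, sub_mul]
  rw [e]
  refine norm_sum_smul_le (fun i j => ?_) u x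
  have h1 := h.a_lip x hx 0 (mem_ball_self one_pos) i j
  rw [sub_zero] at h1
  rw [abs_mul]
  calc _ ≤ L * ‖x‖ * ‖x‖ := mul_le_mul h1 (abs_apply_le_norm x i) (abs_nonneg _)
        ((abs_nonneg _).trans h1)
    _ = _ := by ring

theorem norm_conormal_le (h : IsSol c L ε a s u) {x : Euc n} (hx : x ∈ ball (0 : Euc n) 1) :
    ‖conormal a u x‖ ≤ n ^ 2 * (L * ‖x‖ * √(gsq u x)) := by
  refine norm_sum_smul_le (fun i j => ?_) u x
  rw [abs_mul]
  exact mul_le_mul (h.a_le x hx i j) (abs_apply_le_norm x i) (abs_nonneg _) h.L_nonneg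

theorem le_qf_radialPart (h : IsSol c L ε a s u) {x : Euc n} (hx : x ∈ ball (0 : Euc n) 1) :
    ‖conormal a u x‖ ^ 2 / s x - (n ^ 4 * L ^ 2 + n ^ 4 * L ^ 3 / c) * ‖x‖ ^ 3 * gsq u x ≤
      qf (a x) (radialPart x (grad u x)) (grad u x) := by
  have hL := h.L_nonneg
  have hc := h.c_pos
  have hs : c ≤ s x := h.le_s x hx
  have hs0 : 0 < s x := hc.trans_le hs
  set y := conormal a u x with hy
  set z := contract x (grad u x) with hz
  set g := √(gsq u x) with hg
  have hg2 : g ^ 2 = gsq u x := Real.sq_sqrt (gsq_nonneg u x)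
  have hg0 : 0 ≤ g := Real.sqrt_nonneg _
  have h1 : ‖y - z‖ ≤ n ^ 2 * (L * ‖x‖ ^ 2 * g) := h.norm_conormal_sub_contract_le hx
  have h2 : ‖y‖ ≤ n ^ 2 * (L * ‖x‖ * g) := h.norm_conormal_le hx
  have h3 : |s x - 1| ≤ L * ‖x‖ := by
    have := h.s_lip x hx 0 (mem_ball_self one_pos)
    rwa [h.s_zero, sub_zero] at this
  have e : inner ℝ z y = ‖y‖ ^ 2 / s x - inner ℝ (y - z) y + ‖y‖ ^ 2 * ((s x - 1) / s x) := by
    rw [inner_sub_left, real_inner_self_eq_norm_sq]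
    field_simp
    ring
  have h4 : inner ℝ (y - z) y ≤ n ^ 4 * L ^ 2 * ‖x‖ ^ 3 * gsq u x := by
    refine (real_inner_le_norm _ _).trans ?_
    calc ‖y - z‖ * ‖y‖ ≤ (n ^ 2 * (L * ‖x‖ ^ 2 * g)) * (n ^ 2 * (L * ‖x‖ * g)) := by gcongr
      _ = n ^ 4 * L ^ 2 * ‖x‖ ^ 3 * g ^ 2 := by ring
      _ = _ := by rw [hg2]
  have h5 : -(‖y‖ ^ 2 * ((s x - 1) / s x)) ≤ n ^ 4 * L ^ 3 / c * ‖x‖ ^ 3 * gsq u x := by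
    calc -(‖y‖ ^ 2 * ((s x - 1) / s x)) ≤ |‖y‖ ^ 2 * ((s x - 1) / s x)| := neg_le_abs _
      _ = ‖y‖ ^ 2 * (|s x - 1| / s x) := by
          rw [abs_mul, abs_div, abs_of_pos hs0, abs_of_nonneg (sq_nonneg _)]
      _ ≤ (n ^ 2 * (L * ‖x‖ * g)) ^ 2 * (L * ‖x‖ / c) := by gcongr
      _ = n ^ 4 * L ^ 3 / c * ‖x‖ ^ 3 * g ^ 2 := by ring
      _ = _ := by rw [hg2]
  rw [qf_radialPart, ← hy, ← hz, e]
  linarith only [h4, h5]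

theorem gsq_add_potential_le (h : IsSol c L ε a s u) {x : Euc n} (hx : x ∈ ball (0 : Euc n) 1) :
    gsq u x + potential ε u x ≤ 2 / c * dens a s ε u x := by
  have hc := h.c_pos
  have h1 : c * gsq u x ≤ qf (a x) (grad u x) (grad u x) := le_qf_self (h.elliptic x hx) _
  have h2 := mul_le_mul_of_nonneg_right (h.le_s x hx) (potential_nonneg ε u x)
  have h3 := mul_nonneg hc.le (potential_nonneg ε u x)
  rw [div_mul_eq_mul_div, le_div_iff₀ hc, dens]
  linarith

end IsSol

end Monotonicity

section Monotonicity3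
variable {m : ℕ} {c L ε : ℝ} {a : Euc (m + 3) → Matrix (Fin (m + 3)) (Fin (m + 3)) ℝ}
  {s : Euc (m + 3) → ℝ} {u : Euc (m + 3) → ℂ} {ρ σ : ℝ}

namespace IsSol

theorem dens_nonneg (h : IsSol c L ε a s u) {x : Euc (m + 3)} (hx : x ∈ ball (0 : Euc (m + 3)) 1) :
    0 ≤ dens a s ε u x := by
  have h1 := h.gsq_add_potential_le hx
  have h2 := add_nonneg (gsq_nonneg u x) (potential_nonneg ε u x)
  have := h.c_pos
  exact nonneg_of_mul_nonneg_right (h2.trans h1) (by positivity)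

theorem innerVar_tail_le (h : IsSol c L ε a s u) (hρ : 0 < ρ) (hρσ : ρ ≤ σ) (hσ : σ < 1) {A B : ℝ}
    (hA : A = (((m + 3 : ℕ) : ℝ) ^ 4 * L ^ 2 + ((m + 3 : ℕ) : ℝ) ^ 4 * L ^ 3 / c) * (2 / c))
    (hB : B = A * m + 2 * L * (m + 3) / c) {x : Euc (m + 3)} (hx : x ∈ ball (0 : Euc (m + 3)) σ) :
    innerVar L a s ε u (radialSlope (m + 3) ρ σ (‖x‖ ^ 2)) (tail (m + 1) ρ σ ‖x‖) x ≤
      ((σ ^ (m + 1))⁻¹ + A * (σ ^ m)⁻¹) * dens a s ε u x -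
      ((ρ ^ (m + 1))⁻¹ + A * (ρ ^ m)⁻¹) * (ball 0 ρ).indicator (dens a s ε u) x +
      B * (tail m ρ σ ‖x‖ * dens a s ε u x) -
      tail (m + 1) ρ σ ‖x‖ * (2 * (s x * potential ε u x)) -
      (ball 0 ρ)ᶜ.indicator (fun x => (‖x‖ ^ (m + 3))⁻¹ * (‖conormal a u x‖ ^ 2 / s x)) x := by
  have hx1 : x ∈ ball (0 : Euc (m + 3)) 1 := ball_subset_ball hσ.le hx
  rw [mem_ball_zero_iff] at hx
  have hL := h.L_nonneg
  have hc := h.c_pos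
  have hd := h.dens_nonneg hx1
  have hS := h.gsq_add_potential_le hx1
  have hP := h.le_qf_radialPart hx1
  have hG := gsq_nonneg u x
  have hW := potential_nonneg ε u x
  have t1 := mul_tail (m + 1) hρ hρσ hx.le
  have t0 := mul_tail m hρ hρσ hx.le
  have t10 := tail_succ_mul_le m hρ hρσ hx.le
  have t1n := tail_nonneg (m + 1) hρ hρσ hx.le
  set r := ‖x‖ with hr
  set T1 := tail (m + 1) ρ σ r
  set T0 := tail m ρ σ r
  set d := dens a s ε u x with hdd
  set C₁ := ((m + 3 : ℕ) : ℝ) ^ 4 * L ^ 2 + ((m + 3 : ℕ) : ℝ) ^ 4 * L ^ 3 / c with hC₁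
  have hC₁0 : 0 ≤ C₁ := by positivity
  have hr0 : 0 ≤ r := norm_nonneg x
  have e5 : L * (m + 3) * |T1| * r * (gsq u x + potential ε u x) ≤
      2 * L * (m + 3) / c * (T0 * d) := by
    rw [abs_of_nonneg t1n]
    calc L * (m + 3) * T1 * r * (gsq u x + potential ε u x)
        = L * (m + 3) * (T1 * r) * (gsq u x + potential ε u x) := by ring
      _ ≤ L * (m + 3) * T0 * (2 / c * d) := by
          have : 0 ≤ T1 * r := mul_nonneg t1n hr0
          gcongr
          exact mul_nonneg (by positivity) (this.trans t10)
      _ = _ := by ring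
  have hGd : gsq u x ≤ 2 / c * d := by linarith
  unfold innerVar
  rw [← hdd, ← hr]
  push_cast at t1
  by_cases hrρ : r < ρ
  · have hmem : x ∈ ball (0 : Euc (m + 3)) ρ := by rwa [mem_ball_zero_iff]
    have hp : radialSlope (m + 3) ρ σ (r ^ 2) = 0 :=
      Set.indicator_of_notMem (fun hz => absurd hz.1 (not_le.2 (by gcongr))) _
    rw [hp, Set.indicator_of_mem hmem, Set.indicator_of_notMem (by simpa using hmem), ← hdd]
    rw [max_eq_right hrρ.le] at t1 t0
    have e1 : (m + 1) * T1 * d = ((ρ ^ (m + 1))⁻¹ - (σ ^ (m + 1))⁻¹) * d := by rw [← t1]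
    have e2 : A * (m * T0 * d) = A * (((ρ ^ m)⁻¹ - (σ ^ m)⁻¹) * d) := by rw [← t0]
    rw [hB]
    linarith only [e1, e2, e5]
  · rw [not_lt] at hrρ
    have hr0' : 0 < r := hρ.trans_le hrρ
    have hmem : x ∉ ball (0 : Euc (m + 3)) ρ := by rwa [mem_ball_zero_iff, not_lt]
    have hp : radialSlope (m + 3) ρ σ (r ^ 2) = (r ^ (m + 3))⁻¹ := by
      have hz : r ^ 2 ∈ Set.Ico (ρ ^ 2) (σ ^ 2) := ⟨by gcongr, by gcongr⟩
      rw [radialSlope, Set.indicator_of_mem hz, Real.sqrt_sq hr0]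
    rw [hp, Set.indicator_of_notMem hmem, Set.indicator_of_mem (by simpa using hmem)]
    rw [max_eq_left hrρ] at t1 t0
    have e0 : (r ^ (m + 3))⁻¹ * r ^ 2 = (r ^ (m + 1))⁻¹ := by
      field_simp
      ring
    have e3 : (r ^ (m + 3))⁻¹ * r ^ 3 = (r ^ m)⁻¹ := by
      field_simp
      ring
    have e1 : (m + 1) * T1 * d = ((r ^ (m + 1))⁻¹ - (σ ^ (m + 1))⁻¹) * d := by rw [← t1]
    have e2 : A * (m * T0 * d) = A * (((r ^ m)⁻¹ - (σ ^ m)⁻¹) * d) := by rw [← t0]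
    have e4 : (r ^ (m + 3))⁻¹ * (‖conormal a u x‖ ^ 2 / s x) - A * (r ^ m)⁻¹ * d ≤
        (r ^ (m + 3))⁻¹ * qf (a x) (radialPart x (grad u x)) (grad u x) := by
      refine le_trans ?_ (mul_le_mul_of_nonneg_left hP (by positivity))
      have : C₁ * (r ^ m)⁻¹ * gsq u x ≤ C₁ * (r ^ m)⁻¹ * (2 / c * d) := by gcongr
      have e6 : ∀ Q : ℝ, (r ^ (m + 3))⁻¹ * (Q - C₁ * r ^ 3 * gsq u x) =
          (r ^ (m + 3))⁻¹ * Q - C₁ * (r ^ m)⁻¹ * gsq u x := fun Q => by rw [← e3]; ring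
      rw [e6, hA]
      linarith only [this]
    rw [e0, hB]
    linarith only [e1, e2, e4, e5]

theorem integrableOn_conormal (h : IsSol c L ε a s u) :
    IntegrableOn (fun x => ‖conormal a u x‖ ^ 2 / s x) (ball 0 1) := by
  have hc := h.c_pos
  have hm : AEStronglyMeasurable (conormal a u) (volume.restrict (ball 0 1)) := by
    unfold conormal
    exact Finset.aestronglyMeasurable_fun_sum _ fun i _ =>
      Finset.aestronglyMeasurable_fun_sum _ fun j _ => ((h.aesm_a i j).mul
        (by fun_prop : Continuous fun x : Euc (m + 3) => x i).aestronglyMeasurable).smul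
          (measurable_pd u j).aestronglyMeasurable
  refine (h.integrable_gsq.const_mul ((((m + 3 : ℕ) : ℝ) ^ 2 * L) ^ 2 / c)).mono'
    ((hm.norm.pow 2).aemeasurable.div h.aesm_s.aemeasurable).aestronglyMeasurable ?_
  filter_upwards [ae_restrict_mem measurableSet_ball] with x hx
  have h1 := h.norm_conormal_le hx
  have h2 := h.le_s x hx
  have hx1 : ‖x‖ ≤ 1 := (mem_ball_zero_iff.1 hx).le
  have hL := h.L_nonneg
  rw [Real.norm_eq_abs, abs_of_nonneg (div_nonneg (sq_nonneg _) (h.s_nonneg hx))]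
  calc _ ≤ (((m + 3 : ℕ) : ℝ) ^ 2 * (L * 1 * √(gsq u x))) ^ 2 / c := by
        gcongr
        exact h1.trans (by gcongr)
    _ = (((m + 3 : ℕ) : ℝ) ^ 2 * L) ^ 2 / c * √(gsq u x) ^ 2 := by ring
    _ = _ := by rw [Real.sq_sqrt (gsq_nonneg u x)]

end IsSol
end Monotonicity3

section MonotonicityFormula
variable {m : ℕ} {c L ε : ℝ} {a : Euc (m + 3) → Matrix (Fin (m + 3)) (Fin (m + 3)) ℝ}
  {s : Euc (m + 3) → ℝ} {u : Euc (m + 3) → ℂ} {ρ σ : ℝ}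

/-- The potential contribution to the monotonicity formula on `[ρ, σ]`. -/
def potentialGain (m : ℕ) (s : Euc (m + 3) → ℝ) (ε : ℝ) (u : Euc (m + 3) → ℂ) (ρ σ : ℝ) : ℝ :=
  ∫ τ in ρ..σ, (τ ^ (m + 2))⁻¹ * ∫ x in ball 0 τ, 2 * (s x * potential ε u x)

/-- The radial derivative contribution to the monotonicity formula on `[ρ, σ]`. -/
def radialGain (m : ℕ) (a : Euc (m + 3) → Matrix (Fin (m + 3)) (Fin (m + 3)) ℝ)
    (s : Euc (m + 3) → ℝ) (u : Euc (m + 3) → ℂ) (ρ σ : ℝ) : ℝ :=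
  ∫ x in ball 0 σ \ ball 0 ρ, (‖x‖ ^ (m + 3))⁻¹ * (‖conormal a u x‖ ^ 2 / s x)

namespace IsSol

theorem monotonicity (h : IsSol c L ε a s u) (hρ : 0 < ρ) (hρσ : ρ ≤ σ) (hσ : σ < 1) {A B : ℝ}
    (hA : A = (((m + 3 : ℕ) : ℝ) ^ 4 * L ^ 2 + ((m + 3 : ℕ) : ℝ) ^ 4 * L ^ 3 / c) * (2 / c))
    (hB : B = A * m + 2 * L * (m + 3) / c) :
    ((ρ ^ (m + 1))⁻¹ + A * (ρ ^ m)⁻¹) * (∫ x in ball 0 ρ, dens a s ε u x) +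
      potentialGain m s ε u ρ σ + radialGain m a s u ρ σ ≤
    ((σ ^ (m + 1))⁻¹ + A * (σ ^ m)⁻¹) * (∫ x in ball 0 σ, dens a s ε u x) +
      B * ∫ τ in ρ..σ, (τ ^ (m + 1))⁻¹ * ∫ x in ball 0 τ, dens a s ε u x := by
  obtain ⟨hi, hnn⟩ := h.integral_innerVar_tail hρ hρσ hσ
  have hsub : ball (0 : Euc (m + 3)) σ ⊆ ball 0 1 := ball_subset_ball hσ.le
  have hsub' : ball (0 : Euc (m + 3)) ρ ⊆ ball 0 σ := ball_subset_ball hρσ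
  have hdens := (h.integrableOn_dens h.aesm_u h.norm_le h.integrable_gsq).mono_set hsub
  have hpot : IntegrableOn (fun x => 2 * (s x * potential ε u x)) (ball 0 σ) :=
    ((h.integrableOn_s_mul (h.integrableOn_potential h.aesm_u h.norm_le)).mono_set hsub).const_mul 2
  obtain ⟨i0, f0⟩ := setIntegral_tail_mul m hρ hρσ hdens
  obtain ⟨i1, f1⟩ := setIntegral_tail_mul (m + 1) hρ hρσ hpot
  have hcon := h.integrableOn_conormal.mono_set hsub
  have hrad : IntegrableOn ((ball 0 ρ)ᶜ.indicator
      (fun x => (‖x‖ ^ (m + 3))⁻¹ * (‖conormal a u x‖ ^ 2 / s x))) (ball 0 σ) := by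
    refine (hcon.norm.const_mul ((ρ ^ (m + 3))⁻¹)).mono' (AEStronglyMeasurable.indicator
      (AEStronglyMeasurable.mul ?_ hcon.1) measurableSet_ball.compl) ?_
    · exact (measurable_norm.pow_const _).inv.aestronglyMeasurable
    · filter_upwards with x
      by_cases hx : x ∈ ball (0 : Euc (m + 3)) ρ
      · rw [Set.indicator_of_notMem (by simpa using hx), norm_zero]
        positivity
      · rw [Set.indicator_of_mem (by simpa using hx), norm_mul, norm_inv, norm_pow, norm_norm]
        rw [mem_ball_zero_iff, not_lt] at hx
        gcongr
  have hind : IntegrableOn ((ball 0 ρ).indicator (dens a s ε u)) (ball 0 σ) :=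
    IntegrableOn.indicator hdens measurableSet_ball
  have j1 := hdens.const_mul ((σ ^ (m + 1))⁻¹ + A * (σ ^ m)⁻¹)
  have j2 := hind.const_mul ((ρ ^ (m + 1))⁻¹ + A * (ρ ^ m)⁻¹)
  have j3 := i0.const_mul B
  have key := hnn.trans (setIntegral_mono_on hi ((((j1.sub j2).add j3).sub i1).sub hrad)
    measurableSet_ball fun x hx => h.innerVar_tail_le hρ hρσ hσ hA hB hx)
  have k1 := integral_sub (((j1.sub j2).add j3).sub i1) hrad
  have k2 := integral_sub ((j1.sub j2).add j3) i1
  have k3 := integral_add (j1.sub j2) j3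
  have k4 := integral_sub j1 j2
  rw [integral_const_mul, integral_const_mul, setIntegral_indicator measurableSet_ball,
    Set.inter_eq_self_of_subset_right hsub'] at k4
  rw [integral_const_mul, f0] at k3
  rw [f1] at k2
  rw [setIntegral_indicator measurableSet_ball.compl, ← Set.sdiff_eq] at k1
  simp only [Pi.add_apply, Pi.sub_apply] at key k1 k2 k3
  rw [k1, k2, k3, k4] at key
  rw [potentialGain, radialGain]
  linarith only [key]

end IsSol
end MonotonicityFormula

section GoodRadius

/-- An almost monotonicity formula with error constants `A` and `B`, for an energy `E`, a
potential energy `P` and a radial derivative term `R`. -/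
structure AlmostMonotone (k : ℕ) (A B : ℝ) (E P : ℝ → ℝ) (R : ℝ → ℝ → ℝ) : Prop where
  A_nonneg : 0 ≤ A
  B_nonneg : 0 ≤ B
  mono_E : MonotoneOn E (Set.Ioo 0 1)
  mono_P : MonotoneOn P (Set.Ioo 0 1)
  E_nonneg : ∀ r ∈ Set.Ioo (0 : ℝ) 1, 0 ≤ E r
  P_nonneg : ∀ r ∈ Set.Ioo (0 : ℝ) 1, 0 ≤ P r
  R_nonneg : ∀ ρ σ, 0 < ρ → ρ ≤ σ → σ < 1 → 0 ≤ R ρ σ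
  le : ∀ ρ σ, 0 < ρ → ρ ≤ σ → σ < 1 →
    ((ρ ^ (k + 1))⁻¹ + A * (ρ ^ k)⁻¹) * E ρ + (∫ τ in ρ..σ, (τ ^ (k + 2))⁻¹ * P τ) + R ρ σ ≤
    ((σ ^ (k + 1))⁻¹ + A * (σ ^ k)⁻¹) * E σ + B * ∫ τ in ρ..σ, (τ ^ (k + 1))⁻¹ * E τ

variable {k : ℕ} {A B : ℝ} {E P : ℝ → ℝ} {R : ℝ → ℝ → ℝ}

/-- The increment over `[ρ, σ]` of the almost monotone quantity. -/
def increment (k : ℕ) (A B : ℝ) (E : ℝ → ℝ) (ρ σ : ℝ) : ℝ :=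
  ((σ ^ (k + 1))⁻¹ + A * (σ ^ k)⁻¹) * E σ - ((ρ ^ (k + 1))⁻¹ + A * (ρ ^ k)⁻¹) * E ρ +
    B * ∫ τ in ρ..σ, (τ ^ (k + 1))⁻¹ * E τ

theorem intervalIntegrable_inv_pow_mul {F : ℝ → ℝ} (hF : MonotoneOn F (Set.Ioo 0 1)) (N : ℕ)
    {ρ σ : ℝ} (hρ : 0 < ρ) (hρσ : ρ ≤ σ) (hσ : σ < 1) :
    IntervalIntegrable (fun τ => (τ ^ N)⁻¹ * F τ) volume ρ σ := by
  have hsub : Set.uIcc ρ σ ⊆ Set.Ioo 0 1 := by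
    rw [Set.uIcc_of_le hρσ]
    exact fun τ hτ => ⟨hρ.trans_le hτ.1, hτ.2.trans_lt hσ⟩
  refine (hF.mono hsub).intervalIntegrable.continuousOn_mul
    (ContinuousOn.inv₀ (by fun_prop) fun τ hτ => ?_)
  exact (pow_pos (hsub hτ).1 _).ne'

namespace AlmostMonotone

variable {ρ σ : ℝ}

theorem le_increment (h : AlmostMonotone k A B E P R) (hρ : 0 < ρ) (hρσ : ρ ≤ σ) (hσ : σ < 1) :
    (∫ τ in ρ..σ, (τ ^ (k + 2))⁻¹ * P τ) + R ρ σ ≤ increment k A B E ρ σ := by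
  have := h.le ρ σ hρ hρσ hσ
  unfold increment
  linarith

theorem integral_P_nonneg (h : AlmostMonotone k A B E P R) (hρ : 0 < ρ) (hρσ : ρ ≤ σ)
    (hσ : σ < 1) : 0 ≤ ∫ τ in ρ..σ, (τ ^ (k + 2))⁻¹ * P τ :=
  intervalIntegral.integral_nonneg hρσ fun τ hτ => by
    have h0 : 0 < τ := hρ.trans_le hτ.1
    exact mul_nonneg (by positivity) (h.P_nonneg τ ⟨h0, hτ.2.trans_lt hσ⟩)

theorem increment_nonneg (h : AlmostMonotone k A B E P R) (hρ : 0 < ρ) (hρσ : ρ ≤ σ)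
    (hσ : σ < 1) : 0 ≤ increment k A B E ρ σ :=
  (add_nonneg (h.integral_P_nonneg hρ hρσ hσ) (h.R_nonneg ρ σ hρ hρσ hσ)).trans
    (h.le_increment hρ hρσ hσ)

theorem increment_add (h : AlmostMonotone k A B E P R) {a b c : ℝ} (ha : 0 < a) (hab : a ≤ b)
    (hbc : b ≤ c) (hc : c < 1) :
    increment k A B E a b + increment k A B E b c = increment k A B E a c := by
  have := intervalIntegral.integral_add_adjacent_intervals
    (intervalIntegrable_inv_pow_mul h.mono_E (k + 1) ha hab (hbc.trans_lt hc))
    (intervalIntegrable_inv_pow_mul h.mono_E (k + 1) (ha.trans_le hab) hbc hc)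
  unfold increment
  rw [← this]
  ring

theorem scaled_le (h : AlmostMonotone k A B E P R) (hρ : 0 < ρ) (hρ1 : ρ < 1) :
    (ρ ^ (k + 1))⁻¹ * E ρ ≤ ((ρ ^ (k + 1))⁻¹ + A * (ρ ^ k)⁻¹) * E ρ := by
  have := h.A_nonneg
  exact mul_le_mul_of_nonneg_right (le_add_of_nonneg_right (by positivity)) (h.E_nonneg ρ ⟨hρ, hρ1⟩)

theorem scaled_le_of_le (h : AlmostMonotone k A B E P R) (hρ : 0 < ρ) (hρσ : ρ ≤ σ) (hσ : σ < 1)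
    (hB : B * σ ≤ 1 / 2) :
    (ρ ^ (k + 1))⁻¹ * E ρ ≤ 2 * (((σ ^ (k + 1))⁻¹ + A * (σ ^ k)⁻¹) * E σ) := by
  have hσ0 : 0 < σ := hρ.trans_le hρσ
  set f : ℝ → ℝ := fun τ => (τ ^ (k + 1))⁻¹ * E τ with hf
  set g := ((σ ^ (k + 1))⁻¹ + A * (σ ^ k)⁻¹) * E σ with hg
  set S := sSup (f '' Set.Icc ρ σ) with hS
  have hbdd : BddAbove (f '' Set.Icc ρ σ) := by
    refine ⟨(ρ ^ (k + 1))⁻¹ * E σ, ?_⟩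
    rintro _ ⟨τ, hτ, rfl⟩
    have hτ0 : 0 < τ := hρ.trans_le hτ.1
    have h1 : E τ ≤ E σ := h.mono_E ⟨hτ0, hτ.2.trans_lt hσ⟩ ⟨hσ0, hσ⟩ hτ.2
    have h2 := h.E_nonneg τ ⟨hτ0, hτ.2.trans_lt hσ⟩
    have h3 := hτ.1
    simp only [hf]
    gcongr
  have hfS : ∀ τ ∈ Set.Icc ρ σ, f τ ≤ S := fun τ hτ => le_csSup hbdd ⟨τ, hτ, rfl⟩
  have hS0 : 0 ≤ S := (mul_nonneg (by positivity) (h.E_nonneg ρ ⟨hρ, hρσ.trans_lt hσ⟩)).trans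
    (hfS ρ ⟨le_rfl, hρσ⟩)
  have key : S ≤ g + 1 / 2 * S := by
    refine csSup_le ⟨_, ρ, ⟨le_rfl, hρσ⟩, rfl⟩ ?_
    rintro _ ⟨τ, hτ, rfl⟩
    have hτ0 : 0 < τ := hρ.trans_le hτ.1
    have h1 := h.scaled_le hτ0 (hτ.2.trans_lt hσ)
    have h2 := h.increment_nonneg hτ0 hτ.2 hσ
    have h3 : ∫ t in τ..σ, f t ≤ σ * S := by
      have := intervalIntegral.integral_mono_on hτ.2
        (intervalIntegrable_inv_pow_mul h.mono_E (k + 1) hτ0 hτ.2 hσ)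
        (intervalIntegrable_const (c := S)) fun t ht => hfS t ⟨hτ.1.trans ht.1, ht.2⟩
      rw [intervalIntegral.integral_const, smul_eq_mul] at this
      refine this.trans (mul_le_mul_of_nonneg_right (by linarith) hS0)
    have h4 := mul_le_mul_of_nonneg_left h3 h.B_nonneg
    have h5 := mul_le_mul_of_nonneg_right hB hS0
    unfold increment at h2
    simp only [hf] at h4 ⊢
    linarith only [h1, h2, h4, h5]
  have := hfS ρ ⟨le_rfl, hρσ⟩
  simp only [hf] at this
  linarith

theorem increment_le (h : AlmostMonotone k A B E P R) (hρ : 0 < ρ) (hρσ : ρ ≤ σ) (hσ : σ < 1)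
    (hB : B * σ ≤ 1 / 2) :
    increment k A B E ρ σ ≤ 2 * (((σ ^ (k + 1))⁻¹ + A * (σ ^ k)⁻¹) * E σ) := by
  have hσ0 : 0 < σ := hρ.trans_le hρσ
  set g := ((σ ^ (k + 1))⁻¹ + A * (σ ^ k)⁻¹) * E σ with hg
  have hA := h.A_nonneg
  have hg0 : 0 ≤ g := mul_nonneg (by positivity) (h.E_nonneg σ ⟨hσ0, hσ⟩)
  have h1 := intervalIntegral.integral_mono_on hρσ
    (intervalIntegrable_inv_pow_mul h.mono_E (k + 1) hρ hρσ hσ)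
    (intervalIntegrable_const (c := 2 * g)) fun t ht =>
      h.scaled_le_of_le (hρ.trans_le ht.1) ht.2 hσ hB
  rw [intervalIntegral.integral_const, smul_eq_mul] at h1
  have h2 := mul_le_mul_of_nonneg_left h1 h.B_nonneg
  have h3 : B * ((σ - ρ) * (2 * g)) ≤ g := by
    have h4 : B * (σ - ρ) ≤ 1 / 2 := by
      have := mul_nonneg h.B_nonneg hρ.le
      linarith
    have := mul_le_mul_of_nonneg_right h4 (by linarith : 0 ≤ 2 * g)
    linarith
  have h5 : 0 ≤ ((ρ ^ (k + 1))⁻¹ + A * (ρ ^ k)⁻¹) * E ρ :=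
    mul_nonneg (by positivity) (h.E_nonneg ρ ⟨hρ, hρσ.trans_lt hσ⟩)
  unfold increment
  rw [← hg]
  linarith only [h2, h3, h5]

/-- Among the overlapping annuli `[θ δʲ⁺¹, 2 θ δʲ]`, one carries a small increment. -/
theorem exists_small_increment (h : AlmostMonotone k A B E P R) (hσ : σ < 1)
    (hB : B * σ ≤ 1 / 2) {θ δ : ℝ} (hθ : 0 < θ) (hθ1 : θ ≤ 1) (hδ : 0 < δ) (hδ1 : 2 * δ ≤ 1)
    (hδσ : 2 * δ ≤ σ) (N : ℕ) :
    ∃ j ∈ Finset.range (N + 1), (N + 1) * increment k A B E (θ * δ ^ (j + 2)) (2 * (θ * δ ^ (j + 1)))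
      ≤ 4 * (((σ ^ (k + 1))⁻¹ + A * (σ ^ k)⁻¹) * E σ) := by
  set g := ((σ ^ (k + 1))⁻¹ + A * (σ ^ k)⁻¹) * E σ with hg
  set r : ℕ → ℝ := fun j => θ * δ ^ (j + 1) with hr
  have hr0 : ∀ j, 0 < r j := fun j => by simp only [hr]; positivity
  have hr2 : ∀ j, 2 * r (j + 1) ≤ r j := fun j => by
    have e : r (j + 1) = δ * r j := by simp only [hr]; ring
    rw [e]
    nlinarith [hr0 j]
  have hrσ : ∀ j, 2 * r j ≤ σ := fun j => by
    have h1 : δ ^ (j + 1) ≤ δ := pow_le_of_le_one hδ.le (by linarith) (by simp)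
    have h2 : θ * δ ^ (j + 1) ≤ 1 * δ := by gcongr
    simp only [hr]
    linarith
  -- adding the overlap of two consecutive annuli covers `[r (j + 1), 2 r 0]` at most twice
  have hsum : ∀ N, ∑ j ∈ Finset.range (N + 1), increment k A B E (r (j + 1)) (2 * r j) +
      increment k A B E (r (N + 1)) (r N) ≤
        2 * increment k A B E (r (N + 1)) (2 * r 0) := by
    intro N
    induction N with
    | zero =>
      simp only [zero_add, Finset.range_one, Finset.sum_singleton]
      have h1 := h.increment_add (hr0 1) (by linarith [hr2 0, hr0 1] : r 1 ≤ r 0)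
        (by linarith [hr0 0] : r 0 ≤ 2 * r 0) ((hrσ 0).trans_lt hσ)
      have h2 := h.increment_nonneg (hr0 0) (by linarith [hr0 0] : r 0 ≤ 2 * r 0)
        ((hrσ 0).trans_lt hσ)
      linarith
    | succ N ih =>
      rw [Finset.sum_range_succ]
      have hle : ∀ j, r j ≤ 2 * r 0 := fun j => by
        have : r j ≤ r 0 := antitone_nat_of_succ_le (f := r)
          (fun j => by linarith [hr2 j, hr0 (j + 1)]) (Nat.zero_le j)
        linarith [hr0 0]
      have s0 := hr0 (N + 1)
      have s1 := hr0 (N + 1 + 1)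
      have s2 := hr2 (N + 1)
      have s3 := hr2 N
      have s4 := (hrσ 0).trans_lt hσ
      have s5 := hle N
      have s6 := hle (N + 1)
      have h1 := h.increment_add s1 (by linarith) s6 s4
      have h2 := h.increment_add s1 (by linarith : r (N + 1 + 1) ≤ r (N + 1))
        (by linarith : r (N + 1) ≤ 2 * r (N + 1)) (by linarith)
      have h3 := h.increment_add s0 (by linarith : r (N + 1) ≤ 2 * r (N + 1)) s3 (by linarith)
      have h4 := h.increment_nonneg (by linarith : 0 < 2 * r (N + 1)) s3 (by linarith)
      linarith
  have h1 := hsum N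
  have h2 := h.increment_nonneg (hr0 (N + 1)) (by linarith [hr2 N, hr0 (N + 1)] : r (N + 1) ≤ r N)
    (by linarith [hrσ N, hr0 N])
  have hle : r (N + 1) ≤ 2 * r 0 := by
    have : r (N + 1) ≤ r 0 := antitone_nat_of_succ_le (f := r)
      (fun j => by linarith [hr2 j, hr0 (j + 1)]) (Nat.zero_le _)
    linarith [hr0 0]
  have h3 := h.increment_add (hr0 (N + 1)) hle (hrσ 0) hσ
  have h4 := h.increment_nonneg (by linarith [hr0 0] : 0 < 2 * r 0) (hrσ 0) hσ
  have h5 := h.increment_le (hr0 (N + 1)) (hle.trans (hrσ 0)) hσ hB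
  rw [← hg] at h5
  have htot : ∑ j ∈ Finset.range (N + 1), increment k A B E (r (j + 1)) (2 * r j) ≤
      ∑ _j ∈ Finset.range (N + 1), 4 * g / (N + 1) := by
    rw [Finset.sum_const, Finset.card_range, nsmul_eq_mul]
    push_cast
    rw [mul_div_cancel₀ _ (by positivity)]
    linarith
  obtain ⟨j, hj, hjle⟩ := Finset.exists_le_of_sum_le (by simp) htot
  refine ⟨j, hj, ?_⟩
  rw [le_div_iff₀ (by positivity)] at hjle
  rw [mul_comm]
  exact hjle

end AlmostMonotone

/-- The number of scales `δʲ` above `√ε` is comparable to `log ε / log δ`. -/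
theorem exists_scale_count {ε δ : ℝ} (hε : 0 < ε) (hδ : 0 < δ) (hδ1 : δ < 1) (hεδ : ε < δ ^ 2) :
    ∃ N : ℕ, √ε < δ ^ (N + 1) ∧ -Real.log ε ≤ 4 * (N + 1) * (-Real.log δ) := by
  have hs : 0 < √ε := Real.sqrt_pos.2 hε
  have hex : ∃ M : ℕ, δ ^ M ≤ √ε := by
    obtain ⟨M, hM⟩ := exists_pow_lt_of_lt_one hs hδ1
    exact ⟨M, hM.le⟩
  classical
  have hsδ : √ε < δ := (Real.sqrt_lt' hδ).2 hεδ
  obtain ⟨N, hN⟩ : ∃ N, Nat.find hex = N + 2 := by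
    have h0 : Nat.find hex ≠ 0 := fun h => by
      have := Nat.find_spec hex
      rw [h, pow_zero] at this
      linarith
    have h1 : Nat.find hex ≠ 1 := fun h => by
      have := Nat.find_spec hex
      rw [h, pow_one] at this
      linarith
    exact ⟨Nat.find hex - 2, by omega⟩
  refine ⟨N, not_le.1 (Nat.find_min hex (by omega)), ?_⟩
  have h1 : δ ^ (N + 2) ≤ √ε := hN ▸ Nat.find_spec hex
  have h2 := Real.log_le_log (by positivity) h1
  rw [Real.log_pow, Real.log_sqrt hε.le] at h2
  push_cast at h2
  have h3 : Real.log δ < 0 := Real.log_neg hδ hδ1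
  have h4 : 0 ≤ (N : ℝ) * (-Real.log δ) := mul_nonneg N.cast_nonneg (by linarith)
  linarith

theorem exists_good_radius (k : ℕ) {A B : ℝ} (hA : 0 ≤ A) (hB : 0 ≤ B) :
    ∃ ρ₀ K : ℝ, 0 < ρ₀ ∧ ρ₀ < 1 ∧ 0 < K ∧ ∀ (E P : ℝ → ℝ) (R : ℝ → ℝ → ℝ),
      AlmostMonotone k A B E P R → ∀ ε η : ℝ, 0 < ε → 0 < η →
      (∀ r ∈ Set.Ioo (0 : ℝ) 1, E r ≤ η * (-Real.log ε)) →
      ∀ δ : ℝ, 0 < δ → δ < min (1 / 4) ρ₀ → ε < δ ^ 2 →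
        ∃ r₀ : ℝ, √ε < r₀ ∧ r₀ < δ ∧
          (r₀ ^ (k + 1))⁻¹ * P r₀ ≤ K * η * (-Real.log δ) ∧
          (∫ τ in (δ * r₀)..r₀, (τ ^ (k + 2))⁻¹ * P τ) + R (δ * r₀) r₀ ≤
            K * η * (-Real.log δ) ∧
          (r₀ ^ (k + 1))⁻¹ * E r₀ ≤ K * ((δ * r₀) ^ (k + 1))⁻¹ * E (δ * r₀) +
            K * η * (-Real.log δ) := by
  set σ : ℝ := 1 / (2 * (1 + B)) with hσ
  have hσ0 : 0 < σ := by positivity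
  have hσ1 : σ < 1 := by
    rw [hσ, div_lt_one (by positivity)]
    linarith
  have hBσ : B * σ ≤ 1 / 2 := by
    rw [hσ, mul_one_div, div_le_div_iff₀ (by positivity) (by positivity)]
    linarith
  set D : ℝ := (σ ^ (k + 1))⁻¹ + A * (σ ^ k)⁻¹ with hD
  have hD0 : 0 < D := by positivity
  refine ⟨σ / 2, 2 ^ (k + 2) * (16 * D) + (1 + A), by positivity, by linarith, by positivity, ?_⟩
  intro E P R h ε η hε hη hE δ hδ hδlt hεδ
  set K := 2 ^ (k + 2) * (16 * D) + (1 + A) with hK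
  have hδ4 : δ < 1 / 4 := hδlt.trans_le (min_le_left _ _)
  have hδσ : δ < σ / 2 := hδlt.trans_le (min_le_right _ _)
  have hlog : 0 < -Real.log δ := by
    have := Real.log_neg hδ (by linarith)
    linarith
  obtain ⟨N, hN, hNlog⟩ := exists_scale_count hε hδ (by linarith) hεδ
  have hδN : 0 < δ ^ (N + 1) := by positivity
  obtain ⟨θ, hθ0, hθ1⟩ := exists_between ((div_lt_one hδN).2 hN)
  have hθ : 0 < θ := (div_nonneg (Real.sqrt_nonneg _) hδN.le).trans_lt hθ0
  rw [div_lt_iff₀ hδN] at hθ0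
  obtain ⟨j, hj, hjle⟩ := h.exists_small_increment hσ1 hBσ hθ hθ1.le hδ (by linarith)
    (by linarith) N
  rw [← hD] at hjle
  have hjN : j ≤ N := by simpa [Nat.lt_succ_iff] using hj
  set r := θ * δ ^ (j + 1) with hr
  have hδr : θ * δ ^ (j + 2) = δ * r := by rw [hr]; ring
  rw [hδr] at hjle
  have hr0 : 0 < r := by positivity
  have hrδ : r < δ := by
    have h1 : δ ^ (j + 1) ≤ δ := pow_le_of_le_one hδ.le (by linarith) (by simp)
    calc r ≤ θ * δ := by rw [hr]; gcongr
      _ < δ := mul_lt_of_lt_one_left hδ hθ1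
  have hδr0 : 0 < δ * r := by positivity
  have hδrr : δ * r ≤ r := mul_le_of_le_one_left hr0.le (by linarith)
  have hr1 : r < 1 := by linarith
  set κ := 16 * D * η * (-Real.log δ) with hκ
  have hκ0 : 0 < κ := by positivity
  have hinc : increment k A B E (δ * r) (2 * r) ≤ κ := by
    have h1 : 4 * (D * E σ) ≤ 4 * (D * (η * (-Real.log ε))) := by
      have := hE σ ⟨hσ0, hσ1⟩
      gcongr
    have h2 : 4 * (D * (η * (-Real.log ε))) ≤ 4 * (D * (η * (4 * (N + 1) * (-Real.log δ)))) := by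
      gcongr
    have h3 : (N + 1 : ℝ) * increment k A B E (δ * r) (2 * r) ≤ (N + 1) * κ := by
      refine hjle.trans (h1.trans (h2.trans (le_of_eq ?_)))
      rw [hκ]
      ring
    exact le_of_mul_le_mul_left h3 (by positivity)
  have hadd := h.increment_add hδr0 hδrr (by linarith : r ≤ 2 * r) (by linarith)
  have hn1 := h.increment_nonneg hδr0 hδrr hr1
  have hn2 := h.increment_nonneg hr0 (by linarith : r ≤ 2 * r) (by linarith)
  have hp2 : (1 : ℝ) ≤ 2 ^ (k + 2) := one_le_pow₀ (by norm_num)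
  have hX : 0 < η * (-Real.log δ) := by positivity
  have hκK : 2 ^ (k + 2) * κ ≤ K * η * (-Real.log δ) := by
    have : 0 ≤ (1 + A) * (η * (-Real.log δ)) := by positivity
    rw [hκ, hK]
    linarith only [this]
  have hκK' : κ ≤ K * η * (-Real.log δ) :=
    (le_mul_of_one_le_left hκ0.le hp2).trans hκK
  refine ⟨r, ?_, hrδ, ?_, ?_, ?_⟩
  · refine hθ0.trans_le ?_
    rw [hr]
    gcongr ?_ * ?_
    exact pow_le_pow_of_le_one hδ.le (by linarith) (by omega)
  · have h1 := h.le_increment hr0 (by linarith : r ≤ 2 * r) (by linarith)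
    have h2 := h.R_nonneg r (2 * r) hr0 (by linarith) (by linarith)
    have hP := h.P_nonneg r ⟨hr0, hr1⟩
    have h3 : r * (((2 * r) ^ (k + 2))⁻¹ * P r) ≤
        ∫ τ in r..(2 * r), (τ ^ (k + 2))⁻¹ * P τ := by
      have := intervalIntegral.integral_mono_on (by linarith : r ≤ 2 * r)
        (intervalIntegrable_const (c := ((2 * r) ^ (k + 2))⁻¹ * P r))
        (intervalIntegrable_inv_pow_mul h.mono_P (k + 2) hr0 (by linarith) (by linarith))
        fun τ hτ => by
          have h4 : 0 < τ := hr0.trans_le hτ.1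
          have h5 := hτ.2
          have h6 : P r ≤ P τ := h.mono_P ⟨hr0, hr1⟩ ⟨h4, by linarith⟩ hτ.1
          gcongr
      rw [intervalIntegral.integral_const, smul_eq_mul] at this
      linarith
    have e : (r ^ (k + 1))⁻¹ * P r = 2 ^ (k + 2) * (r * (((2 * r) ^ (k + 2))⁻¹ * P r)) := by
      clear_value r
      rw [mul_pow, pow_succ r (k + 1)]
      field_simp
    rw [e]
    refine le_trans (mul_le_mul_of_nonneg_left ?_ (by positivity)) hκK
    linarith
  · refine le_trans (h.le_increment hδr0 hδrr hr1) ?_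
    linarith
  · have h1 := h.scaled_le hr0 hr1
    have hE0 := h.E_nonneg (δ * r) ⟨hδr0, by linarith⟩
    have h2 : ((δ * r) ^ (k + 1))⁻¹ + A * ((δ * r) ^ k)⁻¹ ≤ (1 + A) * ((δ * r) ^ (k + 1))⁻¹ := by
      have : ((δ * r) ^ k)⁻¹ ≤ ((δ * r) ^ (k + 1))⁻¹ := by
        gcongr ?_⁻¹
        exact pow_le_pow_of_le_one hδr0.le (by linarith) (by omega)
      have := mul_le_mul_of_nonneg_left this hA
      linarith
    have h3 := mul_le_mul_of_nonneg_right h2 hE0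
    have h4 : (1 + A) * ((δ * r) ^ (k + 1))⁻¹ * E (δ * r) ≤
        K * ((δ * r) ^ (k + 1))⁻¹ * E (δ * r) := by
      gcongr
      rw [hK]
      linarith [(by positivity : 0 < 2 ^ (k + 2) * (16 * D))]
    have h5 : 0 ≤ B * ∫ τ in (δ * r)..r, (τ ^ (k + 1))⁻¹ * E τ :=
      mul_nonneg hB (intervalIntegral.integral_nonneg hδrr fun τ hτ => by
        have h0 : 0 < τ := hδr0.trans_le hτ.1
        exact mul_nonneg (by positivity) (h.E_nonneg τ ⟨h0, hτ.2.trans_lt hr1⟩))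
    have h6 : increment k A B E (δ * r) r ≤ κ := by linarith
    unfold increment at h6
    linarith

end GoodRadius

section Metrics
variable {n : ℕ}

theorem sqrtDet_mul_gradSq (g : Euc n → Matrix (Fin n) (Fin n) ℝ) (u ζ : Euc n → ℂ) (x : Euc n) :
    qf (sqrtDet g x • (g x)⁻¹) (grad u x) (grad ζ x) =
      (∑ i, ∑ j, (g x)⁻¹ i j * rdot (pd u i x) (pd ζ j x)) * sqrtDet g x := by
  simp only [qf, grad, Finset.sum_mul, rdot_eq_inner, Matrix.smul_apply, smul_eq_mul]
  exact Finset.sum_congr rfl fun i _ => Finset.sum_congr rfl fun j _ => by ring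

theorem dens_eq_eDen (g : Euc n → Matrix (Fin n) (Fin n) ℝ) (ε : ℝ) (u : Euc n → ℂ) :
    dens (fun x => sqrtDet g x • (g x)⁻¹) (sqrtDet g) ε u =
      fun x => eDen g ε u x * sqrtDet g x := by
  funext x
  rw [dens, sqrtDet_mul_gradSq, eDen, gradSq, potential]
  ring

theorem conormal_eq_radD (g : Euc n → Matrix (Fin n) (Fin n) ℝ) (u : Euc n → ℂ) {x : Euc n}
    (hx : 0 < ‖x‖) :
    conormal (fun x => sqrtDet g x • (g x)⁻¹) u x = (sqrtDet g x * ‖x‖) • radD g u x := by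
  simp only [conormal, radD, Finset.smul_sum, Matrix.smul_apply, smul_eq_mul]
  refine Finset.sum_congr rfl fun i _ => Finset.sum_congr rfl fun j _ => ?_
  rw [← Complex.real_smul, smul_smul]
  congr 1
  field_simp

theorem rpow_two_sub {r : ℝ} (hr : 0 < r) (m : ℕ) :
    r ^ ((2 : ℝ) - (m + 3 : ℕ)) = (r ^ (m + 1))⁻¹ := by
  rw [← Real.rpow_natCast, ← Real.rpow_neg hr.le]
  congr 1
  push_cast
  ring

theorem rpow_one_sub {r : ℝ} (hr : 0 < r) (m : ℕ) :
    r ^ ((1 : ℝ) - (m + 3 : ℕ)) = (r ^ (m + 2))⁻¹ := by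
  rw [← Real.rpow_natCast, ← Real.rpow_neg hr.le]
  congr 1
  push_cast
  ring

theorem IsGLSol.isSol {c L ε : ℝ} {g : Euc n → Matrix (Fin n) (Fin n) ℝ} {u : Euc n → ℂ}
    (hu : IsGLSol n g ε u) (hc : 0 < c) (hL : 1 ≤ L) (hε : 0 < ε)
    (hg : IsCoeff c L (fun x => sqrtDet g x • (g x)⁻¹) (sqrtDet g)) :
    IsSol c L ε (fun x => sqrtDet g x • (g x)⁻¹) (sqrtDet g) u := by
  obtain ⟨hd, h1, hi, hw⟩ := hu
  refine { hg with
    c_pos := hc, one_le_L := hL, ε_pos := hε, diff := hd, norm_le := h1, integrable_gsq := ?_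
    weak := fun ζ hζ hs => ?_ }
  · rw [← dens_eq_eDen] at hi
    refine (hi.const_mul (2 / c)).mono' (measurable_gsq u).aestronglyMeasurable ?_
    filter_upwards [ae_restrict_mem measurableSet_ball] with x hx
    have h2 := le_qf_self (hg.elliptic x hx) (grad u x)
    have h3 := mul_nonneg (hc.le.trans (hg.le_s x hx)) (potential_nonneg ε u x)
    rw [Real.norm_of_nonneg (gsq_nonneg u x), div_mul_eq_mul_div, le_div_iff₀ hc, dens]
    rw [← gsq] at h2
    linarith
  · rw [← hw ζ hζ hs]
    congr 1
    funext x
    rw [sqrtDet_mul_gradSq, rdot_eq_inner]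
    ring

end Metrics

section AlmostMonotonicity
variable {m : ℕ} {c L ε : ℝ} {a : Euc (m + 3) → Matrix (Fin (m + 3)) (Fin (m + 3)) ℝ}
  {s : Euc (m + 3) → ℝ} {u : Euc (m + 3) → ℂ}

theorem setIntegral_ball_mono {f : Euc (m + 3) → ℝ} (hf : IntegrableOn f (ball 0 1))
    (h0 : ∀ x ∈ ball (0 : Euc (m + 3)) 1, 0 ≤ f x) {r t : ℝ} (hrt : r ≤ t) (ht : t ≤ 1) :
    ∫ x in ball 0 r, f x ≤ ∫ x in ball 0 t, f x := by
  have hs := ball_subset_ball (x := (0 : Euc (m + 3))) ht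
  refine setIntegral_mono_set (hf.mono_set hs) ?_ (ball_subset_ball hrt).eventuallyLE
  filter_upwards [ae_restrict_mem measurableSet_ball] with x hx
  exact h0 x (hs hx)

theorem IsSol.almostMonotone (h : IsSol c L ε a s u) {A B : ℝ}
    (hA : A = (((m + 3 : ℕ) : ℝ) ^ 4 * L ^ 2 + ((m + 3 : ℕ) : ℝ) ^ 4 * L ^ 3 / c) * (2 / c))
    (hB : B = A * m + 2 * L * (m + 3) / c) :
    AlmostMonotone m A B (fun r => ∫ x in ball 0 r, dens a s ε u x)
      (fun r => ∫ x in ball 0 r, 2 * (s x * potential ε u x)) (radialGain m a s u) := by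
  have hc := h.c_pos
  have hL := h.L_nonneg
  have hA0 : 0 ≤ A := by rw [hA]; positivity
  have hdens := h.integrableOn_dens h.aesm_u h.norm_le h.integrable_gsq
  have hpot : IntegrableOn (fun x => 2 * (s x * potential ε u x)) (ball 0 1) :=
    (h.integrableOn_s_mul (h.integrableOn_potential h.aesm_u h.norm_le)).const_mul 2
  have hpot0 : ∀ x ∈ ball (0 : Euc (m + 3)) 1, 0 ≤ 2 * (s x * potential ε u x) := fun x hx =>
    mul_nonneg zero_le_two (mul_nonneg (h.s_nonneg hx) (potential_nonneg ε u x))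
  refine ⟨hA0, by rw [hB]; positivity, ?_, ?_, ?_, ?_, ?_, ?_⟩
  · exact fun r _ t ht hrt => setIntegral_ball_mono hdens (fun x hx => h.dens_nonneg hx) hrt ht.2.le
  · exact fun r _ t ht hrt => setIntegral_ball_mono hpot hpot0 hrt ht.2.le
  · exact fun r hr => setIntegral_nonneg measurableSet_ball fun x hx =>
      h.dens_nonneg (ball_subset_ball hr.2.le hx)
  · exact fun r hr => setIntegral_nonneg measurableSet_ball fun x hx =>
      hpot0 x (ball_subset_ball hr.2.le hx)
  · refine fun ρ σ _ _ hσ => setIntegral_nonneg (measurableSet_ball.diff measurableSet_ball)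
      fun x hx => ?_
    have := h.s_nonneg (ball_subset_ball hσ.le hx.1)
    positivity
  · exact fun ρ σ hρ hρσ hσ => h.monotonicity hρ hρσ hσ hA hB

end AlmostMonotonicity

/-- existence of a good radius `r₀ ∈ (ε^{1/2}, δ)` satisfying the three
estimates of Proposition "goodradius". -/
theorem stmt9 (n : ℕ) (hn : 3 ≤ n) (lam Lam : ℝ) (hlam : 0 < lam) (hLam : 0 < Lam) :
    ∃ ρ₀ K : ℝ, 0 < ρ₀ ∧ ρ₀ < 1 ∧ 0 < K ∧
      ∀ (g : Euc n → Matrix (Fin n) (Fin n) ℝ) (ε η : ℝ) (u : Euc n → ℂ),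
        0 < ε → MemM n lam Lam g → IsGLSol n g ε u → 0 < η →
        (∫ x in ball (0 : Euc n) 1, eDen g ε u x * sqrtDet g x) ≤ η * (-Real.log ε) →
        ∀ δ : ℝ, 0 < δ → δ < min (1 / 4) ρ₀ → ε < δ ^ 2 →
          ∃ r₀ : ℝ, Real.sqrt ε < r₀ ∧ r₀ < δ ∧
            (r₀ ^ ((2 : ℝ) - n) *
                (∫ x in ball (0 : Euc n) r₀,
                  (1 - ‖u x‖ ^ 2) ^ 2 / (2 * ε ^ 2) * sqrtDet g x)
              ≤ K * η * (-Real.log δ)) ∧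
            ((∫ s in (δ * r₀)..r₀, s ^ ((1 : ℝ) - n) *
                  ∫ x in ball (0 : Euc n) s,
                    (1 - ‖u x‖ ^ 2) ^ 2 / (2 * ε ^ 2) * sqrtDet g x)
                + (∫ x in ball (0 : Euc n) r₀ \ ball (0 : Euc n) (δ * r₀),
                    ‖x‖ ^ ((2 : ℝ) - n) * ‖radD g u x‖ ^ 2 * sqrtDet g x)
              ≤ K * η * (-Real.log δ)) ∧
            (r₀ ^ ((2 : ℝ) - n) * (∫ x in ball (0 : Euc n) r₀, eDen g ε u x * sqrtDet g x)
              ≤ K * (δ * r₀) ^ ((2 : ℝ) - n) *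
                  (∫ x in ball (0 : Euc n) (δ * r₀), eDen g ε u x * sqrtDet g x)
                + K * η * (-Real.log δ)) := by
  obtain ⟨m, rfl⟩ := Nat.exists_eq_add_of_le' hn
  obtain ⟨c, L, hc, hL, hcoeff⟩ := exists_isCoeff (m + 3) (by omega) (Lam := Lam) hlam
  have hL0 : 0 < L := one_pos.trans_le hL
  set A := (((m + 3 : ℕ) : ℝ) ^ 4 * L ^ 2 + ((m + 3 : ℕ) : ℝ) ^ 4 * L ^ 3 / c) * (2 / c) with hA
  set B := A * m + 2 * L * (m + 3) / c with hB
  have hA0 : 0 ≤ A := by positivity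
  have hB0 : 0 ≤ B := by positivity
  obtain ⟨ρ₀, K, h0, h1, hK, H⟩ := exists_good_radius m hA0 hB0
  refine ⟨ρ₀, K, h0, h1, hK, fun g ε η u hε hg hu hη hE δ hδ hδ' hεδ => ?_⟩
  have h := hu.isSol hc hL hε (hcoeff g hg)
  have hdens := h.integrableOn_dens h.aesm_u h.norm_le h.integrable_gsq
  obtain ⟨r, hr1, hr2, h2, h3, h4⟩ := H _ _ _ (h.almostMonotone hA hB) ε η hε hη
    (fun t ht => (setIntegral_ball_mono hdens (fun x hx => h.dens_nonneg hx) ht.2.le le_rfl).trans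
      (by rwa [dens_eq_eDen])) δ hδ hδ' hεδ
  have hr0 : 0 < r := (Real.sqrt_nonneg ε).trans_lt hr1
  have hδr : 0 < δ * r := by positivity
  have hδ1 : δ < 1 := (hδ'.trans_le (min_le_left _ _)).trans (by norm_num)
  have hp : (fun x => 2 * (sqrtDet g x * potential ε u x)) =
      fun x => (1 - ‖u x‖ ^ 2) ^ 2 / (2 * ε ^ 2) * sqrtDet g x := by
    funext x
    rw [potential]
    field_simp
    ring
  have hrad : radialGain m (fun x => sqrtDet g x • (g x)⁻¹) (sqrtDet g) u (δ * r) r =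
      ∫ x in ball (0 : Euc (m + 3)) r \ ball (0 : Euc (m + 3)) (δ * r),
        ‖x‖ ^ ((2 : ℝ) - (m + 3 : ℕ)) * ‖radD g u x‖ ^ 2 * sqrtDet g x := by
    refine setIntegral_congr_fun (measurableSet_ball.diff measurableSet_ball) fun x hx => ?_
    have hs : 0 < sqrtDet g x :=
      hc.trans_le (h.le_s x (ball_subset_ball (hr2.trans hδ1).le hx.1))
    have hx0 : 0 < ‖x‖ := by
      have := hx.2
      rw [mem_ball_zero_iff, not_lt] at this
      exact hδr.trans_le this
    rw [conormal_eq_radD g u hx0, rpow_two_sub hx0, norm_smul,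
      Real.norm_of_nonneg (by positivity : 0 ≤ sqrtDet g x * ‖x‖)]
    field_simp
    ring
  have hint : (∫ τ in (δ * r)..r, τ ^ ((1 : ℝ) - (m + 3 : ℕ)) *
      ∫ x in ball (0 : Euc (m + 3)) τ, (1 - ‖u x‖ ^ 2) ^ 2 / (2 * ε ^ 2) * sqrtDet g x) =
      ∫ τ in (δ * r)..r, (τ ^ (m + 2))⁻¹ *
        ∫ x in ball (0 : Euc (m + 3)) τ, (1 - ‖u x‖ ^ 2) ^ 2 / (2 * ε ^ 2) * sqrtDet g x := by
    refine intervalIntegral.integral_congr fun τ hτ => ?_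
    rw [Set.uIcc_of_le (mul_le_of_le_one_left hr0.le hδ1.le)] at hτ
    rw [rpow_one_sub (hδr.trans_le hτ.1)]
  simp only [hp] at h2 h3
  rw [hrad] at h3
  simp only [dens_eq_eDen] at h4
  refine ⟨r, hr1, hr2, ?_⟩
  rw [hint, rpow_two_sub hr0, rpow_two_sub hδr]
  exact ⟨h2, h3, h4⟩
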